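/- Let a be a positive integer which is not a perfect h-th power for any h ≥ 2, and write a = a1·a2² with a1 squarefree. Then, unconditionally, the natural densities δ_l = lim_{x→∞} #Q_a(x;4,l)/π(x) exist for l = 0 and l = 2, and: if a1 ≠ 2 then δ_0 = δ_2 = 1/3, while if a1 = 2 then δ_0 = 5/12 and δ_2 = 7/24. -/

import Mathlib

open scoped Classical

/-- The logarithmic integral `li x = ∫_2^x dt / log t`. -/
noncomputable def li (x : ℝ) : ℝ := ∫ t in (2:ℝ)..x, 1 / Real.log t

/-- `Qcount a x l = #Q_a(x;4,l)`: the number of odd primes `p ≤ x` with `p ∤ a` and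
the multiplicative order of `a` modulo `p` congruent to `l` mod `4`. -/
noncomputable def Qcount (a : ℕ) (x : ℝ) (l : ℕ) : ℕ :=
  Set.ncard {p : ℕ | p.Prime ∧ p ≠ 2 ∧ ¬(p ∣ a) ∧ (p : ℝ) ≤ x ∧
    orderOf (a : ZMod p) % 4 = l}

/-- `primePi x`: the number of primes `≤ x`. -/
noncomputable def primePi (x : ℝ) : ℕ := Set.ncard {p : ℕ | p.Prime ∧ (p : ℝ) ≤ x}

namespace QD
open MeasureTheory Filter Topology Set

/-- Fejer kernel -/
noncomputable def fk (v : ℝ) : ℝ := 2 * (1 - Real.cos v) / v ^ 2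

lemma fk_nonneg (v : ℝ) : 0 ≤ fk v := by
  unfold fk
  have := Real.cos_le_one v
  exact div_nonneg (by linarith) (sq_nonneg _)

lemma fk_le_one (v : ℝ) : fk v ≤ 1 := by
  unfold fk
  by_cases hv : v = 0
  · simp [hv]
  have := Real.one_sub_sq_div_two_le_cos (x := v)
  rw [div_le_one (by positivity)]
  linarith

lemma fk_le (v : ℝ) : fk v ≤ 5 * (1 + v ^ 2)⁻¹ := by
  by_cases hv : v = 0
  · simp [hv, fk]
  have h1 := fk_le_one v
  have h2 : fk v * v ^ 2 ≤ 4 := by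
    unfold fk
    rw [div_mul_cancel₀ _ (by positivity)]
    linarith [Real.neg_one_le_cos v]
  rw [← div_eq_mul_inv, le_div_iff₀ (by positivity)]
  linarith

lemma fk_meas : Measurable fk := by
  unfold fk; fun_prop

lemma fk_int : Integrable fk := by
  refine Integrable.mono' (integrable_inv_one_add_sq.const_mul 5) fk_meas.aestronglyMeasurable ?_
  filter_upwards with v
  rw [Real.norm_of_nonneg (fk_nonneg v)]
  exact fk_le v

lemma fk_integral_pos : 0 < ∫ v, fk v := by
  rw [integral_pos_iff_support_of_nonneg fk_nonneg fk_int]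
  refine lt_of_lt_of_le ?_ (measure_mono (s := Ioo 1 2) ?_)
  · simp
  · intro v hv
    rw [Function.mem_support]
    unfold fk
    have : Real.cos v < 1 := by
      have := Real.cos_lt_cos_of_nonneg_of_le_pi (x := 0) (y := v) le_rfl (by linarith [hv.2, Real.pi_gt_three]) (by linarith [hv.1])
      simpa using this
    have h3 : 0 < v := by linarith [hv.1]
    have : 0 < 2 * (1 - Real.cos v) / v ^ 2 := by
      apply div_pos <;> [linarith; positivity]
    exact this.ne'

lemma fk_fourier (v : ℝ) (hv : v ≠ 0) :
    ∫ t in (-1 : ℝ)..1, ((1 - |t| : ℝ) : ℂ) * Complex.exp (Complex.I * t * v) = (fk v : ℂ) := by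
  have hI : (Complex.I * v) ≠ 0 := by simp [hv]
  have hd : ∀ (t : ℝ), HasDerivAt (fun t : ℝ => Complex.exp (Complex.I * t * v)) (Complex.I * v * Complex.exp (Complex.I * t * v)) t := by
    intro t
    have h1 : HasDerivAt (fun z : ℂ => Complex.exp (Complex.I * z * v)) (Complex.exp (Complex.I * t * v) * (Complex.I * 1 * v)) (t:ℂ) :=
      (((hasDerivAt_id (t:ℂ)).const_mul Complex.I).mul_const (v:ℂ)).cexp
    convert h1.comp_ofReal using 1
    ring
  have hc : Continuous (fun t : ℝ => ((1 - |t| : ℝ) : ℂ) * Complex.exp (Complex.I * t * v)) := by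
    fun_prop
  rw [← intervalIntegral.integral_add_adjacent_intervals (b := 0) (hc.intervalIntegrable _ _) (hc.intervalIntegrable _ _)]
  have e1 : ∫ t in (-1 : ℝ)..0, ((1 - |t| : ℝ) : ℂ) * Complex.exp (Complex.I * t * v)
      = ∫ t in (-1 : ℝ)..0, (1 + t : ℂ) * Complex.exp (Complex.I * t * v) := by
    apply intervalIntegral.integral_congr
    intro t ht
    rw [uIcc_of_le (by norm_num)] at ht
    simp only [abs_of_nonpos ht.2]
    push_cast; ring
  have e2 : ∫ t in (0 : ℝ)..1, ((1 - |t| : ℝ) : ℂ) * Complex.exp (Complex.I * t * v)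
      = ∫ t in (0 : ℝ)..1, (1 - t : ℂ) * Complex.exp (Complex.I * t * v) := by
    apply intervalIntegral.integral_congr
    intro t ht
    rw [uIcc_of_le (by norm_num)] at ht
    simp only [abs_of_nonneg ht.1]
    push_cast; ring
  have hid : ∀ t : ℝ, HasDerivAt (fun t : ℝ => (t : ℂ)) 1 t := fun t => by
    simpa using (hasDerivAt_id (t:ℂ)).comp_ofReal
  rw [e1, e2,
    intervalIntegral.integral_eq_sub_of_hasDerivAt
      (f := fun t : ℝ => ((1 + t : ℂ) / (Complex.I * v) - 1 / (Complex.I * v) ^ 2) * Complex.exp (Complex.I * t * v)),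
    intervalIntegral.integral_eq_sub_of_hasDerivAt
      (f := fun t : ℝ => ((1 - t : ℂ) / (Complex.I * v) + 1 / (Complex.I * v) ^ 2) * Complex.exp (Complex.I * t * v))]
  · unfold fk
    have h1 : Complex.exp (Complex.I * (1:ℝ) * v) + Complex.exp (Complex.I * (-1:ℝ) * v) = 2 * Complex.cos v := by
      rw [Complex.cos]
      push_cast
      rw [mul_div_cancel₀ _ two_ne_zero]
      congr 2 <;> ring
    push_cast at h1 ⊢
    have h2 : Complex.exp (Complex.I * 1 * v) = 2 * Complex.cos v - Complex.exp (Complex.I * (-1) * v) := by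
      rw [← h1]; ring
    rw [h2]
    have hv' : (v : ℂ) ≠ 0 := by exact_mod_cast hv
    simp only [mul_zero, zero_mul, Complex.exp_zero]
    field_simp
    simp only [Complex.I_sq]
    ring
  · intro t _
    refine HasDerivAt.congr_deriv (((((hasDerivAt_const t (1:ℂ)).sub (hid t)).div_const (Complex.I * v)).add_const (1 / (Complex.I * v) ^ 2)).mul (hd t)) ?_
    have hv' : (v : ℂ) ≠ 0 := by exact_mod_cast hv
    simp only [Pi.add_apply, Pi.sub_apply]
    field_simp
    ring
  · apply Continuous.intervalIntegrable; fun_prop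
  · intro t _
    refine HasDerivAt.congr_deriv (((((hasDerivAt_const t (1:ℂ)).add (hid t)).div_const (Complex.I * v)).sub_const (1 / (Complex.I * v) ^ 2)).mul (hd t)) ?_
    have hv' : (v : ℂ) ≠ 0 := by exact_mod_cast hv
    simp only [Pi.add_apply, Pi.sub_apply]
    field_simp
    ring
  · apply Continuous.intervalIntegrable; fun_prop

end QD

namespace QD
open MeasureTheory Filter Topology Set

lemma taub1 (f : ℝ → ℝ) (hf : Measurable f) (C : ℝ) (hC : ∀ u, |f u| ≤ C) (σ : ℝ) (hσ : 0 < σ)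
    (T y : ℝ) (hT : 0 < T) :
    ∫ t in (-1:ℝ)..1, ((1 - |t| : ℝ) : ℂ) * Complex.exp (Complex.I * t * (T * y)) *
      (∫ u in Ioi (0:ℝ), (f u : ℂ) * Complex.exp (-(σ + Complex.I * (T * t)) * u)) =
    ∫ u in Ioi (0:ℝ), (f u : ℂ) * Complex.exp (-σ * u) * fk (T * (y - u)) := by
  have hC0 : 0 ≤ C := (abs_nonneg _).trans (hC 0)
  rw [intervalIntegral.integral_of_le (by norm_num)]
  simp_rw [← integral_const_mul]
  rw [integral_integral_swap]
  · apply integral_congr_ae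
    have : ∀ᵐ u : ℝ ∂(volume.restrict (Ioi 0)), u ≠ y := by
      apply ae_restrict_of_ae
      simp [ae_iff]
    filter_upwards [this] with u hu
    rw [← fk_fourier _ (by
      apply mul_ne_zero hT.ne'
      exact sub_ne_zero.mpr (Ne.symm hu)), intervalIntegral.integral_of_le (by norm_num),
      ← integral_const_mul]
    congr 1
    ext t
    have : Complex.exp (Complex.I * t * (T * y)) * Complex.exp (-(σ + Complex.I * (T * t)) * u) =
      Complex.exp (-σ * u) * Complex.exp (Complex.I * t * (T * (y - u) : ℝ)) := by
      rw [← Complex.exp_add, ← Complex.exp_add]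
      congr 1
      push_cast
      ring
    linear_combination ((1 - |t| : ℝ) : ℂ) * (f u) * this
  · have h1 : IntegrableOn (fun _ : ℝ => (1:ℝ)) (Ioc (-1) 1) := by
      apply integrableOn_const <;> simp
    have h2 : IntegrableOn (fun u : ℝ => C * Real.exp (-σ * u)) (Ioi 0) :=
      (integrableOn_exp_mul_Ioi (by linarith) 0).const_mul C
    refine Integrable.mono' (h1.mul_prod h2) ?_ ?_
    · apply Measurable.aestronglyMeasurable
      unfold Function.uncurry
      fun_prop
    · rw [Measure.prod_restrict]
      refine (ae_restrict_iff' (measurableSet_Ioc.prod measurableSet_Ioi)).mpr ?_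
      filter_upwards with p hp
      obtain ⟨t, u⟩ := p
      simp only [Function.uncurry_apply_pair, norm_mul, Complex.norm_real, Complex.norm_exp]
      have ht : |t| ≤ 1 := abs_le.mpr ⟨hp.1.1.le, hp.1.2⟩
      have e1 : (Complex.I * t * (T * y)).re = 0 := by simp
      have e2 : (-(σ + Complex.I * (T * t)) * u : ℂ).re = -σ * u := by simp
      rw [e1, e2, Real.exp_zero, mul_one, Real.norm_eq_abs, Real.norm_eq_abs, abs_of_nonneg (by linarith)]
      have := abs_nonneg t
      calc _ ≤ 1 * (C * Real.exp (-σ * u)) := by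
            gcongr
            · linarith
            · exact hC u
        _ = _ := by ring

lemma taub2 (f : ℝ → ℝ) (hf : Measurable f) (C : ℝ) (hC : ∀ u, |f u| ≤ C)
    (G : ℂ → ℂ) (hG : ContinuousOn G {s | 0 ≤ s.re})
    (hfG : ∀ s : ℂ, 0 < s.re → ∫ u in Ioi (0:ℝ), (f u : ℂ) * Complex.exp (-s * u) = G s)
    (T y : ℝ) (hT : 0 < T) :
    ((∫ u in Ioi (0:ℝ), f u * fk (T * (y - u)) : ℝ) : ℂ) =
      ∫ t in (-1:ℝ)..1, ((1 - |t| : ℝ) : ℂ) * Complex.exp (Complex.I * t * (T * y)) *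
        G (Complex.I * (T * t)) := by
  have hC0 : 0 ≤ C := (abs_nonneg _).trans (hC 0)
  have key : ∀ σ : ℝ, 0 < σ → 
     ∫ t in (-1:ℝ)..1, ((1 - |t| : ℝ) : ℂ) * Complex.exp (Complex.I * t * (T * y)) *
        G (σ + Complex.I * (T * t)) = ∫ u in Ioi (0:ℝ), (f u : ℂ) * Complex.exp (-σ * u) * fk (T * (y - u)) := by
    intro σ hσ
    rw [← taub1 f hf C hC σ hσ T y hT]
    apply intervalIntegral.integral_congr
    intro t _
    simp only
    rw [hfG _ (by simpa using hσ)]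
  have hk : Integrable (fun u => fk (T * (y - u))) := 
    (fk_int.comp_mul_left' hT.ne').comp_sub_left y
  -- limit of RHS
  have l1 : Tendsto (fun σ : ℝ => ∫ u in Ioi (0:ℝ), (f u : ℂ) * Complex.exp (-σ * u) * fk (T * (y - u))) (𝓝[>] 0)
      (𝓝 (∫ u in Ioi (0:ℝ), (f u : ℂ) * fk (T * (y - u)))) := by
    apply tendsto_integral_filter_of_dominated_convergence (fun u => C * fk (T * (y - u)))
    · filter_upwards with σ
      apply Measurable.aestronglyMeasurable
      have := fk_meas
      fun_prop
    · filter_upwards [self_mem_nhdsWithin] with σ hσ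
      rw [ae_restrict_iff' measurableSet_Ioi]
      filter_upwards with u hu
      simp only [norm_mul, Complex.norm_real, Complex.norm_exp, Real.norm_eq_abs, abs_of_nonneg (fk_nonneg _)]
      gcongr
      · exact fk_nonneg _
      · calc _ ≤ C * 1 := by
              gcongr
              · exact hC u
              · rw [Real.exp_le_one_iff]
                simp only [neg_mul, Complex.neg_re, ← Complex.ofReal_mul, Complex.ofReal_re]
                have := mul_pos (mem_Ioi.mp hσ) (mem_Ioi.mp hu)
                linarith
          _ = C := mul_one C
    · exact (hk.const_mul C).restrict
    · filter_upwards with u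
      have : Tendsto (fun σ : ℝ => (f u : ℂ) * Complex.exp (-σ * u) * fk (T * (y - u))) (𝓝 0)
          (𝓝 ((f u : ℂ) * Complex.exp (-(0:ℝ) * u) * fk (T * (y - u)))) := by
        apply Continuous.tendsto' (by fun_prop)
        rfl
      simp only [Complex.ofReal_zero, neg_zero, zero_mul, Complex.exp_zero, mul_one] at this
      exact this.mono_left nhdsWithin_le_nhds
  have l2 : Tendsto (fun σ : ℝ => ∫ t in (-1:ℝ)..1, ((1 - |t| : ℝ) : ℂ) * Complex.exp (Complex.I * t * (T * y)) *
        G (σ + Complex.I * (T * t))) (𝓝[>] 0)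
      (𝓝 (∫ t in (-1:ℝ)..1, ((1 - |t| : ℝ) : ℂ) * Complex.exp (Complex.I * t * (T * y)) *
        G (Complex.I * (T * t)))) := by
    have hcomp : ContinuousOn (fun p : ℝ × ℝ => G (p.1 + Complex.I * (T * p.2))) (Icc 0 1 ×ˢ Icc (-1) 1) := by
      apply hG.comp (by fun_prop)
      intro p hp
      simpa using hp.1.1
    obtain ⟨B, hB⟩ := (isCompact_Icc.prod isCompact_Icc).exists_bound_of_continuousOn hcomp
    have hpt : ∀ σ ∈ Icc (0:ℝ) 1, ContinuousOn (fun t : ℝ => G (σ + Complex.I * (T * t))) (Icc (-1) 1) := by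
      intro σ hσ
      exact hcomp.comp (f := fun t => (σ, t)) (by fun_prop) (fun t ht => ⟨hσ, ht⟩)
    have hev : ∀ᶠ σ in 𝓝[>] (0:ℝ), σ ∈ Icc (0:ℝ) 1 := by
      filter_upwards [Ioc_mem_nhdsGT (zero_lt_one)] with σ hσ using ⟨hσ.1.le, hσ.2⟩
    have h01 : uIoc (-1:ℝ) 1 ⊆ Icc (-1) 1 := by
      rw [uIoc_of_le (by norm_num)]; exact Ioc_subset_Icc_self
    apply intervalIntegral.tendsto_integral_filter_of_dominated_convergence (fun _ => B)
    · filter_upwards [hev] with σ hσ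
      apply ContinuousOn.aestronglyMeasurable _ measurableSet_uIoc
      apply ContinuousOn.mul (by fun_prop)
      exact (hpt σ hσ).mono h01
    · filter_upwards [hev] with σ hσ
      filter_upwards with t ht
      have ht' := h01 ht
      have e1 : (Complex.I * t * (T * y)).re = 0 := by simp
      rw [norm_mul, norm_mul, Complex.norm_exp, e1, Real.exp_zero, mul_one, Complex.norm_real, Real.norm_eq_abs,
        abs_of_nonneg (by linarith [abs_le.mpr ht'])]
      calc _ ≤ 1 * B := by
            gcongr
            · linarith [abs_nonneg t]
            · exact hB (σ, t) ⟨hσ, ht'⟩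
        _ = B := one_mul B
    · simp
    · filter_upwards with t ht
      apply Tendsto.const_mul
      have h0 : ContinuousWithinAt G {s | 0 ≤ s.re} (Complex.I * (T * t)) := hG _ (by simp)
      refine h0.tendsto.comp (tendsto_nhdsWithin_iff.mpr ⟨?_, ?_⟩)
      · refine Tendsto.mono_left ?_ nhdsWithin_le_nhds
        apply Continuous.tendsto' (by fun_prop)
        simp
      · filter_upwards [self_mem_nhdsWithin] with σ hσ
        simpa using (le_of_lt hσ)
  have : Tendsto (fun σ : ℝ => ∫ t in (-1:ℝ)..1, ((1 - |t| : ℝ) : ℂ) * Complex.exp (Complex.I * t * (T * y)) *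
        G (σ + Complex.I * (T * t))) (𝓝[>] 0) (𝓝 (∫ u in Ioi (0:ℝ), (f u : ℂ) * fk (T * (y - u)))) := by
    apply l1.congr'
    filter_upwards [self_mem_nhdsWithin] with σ hσ using (key σ hσ).symm
  rw [← tendsto_nhds_unique this l2, ← integral_complex_ofReal]
  simp

lemma taub3 (f : ℝ → ℝ) (hf : Measurable f) (C : ℝ) (hC : ∀ u, |f u| ≤ C)
    (G : ℂ → ℂ) (hG : ContinuousOn G {s | 0 ≤ s.re})
    (hfG : ∀ s : ℂ, 0 < s.re → ∫ u in Ioi (0:ℝ), (f u : ℂ) * Complex.exp (-s * u) = G s)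
    (T : ℝ) (hT : 0 < T) :
    Tendsto (fun y : ℝ => ∫ u in Ioi (0:ℝ), f u * fk (T * (y - u))) atTop (𝓝 0) := by
  have h1 := Real.tendsto_integral_exp_smul_cocompact 
    (Set.indicator (Ioc (-1:ℝ) 1) (fun t : ℝ => ((1 - |t| : ℝ) : ℂ) * G (Complex.I * (T * t))))
  have h2 : Tendsto (fun y : ℝ => -(T * y / (2 * Real.pi))) atTop (cocompact ℝ) := by
    rw [cocompact_eq_atBot_atTop]
    apply Tendsto.mono_right _ le_sup_left
    apply tendsto_neg_atTop_atBot.comp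
    apply Tendsto.atTop_div_const (by positivity)
    exact Tendsto.const_mul_atTop hT tendsto_id
  have h3 := h1.comp h2
  have h4 : Tendsto (fun y : ℝ => ((∫ u in Ioi (0:ℝ), f u * fk (T * (y - u)) : ℝ) : ℂ)) atTop (𝓝 0) := by
    refine h3.congr fun y => ?_
    rw [taub2 f hf C hC G hG hfG T y hT, intervalIntegral.integral_of_le (by norm_num),
      ← integral_indicator measurableSet_Ioc]
    simp only [Function.comp_apply]
    congr 1
    ext t
    by_cases ht : t ∈ Ioc (-1:ℝ) 1
    · rw [indicator_of_mem ht, indicator_of_mem ht, Circle.smul_def, Real.fourierChar_apply, smul_eq_mul]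
      have : (2 * Real.pi * (-(t * -(T * y / (2 * Real.pi)))) : ℝ) = t * (T * y) := by
        field_simp
      rw [this]
      push_cast
      rw [show Complex.I * t * (T * y) = t * (T * y) * Complex.I by ring]
      ring
    · rw [indicator_of_notMem ht, indicator_of_notMem ht, smul_zero]
  have := (Complex.continuous_re.tendsto 0).comp h4
  simpa [Function.comp_def] using this

end QD

namespace QD
open MeasureTheory Filter Topology Set

lemma fkc_int (T y : ℝ) (hT : 0 < T) : Integrable (fun u => fk (T * (y - u))) :=
  (fk_int.comp_mul_left' hT.ne').comp_sub_left y

lemma fkc_total (T y : ℝ) (hT : 0 < T) : ∫ u, fk (T * (y - u)) = T⁻¹ * ∫ v, fk v := by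
  rw [integral_sub_left_eq_self (fun u => fk (T * u)) volume y, Measure.integral_comp_mul_left]
  rw [abs_of_pos (by positivity), smul_eq_mul]

lemma fkc_mid (R y : ℝ) (hR : 0 < R) : ∫ u in (y - R⁻¹)..(y + R⁻¹), fk (R ^ 2 * (y - u)) =
    (R ^ 2)⁻¹ * ∫ v in (-R)..R, fk v := by
  have := intervalIntegral.integral_comp_sub_mul (a := y - R⁻¹) (b := y + R⁻¹) fk (c := R ^ 2) (by positivity) (R ^ 2 * y)
  simp_rw [mul_sub]
  rw [this, smul_eq_mul]
  congr 2 <;> (field_simp; ring)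

theorem taub (β : ℝ → ℝ) (hβ : Measurable β) (C c : ℝ) (h0 : ∀ u, 0 ≤ β u) (hC : ∀ u, β u ≤ C)
    (hmono : ∀ u v, u ≤ v → β u * Real.exp (-(v - u)) ≤ β v)
    (G : ℂ → ℂ) (hG : ContinuousOn G {s | 0 ≤ s.re})
    (hfG : ∀ s : ℂ, 0 < s.re → ∫ u in Ioi (0:ℝ), ((β u - c : ℝ) : ℂ) * Complex.exp (-s * u) = G s) :
    Tendsto β atTop (𝓝 c) := by
  set κ := ∫ v, fk v with hκ
  have hκ0 : 0 < κ := fk_integral_pos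
  have hC0 : 0 ≤ C := (h0 0).trans (hC 0)
  -- half integral
  have hhalf : ∀ T : ℝ, 0 < T → Tendsto (fun y : ℝ => ∫ u in Ioi (0:ℝ), fk (T * (y - u))) atTop (𝓝 (T⁻¹ * κ)) := by
    intro T hT
    have e : ∀ y : ℝ, ∫ u in Ioi (0:ℝ), fk (T * (y - u)) = ∫ w, (Iio y).indicator (fun w => fk (T * w)) w := by
      intro y
      rw [← integral_sub_left_eq_self _ volume y, ← integral_indicator measurableSet_Ioi]
      congr 1
      ext u
      simp [indicator_apply]
    simp_rw [e]
    have e2 : T⁻¹ * κ = ∫ w, fk (T * w) := by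
      rw [Measure.integral_comp_mul_left, abs_of_pos (by positivity), smul_eq_mul]
    rw [e2]
    have hi : Integrable (fun w => fk (T * w)) := fk_int.comp_mul_left' hT.ne'
    apply tendsto_integral_filter_of_dominated_convergence (fun w => fk (T * w))
    · filter_upwards with y
      exact hi.aestronglyMeasurable.indicator measurableSet_Iio
    · filter_upwards with y
      filter_upwards with w
      rw [Real.norm_of_nonneg (indicator_nonneg (fun _ _ => fk_nonneg _) _)]
      exact indicator_le_self' (fun _ _ => fk_nonneg _) _
    · exact hi
    · filter_upwards with w
      apply tendsto_const_nhds.congr'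
      filter_upwards [eventually_gt_atTop w] with y hy
      rw [indicator_of_mem (mem_Iio.mpr hy)]
  have hβi : ∀ T y : ℝ, 0 < T → Integrable (fun u => β u * fk (T * (y - u))) := by
    intro T y hT
    apply (fkc_int T y hT).bdd_mul (c := C) hβ.aestronglyMeasurable
    filter_upwards with u
    rw [Real.norm_of_nonneg (h0 u)]; exact hC u
  have hS : ∀ T : ℝ, 0 < T → Tendsto (fun y : ℝ => T * ∫ u in Ioi (0:ℝ), β u * fk (T * (y - u))) atTop (𝓝 (c * κ)) := by
    intro T hT
    have h1 := taub3 (fun u => β u - c) (hβ.sub_const c) (C + |c|) (fun u => by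
      calc |β u - c| ≤ |β u| + |c| := abs_sub _ _
        _ ≤ C + |c| := by rw [abs_of_nonneg (h0 u)]; gcongr; exact hC u) G hG hfG T hT
    have h2 := ((h1.add ((hhalf T hT).const_mul c))).const_mul T
    have e : T * (0 + c * (T⁻¹ * κ)) = c * κ := by field_simp; ring
    rw [e] at h2
    refine h2.congr fun y => ?_
    rw [← integral_const_mul, ← integral_add]
    · congr 2
      ext u
      ring
    · have : (fun u => (β u - c) * fk (T * (y - u))) = fun u => β u * fk (T * (y - u)) - c * fk (T * (y - u)) := by
        ext u; ring
      rw [this]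
      exact ((hβi T y hT).sub ((fkc_int T y hT).const_mul c)).restrict
    · exact ((fkc_int T y hT).const_mul c).restrict
  set κR : ℝ → ℝ := fun R => ∫ v in (-R)..R, fk v with hκR
  have hκRlim : Tendsto κR atTop (𝓝 κ) :=
    intervalIntegral_tendsto_integral fk_int tendsto_neg_atTop_atBot tendsto_id
  have hlo : ∀ R y : ℝ, 0 < R → R⁻¹ ≤ y → β (y - R⁻¹) * (Real.exp (-2 * R⁻¹) * κR R) ≤
      R ^ 2 * ∫ u in Ioi (0:ℝ), β u * fk (R ^ 2 * (y - u)) := by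
    intro R y hR hy
    have hT : 0 < R ^ 2 := by positivity
    have hRi : 0 < R⁻¹ := by positivity
    have s1 : ∫ u in (y - R⁻¹)..(y + R⁻¹), β (y - R⁻¹) * Real.exp (-2 * R⁻¹) * fk (R ^ 2 * (y - u)) ≤
        ∫ u in (y - R⁻¹)..(y + R⁻¹), β u * fk (R ^ 2 * (y - u)) := by
      apply intervalIntegral.integral_mono_on (by linarith)
      · exact ((fkc_int _ y hT).const_mul _).intervalIntegrable
      · exact (hβi _ y hT).intervalIntegrable
      · intro u hu
        gcongr
        · exact fk_nonneg _
        · refine le_trans ?_ (hmono (y - R⁻¹) u hu.1)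
          gcongr
          · exact h0 _
          · linarith [hu.2]
    have s2 : ∫ u in (y - R⁻¹)..(y + R⁻¹), β u * fk (R ^ 2 * (y - u)) ≤ ∫ u in Ioi (0:ℝ), β u * fk (R ^ 2 * (y - u)) := by
      rw [intervalIntegral.integral_of_le (by linarith)]
      apply setIntegral_mono_set (hβi _ y hT).restrict
      · filter_upwards with u using mul_nonneg (h0 _) (fk_nonneg _)
      · apply Eventually.of_forall
        intro u hu
        exact lt_of_le_of_lt (by linarith) hu.1
    rw [intervalIntegral.integral_const_mul, fkc_mid R y hR] at s1
    have s3 := mul_le_mul_of_nonneg_left (s1.trans s2) hT.le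
    refine le_trans (le_of_eq ?_) s3
    field_simp
    rfl
  have hup : ∀ R y : ℝ, 0 < R → R⁻¹ ≤ y → R ^ 2 * ∫ u in Ioi (0:ℝ), β u * fk (R ^ 2 * (y - u)) ≤
      β (y + R⁻¹) * Real.exp (2 * R⁻¹) * κR R + C * (κ - κR R) := by
    intro R y hR hy
    have hT : 0 < R ^ 2 := by positivity
    have hRi : 0 < R⁻¹ := by positivity
    have s1 : ∫ u in Ioi (0:ℝ), β u * fk (R ^ 2 * (y - u)) ≤ ∫ u, β u * fk (R ^ 2 * (y - u)) := by
      apply setIntegral_le_integral (hβi _ y hT)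
      filter_upwards with u using mul_nonneg (h0 _) (fk_nonneg _)
    have s2 : ∫ u, β u * fk (R ^ 2 * (y - u)) ≤ ∫ u, (C * fk (R ^ 2 * (y - u)) +
        (Ioc (y - R⁻¹) (y + R⁻¹)).indicator (fun u => (β (y + R⁻¹) * Real.exp (2 * R⁻¹) - C) * fk (R ^ 2 * (y - u))) u) := by
      apply integral_mono (hβi _ y hT)
      · exact ((fkc_int _ y hT).const_mul _).add (((fkc_int _ y hT).const_mul _).indicator measurableSet_Ioc)
      · intro u
        simp only
        by_cases hu : u ∈ Ioc (y - R⁻¹) (y + R⁻¹)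
        · rw [indicator_of_mem hu, ← add_mul]
          gcongr
          · exact fk_nonneg _
          · have h3 := hmono u (y + R⁻¹) hu.2
            have h4 : β u ≤ β (y + R⁻¹) * Real.exp (y + R⁻¹ - u) := by
              calc β u = β u * Real.exp (-(y + R⁻¹ - u)) * Real.exp (y + R⁻¹ - u) := by
                    rw [mul_assoc, ← Real.exp_add]; simp
                _ ≤ _ := by gcongr
            have h5 : β (y + R⁻¹) * Real.exp (y + R⁻¹ - u) ≤ β (y + R⁻¹) * Real.exp (2 * R⁻¹) := by
              gcongr
              · exact h0 _
              · linarith [hu.1]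
            linarith
        · rw [indicator_of_notMem hu, add_zero]
          gcongr
          · exact fk_nonneg _
          · exact hC u
    rw [integral_add ((fkc_int _ y hT).const_mul _) (((fkc_int _ y hT).const_mul _).indicator measurableSet_Ioc),
      integral_indicator measurableSet_Ioc, ← intervalIntegral.integral_of_le (by linarith),
      intervalIntegral.integral_const_mul, fkc_mid R y hR, integral_const_mul, fkc_total _ _ hT] at s2
    have s3 := mul_le_mul_of_nonneg_left (s1.trans s2) hT.le
    refine s3.trans (le_of_eq ?_)
    simp only [hκR]
    field_simp
    ring
  have hinv : Tendsto (fun R : ℝ => R⁻¹) atTop (𝓝 0) := tendsto_inv_atTop_zero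
  rw [tendsto_order]
  constructor
  · intro a ha
    have l1 : Tendsto (fun R => (c * κ - C * (κ - κR R)) - a * Real.exp (2 * R⁻¹) * κR R) atTop (𝓝 ((c * κ - C * (κ - κ)) - a * Real.exp (2 * 0) * κ)) := by
      apply Tendsto.sub
      · exact tendsto_const_nhds.sub ((tendsto_const_nhds.sub hκRlim).const_mul C)
      · exact (((Real.continuous_exp.tendsto _).comp (hinv.const_mul 2)).const_mul a).mul hκRlim
    have hpos : 0 < (c * κ - C * (κ - κ)) - a * Real.exp (2 * 0) * κ := by
      simp; nlinarith
    have hev := (l1.eventually (lt_mem_nhds hpos)).and ((eventually_gt_atTop (0:ℝ)).and (hκRlim.eventually (lt_mem_nhds hκ0)))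
    obtain ⟨R, hR1, hR2, hR3⟩ := hev.exists
    have hev2 := (hS (R ^ 2) (by positivity)).eventually (lt_mem_nhds (show C * (κ - κR R) + a * Real.exp (2 * R⁻¹) * κR R < c * κ by linarith))
    have hsh : Tendsto (fun y : ℝ => y - R⁻¹) atTop atTop := tendsto_atTop_add_const_right _ _ tendsto_id
    filter_upwards [hsh.eventually hev2, hsh.eventually (eventually_ge_atTop R⁻¹)] with y hy1 hy2
    have := hup R (y - R⁻¹) hR2 hy2
    rw [sub_add_cancel] at this
    have h6 : a * (Real.exp (2 * R⁻¹) * κR R) < β y * (Real.exp (2 * R⁻¹) * κR R) := by linarith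
    exact lt_of_mul_lt_mul_right h6 (by positivity)
  · intro a ha
    have l1 : Tendsto (fun R => a * (Real.exp (-2 * R⁻¹) * κR R) - c * κ) atTop (𝓝 (a * (Real.exp (-2 * 0) * κ) - c * κ)) := by
      apply Tendsto.sub _ tendsto_const_nhds
      exact (((Real.continuous_exp.tendsto _).comp (hinv.const_mul (-2))).mul hκRlim).const_mul a
    have hpos : 0 < a * (Real.exp (-2 * 0) * κ) - c * κ := by
      simp; nlinarith
    have hev := (l1.eventually (lt_mem_nhds hpos)).and ((eventually_gt_atTop (0:ℝ)).and (hκRlim.eventually (lt_mem_nhds hκ0)))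
    obtain ⟨R, hR1, hR2, hR3⟩ := hev.exists
    have hev2 := (hS (R ^ 2) (by positivity)).eventually (gt_mem_nhds (show c * κ < a * (Real.exp (-2 * R⁻¹) * κR R) by linarith))
    have hsh : Tendsto (fun y : ℝ => y + R⁻¹) atTop atTop := tendsto_atTop_add_const_right _ _ tendsto_id
    filter_upwards [hsh.eventually hev2, hsh.eventually (eventually_ge_atTop R⁻¹)] with y hy1 hy2
    have := hlo R (y + R⁻¹) hR2 hy2
    rw [add_sub_cancel_right] at this
    exact lt_of_mul_lt_mul_right (this.trans_lt hy1) (by positivity)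

end QD

namespace QD
open MeasureTheory Filter Topology Set

theorem WI (b : ℕ → ℝ) (hb : ∀ n, 0 ≤ b n) (C c : ℝ) (hC : ∀ x : ℝ, 0 ≤ x → ∑ n ∈ Finset.Icc 1 ⌊x⌋₊, b n ≤ C * x)
    (G : ℂ → ℂ) (hG : ContinuousOn G {s | 1 ≤ s.re})
    (h : ∀ s : ℂ, 1 < s.re → LSeries (fun n => (b n : ℂ)) s = c / (s - 1) + G s) :
    Tendsto (fun x : ℝ => (∑ n ∈ Finset.Icc 1 ⌊x⌋₊, b n) / x) atTop (𝓝 c) := by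
  set B : ℝ → ℝ := fun x => ∑ n ∈ Finset.Icc 1 ⌊x⌋₊, b n with hB
  have hBm : Monotone B := fun x y hxy => by
    apply Finset.sum_le_sum_of_subset_of_nonneg
    · exact Finset.Icc_subset_Icc_right (Nat.floor_mono hxy)
    · intros; exact hb _
  have hB0 : ∀ x, 0 ≤ B x := fun x => Finset.sum_nonneg fun n _ => hb n
  set β : ℝ → ℝ := fun u => Real.exp (-u) * B (Real.exp u) with hβdef
  have hβ : Measurable β := by
    have := hBm.measurable
    fun_prop
  have hβ0 : ∀ u, 0 ≤ β u := fun u => mul_nonneg (Real.exp_nonneg _) (hB0 _)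
  have hβC : ∀ u, β u ≤ C := fun u => by
    have := hC (Real.exp u) (Real.exp_nonneg u)
    calc β u ≤ Real.exp (-u) * (C * Real.exp u) := by
          apply mul_le_mul_of_nonneg_left this (Real.exp_nonneg _)
      _ = C := by
          rw [mul_comm C, ← mul_assoc, ← Real.exp_add]; simp
  have hbO : (fun n : ℕ => ∑ k ∈ Finset.Icc 1 n, b k) =O[atTop] fun n => (n:ℝ) ^ (1:ℝ) := by
    apply Asymptotics.IsBigO.of_bound C
    filter_upwards with n
    have := hC n (by positivity)
    rw [Nat.floor_natCast] at this
    rw [Real.norm_of_nonneg (Finset.sum_nonneg fun n _ => hb n), Real.rpow_one, Real.norm_of_nonneg (by positivity)]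
    exact this
  have hlim : Tendsto β atTop (𝓝 c) := by
    refine taub β hβ C c hβ0 hβC ?_ (fun s => (G (s + 1) - c) / (s + 1)) ?_ ?_
    · intro u v huv
      simp only [hβdef]
      calc _ = Real.exp (-v) * B (Real.exp u) := by
            rw [mul_right_comm, ← Real.exp_add]; congr 2; ring
        _ ≤ _ := by
            gcongr
            exact hBm (Real.exp_le_exp.mpr huv)
    · apply ContinuousOn.div
      · apply ContinuousOn.sub _ continuousOn_const
        apply hG.comp (by fun_prop)
        intro s hs
        simpa using hs
      · fun_prop
      · intro s hs h0
        have := congrArg Complex.re h0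
        simp at this hs
        linarith
    · intro s hs
      have hs1 : s + 1 ≠ 0 := by
        intro h0
        have := congrArg Complex.re h0
        simp at this
        linarith
      have hs0 : s ≠ 0 := by
        rintro rfl; simp at hs
      have e1 := LSeries_eq_mul_integral_of_nonneg b (r := 1) zero_le_one (s := s + 1) (by simpa using hs) hbO hb
      rw [h _ (by simpa using hs)] at e1
      have himg : Real.exp '' (Ioi 0) = Ioi 1 := by
        ext x
        constructor
        · rintro ⟨u, hu, rfl⟩
          exact Real.one_lt_exp_iff.mpr hu
        · intro hx
          exact ⟨Real.log x, Real.log_pos hx, Real.exp_log (lt_trans zero_lt_one hx)⟩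
      have e2 : ∫ t in Ioi (1:ℝ), (∑ k ∈ Finset.Icc 1 ⌊t⌋₊, (b k : ℂ)) * (t:ℂ) ^ (-(s + 1 + 1)) =
          ∫ u in Ioi (0:ℝ), (β u : ℂ) * Complex.exp (-s * u) := by
        rw [← himg, integral_image_eq_integral_abs_deriv_smul measurableSet_Ioi
          (fun x _ => (Real.hasDerivAt_exp x).hasDerivWithinAt) (Real.exp_injective.injOn)]
        congr 1
        ext u
        have hBc : (∑ k ∈ Finset.Icc 1 ⌊Real.exp u⌋₊, (b k : ℂ)) = (B (Real.exp u) : ℂ) := by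
          simp [hB]
        rw [hBc, abs_of_pos (Real.exp_pos u), Complex.real_smul, Complex.cpow_def_of_ne_zero (by simp), ← Complex.ofReal_log (Real.exp_nonneg _), Real.log_exp]
        simp only [hβdef]
        push_cast
        have : Complex.exp u * Complex.exp (u * (-(s + 1 + 1))) = Complex.exp (-u) * Complex.exp (-s * u) := by
          rw [← Complex.exp_add, ← Complex.exp_add]; congr 1; ring
        linear_combination (B (Real.exp u) : ℂ) * this
      have i1 : IntegrableOn (fun u : ℝ => Complex.exp (-s * u)) (Ioi 0) :=
        integrableOn_exp_mul_complex_Ioi (by simpa using hs) 0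
      have i2 : IntegrableOn (fun u : ℝ => (β u : ℂ) * Complex.exp (-s * u)) (Ioi 0) := by
        apply i1.bdd_mul (c := C)
        · exact (Complex.measurable_ofReal.comp hβ).aestronglyMeasurable
        · filter_upwards with u
          rw [Complex.norm_real, Real.norm_of_nonneg (hβ0 u)]; exact hβC u
      have e3 : ∫ u in Ioi (0:ℝ), Complex.exp (-s * u) = 1 / s := by
        rw [integral_exp_mul_complex_Ioi (by simpa using hs)]
        simp
      simp only [Complex.ofReal_sub, sub_mul]
      rw [integral_sub i2 (i1.const_mul _), integral_const_mul, e3, ← e2]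
      rw [add_sub_cancel_right] at e1
      field_simp
      field_simp at e1
      linear_combination -e1
  have := hlim.comp Real.tendsto_log_atTop
  refine this.congr' ?_
  filter_upwards [eventually_gt_atTop 0] with x hx
  simp only [Function.comp, hβdef]
  rw [Real.exp_neg, Real.exp_log hx, inv_mul_eq_div]

end QD

namespace QD
open MeasureTheory Filter Topology Set

lemma zcont (a : ℕ → ℝ) (ha : ∀ n, 0 ≤ a n) (ρ θ C : ℝ) (hθ0 : 0 ≤ θ) (hθ : θ < 1)
    (hA : ∀ x : ℝ, 1 ≤ x → |∑ n ∈ Finset.Icc 1 ⌊x⌋₊, a n - ρ * x| ≤ C * x ^ θ) :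
    (∀ s : ℂ, 1 < s.re → LSeriesSummable (fun n => (a n : ℂ)) s) ∧
    ∃ g : ℂ → ℂ, (∀ s : ℂ, θ < s.re → DifferentiableAt ℂ g s) ∧ g 1 = ρ ∧
      ∀ s : ℂ, 1 < s.re → (s - 1) * LSeries (fun n => (a n : ℂ)) s = g s := by
  have hbO : (fun n : ℕ => ∑ k ∈ Finset.Icc 1 n, a k) =O[atTop] fun n => (n:ℝ) ^ (1:ℝ) := by
    apply Asymptotics.IsBigO.of_bound (|ρ| + |C|)
    filter_upwards [eventually_ge_atTop 1] with n hn
    have hn' : (1:ℝ) ≤ n := by exact_mod_cast hn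
    have h := hA n hn'
    rw [Nat.floor_natCast] at h
    rw [Real.norm_eq_abs, Real.rpow_one, Real.norm_of_nonneg (by positivity)]
    have h1 : (n:ℝ) ^ θ ≤ n := by
      calc (n:ℝ) ^ θ ≤ (n:ℝ) ^ (1:ℝ) := Real.rpow_le_rpow_of_exponent_le hn' hθ.le
        _ = n := Real.rpow_one _
    calc |∑ k ∈ Finset.Icc 1 n, a k| = |(∑ k ∈ Finset.Icc 1 n, a k - ρ * n) + ρ * n| := by ring_nf
      _ ≤ |∑ k ∈ Finset.Icc 1 n, a k - ρ * n| + |ρ * n| := abs_add_le _ _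
      _ ≤ |C| * n + |ρ| * n := by
          gcongr
          · refine h.trans ?_
            gcongr
            exact le_abs_self C
          · rw [abs_mul, abs_of_nonneg (by positivity : (0:ℝ) ≤ n)]
      _ = _ := by ring
  have hsum : ∀ s : ℂ, 1 < s.re → LSeriesSummable (fun n => (a n : ℂ)) s := fun s hs =>
    LSeriesSummable_of_sum_norm_bigO_and_nonneg hbO ha zero_le_one hs
  refine ⟨hsum, ?_⟩
  set A : ℝ → ℝ := fun x => ∑ n ∈ Finset.Icc 1 ⌊x⌋₊, a n with hAdef
  have hAm : Monotone A := fun x y hxy => by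
    apply Finset.sum_le_sum_of_subset_of_nonneg
    · exact Finset.Icc_subset_Icc_right (Nat.floor_mono hxy)
    · intros; exact ha _
  set r : ℝ → ℂ := (Ioi (1:ℝ)).indicator (fun t => ((A t - ρ * t : ℝ) : ℂ)) with hr
  have hloc : LocallyIntegrableOn r (Ioi 0) := by
    apply LocallyIntegrable.locallyIntegrableOn
    apply LocallyIntegrable.indicator _ measurableSet_Ioi
    have h1 : LocallyIntegrable (fun t => A t - ρ * t) :=
      hAm.locallyIntegrable.sub ((by fun_prop : Continuous fun t : ℝ => ρ * t).locallyIntegrable)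
    intro x
    obtain ⟨U, hU, hi⟩ := h1 x
    exact ⟨U, hU, hi.ofReal⟩
  have htop : r =O[atTop] (fun t : ℝ => t ^ (-(-θ))) := by
    apply Asymptotics.IsBigO.of_bound C
    filter_upwards [eventually_gt_atTop 1] with x hx
    rw [hr, indicator_of_mem (mem_Ioi.mpr hx), Complex.norm_real, neg_neg, Real.norm_eq_abs,
      Real.norm_of_nonneg (by positivity)]
    exact hA x hx.le
  have hbot : ∀ b : ℝ, r =O[𝓝[>] 0] (fun t : ℝ => t ^ (-b)) := by
    intro b
    apply Asymptotics.IsBigO.of_bound 1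
    filter_upwards [Ioo_mem_nhdsGT zero_lt_one] with x hx
    rw [hr, indicator_of_notMem (by simp; exact hx.2.le)]
    simp
  have hE : ∀ s : ℂ, θ < s.re → DifferentiableAt ℂ (fun s => mellin r (-s)) s := by
    intro s hs
    have : DifferentiableAt ℂ (mellin r) (-s) :=
      mellin_differentiableAt_of_isBigO_rpow hloc htop (by simpa using hs) (hbot ((-s).re - 1)) (by linarith)
    exact this.comp s differentiableAt_id.neg
  refine ⟨fun s => ρ * s + s * (s - 1) * mellin r (-s), ?_, by simp, ?_⟩
  · intro s hs
    have := hE s hs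
    fun_prop
  · intro s hs
    have hs1 : s - 1 ≠ 0 := by
      intro h0
      have := congrArg Complex.re h0
      simp at this
      linarith
    have e1 := LSeries_eq_mul_integral_of_nonneg a (r := 1) zero_le_one (s := s) hs hbO ha
    rw [e1]
    have hm : MellinConvergent r (-s) :=
      mellinConvergent_of_isBigO_rpow hloc htop (by simp; linarith) (hbot ((-s).re - 1)) (by linarith)
    have e2 : mellin r (-s) = ∫ t in Ioi (1:ℝ), ((A t - ρ * t : ℝ) : ℂ) * (t:ℂ) ^ (-(s + 1)) := by
      rw [mellin, ← integral_indicator measurableSet_Ioi, ← integral_indicator measurableSet_Ioi]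
      congr 1
      ext t
      by_cases ht : t ∈ Ioi (1:ℝ)
      · have ht0 : t ∈ Ioi (0:ℝ) := lt_trans zero_lt_one (mem_Ioi.mp ht)
        rw [indicator_of_mem ht, indicator_of_mem ht0, hr, indicator_of_mem ht, smul_eq_mul, mul_comm]
        congr 2
        ring
      · rw [indicator_of_notMem ht, indicator_apply]
        rw [hr, indicator_of_notMem ht]
        simp
    have i1 : IntegrableOn (fun t : ℝ => ((A t - ρ * t : ℝ) : ℂ) * (t:ℂ) ^ (-(s + 1))) (Ioi 1) := by
      have h3 : IntegrableOn (fun t : ℝ => (t:ℂ) ^ (-s - 1) • r t) (Ioi 1) := hm.mono_set (Ioi_subset_Ioi zero_le_one)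
      refine h3.congr_fun (fun t ht => ?_) measurableSet_Ioi
      simp only [hr, indicator_of_mem ht, smul_eq_mul]
      rw [mul_comm]
      congr 2
      ring
    have i2 : IntegrableOn (fun t : ℝ => (ρ : ℂ) * (t:ℂ) ^ (-s)) (Ioi 1) :=
      (integrableOn_Ioi_cpow_of_lt (by simpa using hs) zero_lt_one).const_mul _
    have e3 : ∫ t in Ioi (1:ℝ), (∑ k ∈ Finset.Icc 1 ⌊t⌋₊, (a k : ℂ)) * (t:ℂ) ^ (-(s + 1)) =
        mellin r (-s) + ρ * (1 / (s - 1)) := by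
      have e4 : ∫ t in Ioi (1:ℝ), (t:ℂ) ^ (-s) = 1 / (s - 1) := by
        rw [integral_Ioi_cpow_of_lt (by simpa using hs) zero_lt_one]
        simp only [Complex.ofReal_one, Complex.one_cpow]
        rw [neg_div, ← div_neg]
        congr 1
        ring
      rw [e2, ← e4, ← integral_const_mul, ← integral_add i1 i2]
      apply setIntegral_congr_fun measurableSet_Ioi
      intro t ht
      have ht0 : (t:ℂ) ≠ 0 := by
        have : (1:ℝ) < t := ht
        exact_mod_cast (by linarith : t ≠ 0)
      simp only
      have : (t:ℂ) ^ (-s) = t * (t:ℂ) ^ (-(s + 1)) := by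
        rw [show -s = -(s + 1) + 1 by ring, Complex.cpow_add _ _ ht0, Complex.cpow_one]
        ring
      rw [this]
      simp only [hAdef]
      push_cast
      ring
    rw [e3]
    field_simp
    ring

end QD

namespace QD
open MeasureTheory Filter Topology Set

lemma lam_sum (Lam : ℕ → ℝ) (hL0 : ∀ n, 0 ≤ Lam n) (N : ℝ)
    (hL : ∀ n, Lam n ≤ N * ArithmeticFunction.vonMangoldt n) (s : ℂ) (hs : 1 < s.re) :
    LSeriesSummable (fun n => (Lam n : ℂ)) s := by
  have h1 := ArithmeticFunction.LSeriesSummable_vonMangoldt hs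
  have h2 := (h1.smul (N:ℂ))
  refine Summable.of_norm_bounded h2.norm (fun n => ?_)
  apply LSeries.norm_term_le
  have := hL n
  simp only [Pi.smul_apply, smul_eq_mul, norm_mul, Complex.norm_real, Real.norm_eq_abs]
  rw [abs_of_nonneg (hL0 n), ← abs_mul]
  exact (hL n).trans (le_abs_self _)

lemma trig341 (σ t : ℝ) (n : ℕ) (hn : n ≠ 0) :
    0 ≤ (3 * (n:ℂ)^(-(σ:ℂ)) + 4 * (n:ℂ)^(-((σ:ℂ) + t * Complex.I)) + (n:ℂ)^(-((σ:ℂ) + 2 * t * Complex.I))).re := by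
  have hn' : (n:ℂ) ≠ 0 := by exact_mod_cast hn
  set L := Real.log n with hLdef
  have hlog : Complex.log (n:ℂ) = (L : ℂ) := by
    rw [hLdef]; exact Complex.natCast_log.symm
  have key : ∀ u : ℝ, ((n:ℂ)^(-((σ:ℂ) + u * Complex.I))).re = Real.exp (-(σ * L)) * Real.cos (u * L) := by
    intro u
    rw [Complex.cpow_def_of_ne_zero hn', hlog, Complex.exp_re]
    have e1 : ((L:ℂ) * -((σ:ℂ) + u * Complex.I)).re = -(σ * L) := by simp; ring
    have e2 : ((L:ℂ) * -((σ:ℂ) + u * Complex.I)).im = -(u * L) := by simp; ring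
    rw [e1, e2, Real.cos_neg]
  have k0 := key 0
  have k1 := key t
  have k2 := key (2*t)
  simp only [Complex.ofReal_zero, zero_mul, add_zero, Real.cos_zero, mul_one] at k0
  push_cast at k2
  have e4 : (3 * (n:ℂ)^(-(σ:ℂ))).re = 3 * ((n:ℂ)^(-(σ:ℂ))).re := by simp
  have e5 : (4 * (n:ℂ)^(-((σ:ℂ) + t * Complex.I))).re = 4 * ((n:ℂ)^(-((σ:ℂ) + t * Complex.I))).re := by simp
  rw [Complex.add_re, Complex.add_re, e4, e5, k0, k1, k2,
    show 2 * t * L = 2 * (t * L) by ring, Real.cos_two_mul]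
  have := mul_nonneg (Real.exp_pos (-(σ * L))).le (sq_nonneg (Real.cos (t*L) + 1))
  nlinarith

lemma re341 (c : ℕ → ℝ) (hc : ∀ n, 0 ≤ c n) 
    (hs : ∀ s : ℂ, 1 < s.re → LSeriesSummable (fun n => (c n : ℂ)) s) (σ t : ℝ) (hσ : 1 < σ) :
    0 ≤ (3 * LSeries (fun n => (c n : ℂ)) σ + 4 * LSeries (fun n => (c n : ℂ)) (σ + t * Complex.I)
      + LSeries (fun n => (c n : ℂ)) (σ + 2 * t * Complex.I)).re := by
  have h0 := (hs σ (by simpa using hσ)).hasSum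
  have h1 := (hs (σ + t * Complex.I) (by simpa using hσ)).hasSum
  have h2 := (hs (σ + 2 * t * Complex.I) (by simpa using hσ)).hasSum
  have H := Complex.hasSum_re (((h0.mul_left 3).add (h1.mul_left 4)).add h2)
  refine H.nonneg (fun n => ?_)
  rcases eq_or_ne n 0 with rfl | hn
  · simp
  have h := mul_nonneg (hc n) (trig341 σ t n hn)
  rw [LSeries.term_of_ne_zero hn, LSeries.term_of_ne_zero hn, LSeries.term_of_ne_zero hn]
  rw [← Complex.re_ofReal_mul] at h
  convert h using 2
  simp only [div_eq_mul_inv, Complex.cpow_neg]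
  ring

lemma Zexp (a Lam : ℕ → ℝ) (hL0 : ∀ n, 0 ≤ Lam n) (N : ℝ)
    (hL : ∀ n, Lam n ≤ N * ArithmeticFunction.vonMangoldt n)
    (hconv : ∀ n, a n * Real.log n = ∑ d ∈ n.divisorsAntidiagonal, Lam d.1 * a d.2)
    (hs : ∀ s : ℂ, 1 < s.re → LSeriesSummable (fun n => (a n : ℂ)) s) :
    (∀ s : ℂ, 1 < s.re → HasDerivAt (LSeries (fun n => (a n : ℂ)))
      (- (LSeries (fun n => (Lam n : ℂ)) s * LSeries (fun n => (a n : ℂ)) s)) s) ∧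
    ∃ (K : ℂ) (l : ℂ → ℂ), (∀ s : ℂ, 1 < s.re → LSeries (fun n => (a n : ℂ)) s = K * Complex.exp (l s)) ∧
      ∀ (σ t : ℝ), 1 < σ → 0 ≤ (3 * l σ + 4 * l (σ + t * Complex.I) + l (σ + 2 * t * Complex.I)).re := by
  have absc : ∀ f : ℕ → ℂ, (∀ s : ℂ, 1 < s.re → LSeriesSummable f s) → ∀ s : ℂ, 1 < s.re →
      LSeries.abscissaOfAbsConv f < s.re := by
    intro f hf s hs
    refine lt_of_le_of_lt (LSeries.abscissaOfAbsConv_le_of_forall_lt_LSeriesSummable (x := 1) ?_) (by exact_mod_cast hs)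
    intro y hy
    exact hf y (by simpa using hy)
  have hZ : ∀ s : ℂ, 1 < s.re → HasDerivAt (LSeries (fun n => (a n : ℂ)))
      (- (LSeries (fun n => (Lam n : ℂ)) s * LSeries (fun n => (a n : ℂ)) s)) s := by
    intro s hs1
    have h := LSeries_hasDerivAt (absc _ hs s hs1)
    rw [← LSeries_convolution' (lam_sum Lam hL0 N hL s hs1) (hs s hs1)]
    convert h using 2
    refine LSeries_congr (fun {n} _ => ?_) s
    rw [LSeries.convolution_def]
    simp only [LSeries.logMul]
    have := hconv n
    rw [← Complex.natCast_log]
    rw [mul_comm]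
    exact_mod_cast this.symm
  refine ⟨hZ, ?_⟩
  have hL1 : Lam 1 = 0 := le_antisymm (by simpa using hL 1) (hL0 1)
  let c : ℕ → ℝ := fun n => Lam n / Real.log n
  have hc0 : ∀ n, 0 ≤ c n := fun n => div_nonneg (hL0 n) (Real.log_natCast_nonneg n)
  have hcl : ∀ {n : ℕ}, n ≠ 0 → LSeries.logMul (fun n => (c n : ℂ)) n = (Lam n : ℂ) := by
    intro n hn
    simp only [LSeries.logMul, c]
    rw [← Complex.natCast_log]
    rcases eq_or_ne n 1 with rfl | h1
    · simp [hL1]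
    have : Real.log n ≠ 0 := by
      apply ne_of_gt; apply Real.log_pos; exact_mod_cast (by omega : 1 < n)
    rw [← Complex.ofReal_mul, mul_div_cancel₀ _ this]
  have habs : ∀ s : ℂ, 1 < s.re → LSeries.abscissaOfAbsConv (fun n => (c n : ℂ)) < s.re := by
    intro s hs1
    rw [← LSeries.abscissaOfAbsConv_logMul, LSeries.abscissaOfAbsConv_congr hcl]
    exact absc _ (lam_sum Lam hL0 N hL) s hs1
  have hcs : ∀ s : ℂ, 1 < s.re → LSeriesSummable (fun n => (c n : ℂ)) s := fun s h =>
    LSeriesSummable_of_abscissaOfAbsConv_lt_re (habs s h)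
  have hl : ∀ s : ℂ, 1 < s.re → HasDerivAt (LSeries (fun n => (c n : ℂ))) (- LSeries (fun n => (Lam n : ℂ)) s) s := by
    intro s h
    have := LSeries_hasDerivAt (habs s h)
    rwa [LSeries_congr hcl] at this
  have hop : IsOpen {s : ℂ | 1 < s.re} := isOpen_lt continuous_const Complex.continuous_re
  have hE : ∀ s : ℂ, 1 < s.re → HasDerivAt (fun s => LSeries (fun n => (a n : ℂ)) s * Complex.exp (-LSeries (fun n => (c n : ℂ)) s)) 0 s := by
    intro s h
    refine ((hZ s h).mul ((hl s h).neg.cexp)).congr_deriv ?_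
    simp only [Pi.neg_apply, neg_neg]
    ring
  obtain ⟨K, hK⟩ := hop.exists_is_const_of_deriv_eq_zero (convex_halfSpace_re_gt 1).isPreconnected
    (fun s h => (hE s h).differentiableAt.differentiableWithinAt) (fun s h => (hE s h).deriv)
  refine ⟨K, LSeries (fun n => (c n : ℂ)), fun s h => ?_, fun σ t h => re341 c hc0 hcs σ t h⟩
  rw [← hK s h, mul_assoc, ← Complex.exp_add]
  simp

theorem PIT (a Lam : ℕ → ℝ) (ha : ∀ n, 0 ≤ a n) (hL0 : ∀ n, 0 ≤ Lam n) (N : ℝ) (hN : 0 ≤ N)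
    (hL : ∀ n, Lam n ≤ N * ArithmeticFunction.vonMangoldt n)
    (hconv : ∀ n, a n * Real.log n = ∑ d ∈ n.divisorsAntidiagonal, Lam d.1 * a d.2)
    (ρ θ C : ℝ) (hρ : 0 < ρ) (hθ0 : 0 ≤ θ) (hθ : θ < 1)
    (hA : ∀ x : ℝ, 1 ≤ x → |∑ n ∈ Finset.Icc 1 ⌊x⌋₊, a n - ρ * x| ≤ C * x ^ θ) :
    Tendsto (fun x : ℝ => (∑ n ∈ Finset.Icc 1 ⌊x⌋₊, Lam n)/x) atTop (𝓝 1) := by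
  obtain ⟨hs, g, hgd, hg1, hg⟩ := zcont a ha ρ θ C hθ0 hθ hA
  obtain ⟨hZ', K, l, hKl, hl⟩ := Zexp a Lam hL0 N hL hconv hs
  set Z := LSeries (fun n => (a n : ℂ)) with hZdef
  have hop : IsOpen {s : ℂ | θ < s.re} := isOpen_lt continuous_const Complex.continuous_re
  have hline : ∀ t : ℝ, Tendsto (fun σ : ℝ => g (σ + t * Complex.I)) (𝓝[>] 1) (𝓝 (g (1 + t * Complex.I))) := by
    intro t
    have h1 : ContinuousAt g (1 + t * Complex.I) := (hgd _ (by simpa using hθ)).continuousAt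
    have h2 : ContinuousAt (fun σ : ℝ => g (σ + t * Complex.I)) 1 := by
      apply ContinuousAt.comp (g := g)
      · simpa using h1
      · fun_prop
    have := h2.tendsto.mono_left (nhdsWithin_le_nhds (s := Ioi 1))
    simpa using this
  have hK0 : K ≠ 0 := by
    rintro rfl
    have h1 := hline 0
    have h2 : (fun σ : ℝ => g (σ + (0:ℝ) * Complex.I)) =ᶠ[𝓝[>] 1] fun _ => 0 := by
      filter_upwards [self_mem_nhdsWithin] with σ hσ
      rw [← hg _ (by simpa using hσ), hKl _ (by simpa using hσ)]
      simp
    have h3 := tendsto_nhds_unique (h1.congr' h2) tendsto_const_nhds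
    simp only [Complex.ofReal_zero, zero_mul, add_zero, hg1] at h3
    exact hρ.ne' (by exact_mod_cast h3)
  have hZ0 : ∀ s : ℂ, 1 < s.re → Z s ≠ 0 := by
    intro s h
    rw [hKl s h]
    exact mul_ne_zero hK0 (Complex.exp_ne_zero _)
  have hnv : ∀ t : ℝ, g (1 + t * Complex.I) ≠ 0 := by
    intro t ht0
    rcases eq_or_ne t 0 with rfl | ht
    · simp only [Complex.ofReal_zero, zero_mul, add_zero, hg1] at ht0
      exact hρ.ne' (by exact_mod_cast ht0)
    have hder : HasDerivAt (fun σ : ℝ => g (σ + t * Complex.I)) (deriv g (1 + t * Complex.I)) 1 := by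
      have h1 : HasDerivAt g (deriv g (1 + t * Complex.I)) (1 + t * Complex.I) := (hgd _ (by simpa using hθ)).hasDerivAt
      have h2 : HasDerivAt (fun σ : ℝ => (σ:ℂ) + t * Complex.I) 1 1 := by
        simpa using (HasDerivAt.ofReal_comp (hasDerivAt_id (1:ℝ))).add_const (t * Complex.I)
      have h3 : HasDerivAt g (deriv g (1 + t * Complex.I)) (((1:ℝ):ℂ) + t * Complex.I) := by simpa using h1
      have h4 := h3.comp_of_eq (1:ℝ) h2 rfl
      rw [mul_one] at h4
      exact h4
    have hsl := (hasDerivAt_iff_tendsto_slope.mp hder).mono_left (nhdsWithin_mono (1:ℝ) (fun x (hx : 1 < x) => (ne_of_gt hx : x ≠ 1)))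
    have hden : ∀ u : ℝ, u ≠ 0 → Tendsto (fun σ : ℝ => ‖((σ:ℂ) + u * Complex.I - 1)⁻¹‖) (𝓝[>] 1) (𝓝 ‖(((1:ℝ):ℂ) + u * Complex.I - 1)⁻¹‖) := by
      intro u hu
      have : ContinuousAt (fun σ : ℝ => ‖((σ:ℂ) + u * Complex.I - 1)⁻¹‖) 1 := by
        apply ContinuousAt.norm
        apply ContinuousAt.inv₀
        · fun_prop
        · simp [hu]
      exact this.tendsto.mono_left nhdsWithin_le_nhds
    have hz : Tendsto (fun σ : ℝ => σ - 1) (𝓝[>] 1) (𝓝 0) := by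
      have : ContinuousAt (fun σ : ℝ => σ - 1) 1 := by fun_prop
      simpa using this.tendsto.mono_left (nhdsWithin_le_nhds (s := Ioi 1))
    have hlim := ((((hline 0).norm.pow 3).mul (hsl.norm.pow 4)).mul (((hline (2*t)).norm.mul ((hden t ht).pow 4)).mul
      (hden (2*t) (by simpa using ht)))).mul hz
    rw [mul_zero] at hlim
    have hle : ‖K‖^8 ≤ 0 := by
      refine ge_of_tendsto hlim ?_
      filter_upwards [self_mem_nhdsWithin] with σ hσ
      have hσ : 1 < σ := hσ
      have hp : 0 < σ - 1 := by linarith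
      have e0 := hKl (σ:ℂ) (by simpa using hσ)
      have e1 := hKl (σ + t * Complex.I) (by simpa using hσ)
      have e2 := hKl (σ + 2 * t * Complex.I) (by simpa using hσ)
      have q0 := hg (σ:ℂ) (by simpa using hσ)
      have q1 := hg (σ + t * Complex.I) (by simpa using hσ)
      have q2 := hg (σ + 2 * t * Complex.I) (by simpa using hσ)
      have n1 : (σ:ℂ) + t * Complex.I - 1 ≠ 0 := by
        intro h; have := congrArg Complex.im h; simp [ht] at this
      have n2 : (σ:ℂ) + 2 * t * Complex.I - 1 ≠ 0 := by
        intro h; have := congrArg Complex.im h; simp [ht] at this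
      have main : ‖K‖^8 ≤ ‖Z σ‖^3 * ‖Z (σ + t * Complex.I)‖^4 * ‖Z (σ + 2 * t * Complex.I)‖ := by
        rw [← norm_pow, ← norm_pow, ← norm_pow, ← norm_mul, ← norm_mul, e0, e1, e2]
        have : (K * Complex.exp (l σ)) ^ 3 * (K * Complex.exp (l (σ + t * Complex.I))) ^ 4 *
            (K * Complex.exp (l (σ + 2 * t * Complex.I))) = K ^ 8 * Complex.exp (3 * l σ + 4 * l (σ + t * Complex.I) + l (σ + 2 * t * Complex.I)) := by
          rw [Complex.exp_add, Complex.exp_add, mul_comm (3:ℂ), mul_comm (4:ℂ)]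
          have h3 := Complex.exp_nat_mul (l σ) 3
          have h4 := Complex.exp_nat_mul (l (σ + t * Complex.I)) 4
          push_cast at h3 h4
          rw [mul_comm (l _), mul_comm (l (σ + t * Complex.I)), h3, h4]
          ring
        rw [this, norm_mul, norm_pow, Complex.norm_exp]
        have := Real.one_le_exp (hl σ t hσ)
        nlinarith [pow_nonneg (norm_nonneg K) 8]
      refine main.trans (le_of_eq ?_)
      rw [slope_def_module]
      simp only [Complex.ofReal_one, ht0, sub_zero, Complex.ofReal_zero, zero_mul, add_zero, norm_smul]
      push_cast
      rw [← q0, ← q1, ← q2]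
      simp only [norm_mul, norm_inv, Real.norm_eq_abs, abs_of_pos hp]
      have n0 : ‖(σ:ℂ) - 1‖ = σ - 1 := by
        rw [← Complex.ofReal_one, ← Complex.ofReal_sub, Complex.norm_real, Real.norm_of_nonneg hp.le]
      rw [n0]
      have n1' := norm_ne_zero_iff.mpr n1
      have n2' := norm_ne_zero_iff.mpr n2
      set A1 := ‖(σ:ℂ) + t * Complex.I - 1‖
      set A2 := ‖(σ:ℂ) + 2 * t * Complex.I - 1‖
      set Z2 := ‖Z ((σ:ℂ) + 2 * t * Complex.I)‖
      field_simp
    have : 0 < ‖K‖^8 := by positivity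
    linarith
  have hg0 : ∀ s : ℂ, 1 ≤ s.re → g s ≠ 0 := by
    intro s h
    rcases h.eq_or_lt with h | h
    · have := hnv s.im
      rwa [show (1:ℂ) + s.im * Complex.I = s by apply Complex.ext <;> simp [← h]] at this
    · rw [← hg s h]
      refine mul_ne_zero ?_ (hZ0 s h)
      intro h0
      have := congrArg Complex.re h0
      simp at this
      linarith
  refine WI Lam hL0 (N * (Real.log 4 + 4)) 1 ?_ (fun s => - deriv g s / g s) ?_ ?_
  · intro x hx
    have h1 := Chebyshev.psi_le_const_mul_self hx
    calc ∑ n ∈ Finset.Icc 1 ⌊x⌋₊, Lam n ≤ ∑ n ∈ Finset.Icc 1 ⌊x⌋₊, N * ArithmeticFunction.vonMangoldt n :=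
          Finset.sum_le_sum fun n _ => hL n
      _ = N * Chebyshev.psi x := by
          rw [← Finset.mul_sum, Chebyshev.psi]; rfl
      _ ≤ _ := by rw [mul_assoc]; exact mul_le_mul_of_nonneg_left h1 hN
  · intro s h
    have h : 1 ≤ s.re := h
    have hdiff : DifferentiableOn ℂ g {s : ℂ | θ < s.re} := fun z hz => (hgd z hz).differentiableWithinAt
    have hs' : {s : ℂ | θ < s.re} ∈ 𝓝 s := hop.mem_nhds (lt_of_lt_of_le hθ h)
    have h1 : ContinuousAt (deriv g) s := ((hdiff.deriv hop).continuousOn).continuousAt hs'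
    have h2 : ContinuousAt g s := (hgd s (lt_of_lt_of_le hθ h)).continuousAt
    exact (h1.neg.div h2 (hg0 s h)).continuousWithinAt
  · intro s h
    have hs1 : s - 1 ≠ 0 := by
      intro h0
      have := congrArg Complex.re h0
      simp at this
      linarith
    have hop1 : IsOpen {s : ℂ | 1 < s.re} := isOpen_lt continuous_const Complex.continuous_re
    have e : g =ᶠ[𝓝 s] fun s => (s - 1) * Z s := by
      filter_upwards [hop1.mem_nhds h] with z hz
      exact (hg z hz).symm
    have hd : HasDerivAt (fun s => (s - 1) * Z s) (1 * Z s + (s - 1) * (- (LSeries (fun n => (Lam n : ℂ)) s * Z s))) s :=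
      ((hasDerivAt_id s).sub_const 1).mul (hZ' s h)
    rw [e.deriv_eq, hd.deriv, ← hg s h]
    have := hZ0 s h
    push_cast
    field_simp
    ring

end QD

namespace QD
open MeasureTheory Filter Topology Set
open scoped Pointwise

lemma lat_count {E : Type*} [NormedAddCommGroup E] [NormedSpace ℝ E] [FiniteDimensional ℝ E]
    [MeasurableSpace E] [BorelSpace E] (μ : Measure E) [μ.IsAddHaarMeasure]
    (Λ : Submodule ℤ E) [DiscreteTopology Λ] [IsZLattice ℝ Λ] (F : Set E)
    (hF : IsAddFundamentalDomain Λ F μ) (r : ℝ) (hr : ∀ f ∈ F, ‖f‖ ≤ r)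
    (S A B : Set E) (hA : ∀ x ∈ A, ∀ y, ‖x - y‖ ≤ r → y ∈ S) (hB : ∀ x ∈ S, ∀ y, ‖x - y‖ ≤ r → y ∈ B)
    (hBt : μ B ≠ ⊤) (hF0 : μ F ≠ 0) (hFt : μ F ≠ ⊤) :
    μ.real A ≤ Nat.card {x : Λ // (x:E) ∈ S} * μ.real F ∧
    Nat.card {x : Λ // (x:E) ∈ S} * μ.real F ≤ μ.real B := by
  have : VAddInvariantMeasure Λ E μ := ⟨fun c s _ => measure_preimage_add μ (c:E) s⟩
  have hmF : ∀ g : Λ, μ (g +ᵥ F) = μ F := fun g => by rw [measure_vadd]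
  have hup : (ENat.card {x : Λ // (x:E) ∈ S} : ENNReal) * μ F ≤ μ B := by
    rw [← ENNReal.tsum_const, hF.measure_eq_tsum_of_ac (fun _ h => h) B]
    calc ∑' (_ : {x : Λ // (x:E) ∈ S}), μ F ≤ ∑' (g : {x : Λ // (x:E) ∈ S}), μ (B ∩ (g.1 +ᵥ F)) := by
          refine ENNReal.tsum_le_tsum fun g => ?_
          rw [← hmF g.1]
          refine measure_mono fun y hy => ⟨?_, hy⟩
          obtain ⟨f, hf, rfl⟩ := hy
          refine hB _ g.2 _ ?_
          have : (g.1 +ᵥ f : E) = g.1.1 + f := rfl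
          simpa [this] using hr f hf
      _ ≤ _ := ENNReal.tsum_comp_le_tsum_of_injective Subtype.val_injective (fun g : Λ => μ (B ∩ (g +ᵥ F)))
  have hlo : μ A ≤ (ENat.card {x : Λ // (x:E) ∈ S} : ENNReal) * μ F := by
    rw [← ENNReal.tsum_const, hF.measure_eq_tsum_of_ac (fun _ h => h) A]
    have : ∑' (_ : {x : Λ // (x:E) ∈ S}), μ F = ∑' (g : Λ), Set.indicator {x : Λ | (x:E) ∈ S} (fun _ => μ F) g :=
      tsum_subtype {x : Λ | (x:E) ∈ S} (fun _ => μ F)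
    rw [this]
    refine ENNReal.tsum_le_tsum fun g => ?_
    by_cases hg : (g:E) ∈ S
    · rw [Set.indicator_of_mem (by exact hg)]
      rw [← hmF g]
      exact measure_mono inter_subset_right
    · rw [Set.indicator_of_notMem (by exact hg)]
      have : A ∩ (g +ᵥ F) = ∅ := by
        rw [Set.eq_empty_iff_forall_notMem]
        rintro y ⟨hy, f, hf, rfl⟩
        apply hg
        refine hA _ hy _ ?_
        have : (g +ᵥ f : E) = g.1 + f := rfl
        simpa [this] using hr f hf
      simp [this]
  have hfin : Finite {x : Λ // (x:E) ∈ S} := by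
    rw [← ENat.card_lt_top]
    by_contra h
    rw [not_lt, top_le_iff] at h
    rw [h] at hup
    simp only [ENat.toENNReal_top, ENNReal.top_mul hF0, top_le_iff] at hup
    exact hBt hup
  rw [ENat.card_eq_coe_natCard] at hup hlo
  have e : ((Nat.card {x : Λ // (x:E) ∈ S} : ENNReal) * μ F).toReal = Nat.card {x : Λ // (x:E) ∈ S} * μ.real F := by
    rw [ENNReal.toReal_mul, ENNReal.toReal_natCast]; rfl
  have ht : (Nat.card {x : Λ // (x:E) ∈ S} : ENNReal) * μ F ≠ ⊤ := ENNReal.mul_ne_top (by simp) hFt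
  constructor
  · rw [← e]; exact ENNReal.toReal_mono ht (by simpa using hlo)
  · rw [← e]; exact ENNReal.toReal_mono hBt (by simpa using hup)

end QD

namespace QD
open MeasureTheory Filter Topology Set
open NumberField NumberField.InfinitePlace NumberField.mixedEmbedding NumberField.mixedEmbedding.fundamentalCone NumberField.Units NumberField.Units.dirichletUnitTheorem

variable (K : Type*) [Field K] [NumberField K]

noncomputable def pset (τ a b : ℝ) : Set (realSpace K) :=
  Set.univ.pi fun w => if w = w₀ then Set.Iic τ else Set.Ico a b

noncomputable def Rg (τ a b : ℝ) : Set (mixedSpace K) :=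
  normAtAllPlaces ⁻¹' (expMapBasis '' (pset K τ a b))

lemma pset_meas (τ a b : ℝ) : MeasurableSet (pset K τ a b) := by
  refine MeasurableSet.univ_pi fun _ ↦ ?_
  split_ifs
  · exact measurableSet_Iic
  · exact measurableSet_Ico

lemma Rg_meas (τ a b : ℝ) : MeasurableSet (Rg K τ a b) := by
  refine MeasurableSet.preimage ?_ (continuous_normAtAllPlaces K).measurable
  exact (pset_meas K τ a b).image_of_continuousOn_injOn (continuous_expMapBasis K).continuousOn
      (injective_expMapBasis K).injOn

lemma pset_int (τ a b : ℝ) {n : ℕ} (hn : 0 < n) :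
    ∫⁻ (x : realSpace K) in pset K τ a b, .ofReal (Real.exp (x w₀ * n)) =
      (n : ENNReal)⁻¹ * ENNReal.ofReal (Real.exp (n * τ)) * ENNReal.ofReal (b - a) ^ (Fintype.card (InfinitePlace K) - 1) := by
  have hn : 0 < (n : ℝ) := Nat.cast_pos.mpr hn
  rw [volume_pi, pset, Measure.restrict_pi_pi, lintegral_eq_lmarginal_univ 0,
    lmarginal_erase' _ (by fun_prop) (Finset.mem_univ w₀), if_pos rfl]
  simp_rw [Function.update_self, lmarginal, lintegral_const, Measure.pi_univ, if_neg
    (Finset.ne_of_mem_erase (Subtype.prop _)), Measure.restrict_apply_univ, Real.volume_Ico,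
    mul_comm _ (n : ℝ)]
  rw [← ofReal_integral_eq_lintegral_ofReal (integrableOn_exp_mul_Iic hn _), integral_exp_mul_Iic
    hn, ENNReal.ofReal_div_of_pos hn, ENNReal.ofReal_natCast]
  · simp
    rw [ENNReal.div_eq_inv_mul]
  filter_upwards with _ using Real.exp_nonneg _

lemma Rg_vol (τ a b : ℝ) : volume (Rg K τ a b) =
    volume (normLeOne K) * (ENNReal.ofReal (Real.exp (Module.finrank ℚ K * τ)) * ENNReal.ofReal (b - a) ^ (Fintype.card (InfinitePlace K) - 1)) := by
  have hgen : ∀ τ a b, volume (Rg K τ a b) = 2 ^ nrRealPlaces K * NNReal.pi ^ nrComplexPlaces K * .ofReal (regulator K) * (ENNReal.ofReal (Real.exp (Module.finrank ℚ K * τ)) * ENNReal.ofReal (b - a) ^ (Fintype.card (InfinitePlace K) - 1)) := by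
    intro τ a b
    rw [volume_eq_two_pow_mul_two_pi_pow_mul_integral (by rw [Rg]; exact Set.preimage_image_preimage) (Rg_meas K τ a b), Rg,
      normAtAllPlaces_image_preimage_expMapBasis,
      setLIntegral_expMapBasis_image (pset_meas K τ a b) (by fun_prop)]
    simp_rw [ENNReal.inv_mul_cancel_right
      (Finset.prod_ne_zero_iff.mpr fun _ _ ↦ ENNReal.ofReal_ne_zero_iff.mpr (expMapBasis_pos _ _))
      (ENNReal.prod_ne_top fun _ _ ↦ ENNReal.ofReal_ne_top)]
    rw [pset_int K τ a b Module.finrank_pos, ENNReal.ofReal_mul zero_le_two, mul_pow,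
      ENNReal.ofReal_ofNat, mul_assoc (Module.finrank ℚ K : ENNReal)⁻¹, ← mul_assoc _ (Module.finrank ℚ K : ENNReal)⁻¹, ENNReal.mul_inv_cancel_right (Nat.cast_ne_zero.mpr Module.finrank_pos.ne')
      (ENNReal.natCast_ne_top _), ENNReal.coe_nnreal_eq, NNReal.coe_real_pi, ← mul_assoc, mul_mul_mul_comm, ← ENNReal.inv_pow,
      ← mul_assoc, ← mul_assoc]
    have h2 : (2:ENNReal) ^ nrComplexPlaces K * (2 ^ nrComplexPlaces K)⁻¹ = 1 := ENNReal.mul_inv_cancel (pow_ne_zero _ two_ne_zero) (ENNReal.pow_ne_top ENNReal.ofNat_ne_top)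
    refine Eq.trans ?_ (one_mul _)
    rw [← h2]
    ring
  rw [hgen, volume_normLeOne]

lemma normLeOne_eq_Rg : normLeOne K = Rg K 0 0 1 := normLeOne_eq_preimage K

lemma norm_le_iff_place (x : mixedSpace K) (r : ℝ) : ‖x‖ ≤ r ↔ ∀ w, normAtPlace w x ≤ r := by
  rw [norm_eq_sup'_normAtPlace, Finset.sup'_le_iff]
  simp

lemma place_sub (x y : mixedSpace K) (w : InfinitePlace K) : |normAtPlace w x - normAtPlace w y| ≤ ‖x - y‖ := by
  have h : ∀ u : mixedSpace K, normAtPlace w u ≤ ‖u‖ := fun u => (norm_le_iff_place K u _).mp le_rfl w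
  rw [abs_le]
  constructor
  · have h1 := normAtPlace_add_le w x (y - x)
    have h2 := h (y - x)
    rw [norm_sub_rev] at h2
    rw [add_sub_cancel] at h1
    linarith
  · have h1 := normAtPlace_add_le w y (x - y)
    have h2 := h (x - y)
    rw [add_sub_cancel] at h1
    linarith

end QD

namespace QD
open MeasureTheory Filter Topology Set
open NumberField NumberField.InfinitePlace NumberField.mixedEmbedding NumberField.mixedEmbedding.fundamentalCone NumberField.Units NumberField.Units.dirichletUnitTheorem

variable (K : Type*) [Field K] [NumberField K]

lemma box_kappa : ∃ κ : ℝ, 0 < κ ∧ κ ≤ 1 ∧ ∀ c : realSpace K, (∀ i, i ≠ w₀ → c i ∈ Set.Icc (-1:ℝ) 2) → ∀ w w', κ * expMapBasis c w' ≤ expMapBasis c w := by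
  have hc : IsCompact (expMapBasis '' (Set.univ.pi fun _ : InfinitePlace K => Set.Icc (-1:ℝ) 2)) :=
    (isCompact_univ_pi fun _ => isCompact_Icc).image (continuous_expMapBasis K)
  have key : ∀ w w' : InfinitePlace K, ∃ κ : ℝ, 0 < κ ∧ ∀ u ∈ (expMapBasis '' (Set.univ.pi fun _ : InfinitePlace K => Set.Icc (-1:ℝ) 2)), κ * u w' ≤ u w := by
    intro w w'
    have hne : (expMapBasis '' (Set.univ.pi fun _ : InfinitePlace K => Set.Icc (-1:ℝ) 2)).Nonempty := ⟨_, ⟨0, fun i _ => by simp, rfl⟩⟩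
    have hpos : ∀ u ∈ (expMapBasis '' (Set.univ.pi fun _ : InfinitePlace K => Set.Icc (-1:ℝ) 2)), ∀ w, 0 < u w := by
      rintro _ ⟨c, _, rfl⟩ w
      exact expMapBasis_pos c w
    obtain ⟨u0, hu0, hmin⟩ := hc.exists_isMinOn hne (f := fun u => u w / u w')
      (ContinuousOn.div (by fun_prop) (by fun_prop) (fun u hu => (hpos u hu w').ne'))
    refine ⟨u0 w / u0 w', div_pos (hpos _ hu0 _) (hpos _ hu0 _), fun u hu => ?_⟩
    have := hmin hu
    simp only [mem_ofPred_eq] at this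
    exact (le_div_iff₀ (hpos u hu w')).mp this
  choose κ hκ0 hκ using key
  obtain ⟨p, hp⟩ := Finite.exists_min (fun p : InfinitePlace K × InfinitePlace K => κ p.1 p.2)
  refine ⟨min (κ p.1 p.2) 1, lt_min (hκ0 _ _) one_pos, min_le_right _ _, fun c hcb w w' => ?_⟩
  have h1 := hκ w w' (expMapBasis (fun i ↦ if i = w₀ then 0 else c i)) ⟨_, fun i _ => by
    show (if i = w₀ then (0:ℝ) else c i) ∈ _
    split_ifs with h
    · simp
    · exact hcb i h, rfl⟩
  rw [expMapBasis_apply'' c]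
  simp only [Pi.smul_apply, smul_eq_mul]
  have h2 := hp (w, w')
  simp only at h2
  have h3 := expMapBasis_pos (fun i ↦ if i = w₀ then 0 else c i) w'
  have h4 : min (κ p.1 p.2) 1 * expMapBasis (fun i ↦ if i = w₀ then 0 else c i) w' ≤ expMapBasis (fun i ↦ if i = w₀ then 0 else c i) w := by
    refine le_trans ?_ h1
    gcongr
    exact (min_le_left _ _).trans h2
  nlinarith [Real.exp_pos (c w₀)]

lemma perturb : ∃ κ C1 : ℝ, 0 < κ ∧ κ ≤ 1 ∧ 0 < C1 ∧ ∀ (x y : mixedSpace K) (c : realSpace K) (M ε : ℝ),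
    normAtAllPlaces x = expMapBasis c → (∀ i, i ≠ w₀ → c i ∈ Set.Icc (-1:ℝ) 2) → 0 < M → M ≤ ‖x‖ → ‖x - y‖ ≤ ε → ε ≤ κ * M / 2 →
    ∃ c' : realSpace K, normAtAllPlaces y = expMapBasis c' ∧ ∀ i, |c' i - c i| ≤ C1 * ε / M := by
  obtain ⟨κ, hκ, hκ1, hk⟩ := box_kappa K
  set Lf := ‖((completeBasis K).equivFunL : realSpace K →L[ℝ] realSpace K)‖ with hLf
  have hL0 : 0 ≤ Lf := norm_nonneg _
  refine ⟨κ, Lf * (4 / κ) + 1, hκ, hκ1, by positivity, fun x y c M ε hx hc hM hMx hxy hε => ?_⟩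
  have hε0 : 0 ≤ ε := (norm_nonneg _).trans hxy
  have hu : ∀ w, κ * M ≤ expMapBasis c w := by
    intro w
    have h1 : ‖x‖ ≤ expMapBasis c w / κ := by
      rw [norm_le_iff_place]
      intro w'
      rw [le_div_iff₀ hκ, mul_comm]
      have := congrFun hx w'
      rw [normAtAllPlaces_apply] at this
      rw [this]
      exact hk c hc w w'
    rw [le_div_iff₀ hκ] at h1
    nlinarith
  have huv : ∀ w, |expMapBasis c w - normAtPlace w y| ≤ ε := by
    intro w
    have := congrFun hx w
    rw [normAtAllPlaces_apply] at this
    rw [← this]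
    exact (place_sub K x y w).trans hxy
  have hv : ∀ w, κ * M / 2 ≤ normAtPlace w y := by
    intro w
    have h1 := (abs_le.mp (huv w)).2
    linarith [hu w]
  have hκM : 0 < κ * M / 2 := by positivity
  have hlog : ∀ w, |Real.log (normAtPlace w y) - Real.log (expMapBasis c w)| ≤ ε / (κ * M / 2) := by
    have hgen : ∀ s t : ℝ, κ * M / 2 ≤ s → 0 < t → t - s ≤ ε → Real.log t - Real.log s ≤ ε / (κ * M / 2) := by
      intro s t hs ht hst
      have hs0 : 0 < s := hκM.trans_le hs
      rw [← Real.log_div ht.ne' hs0.ne']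
      have h1 := Real.log_le_sub_one_of_pos (div_pos ht hs0)
      have h2 : t / s - 1 = (t - s) / s := by field_simp
      rw [h2] at h1
      refine h1.trans ?_
      calc (t - s) / s ≤ ε / s := by gcongr
        _ ≤ _ := by gcongr
    intro w
    have h1 := abs_le.mp (huv w)
    have h2 := hv w
    have h3 := hu w
    rw [abs_le]
    constructor
    · have := hgen _ _ h2 (lt_of_lt_of_le (by positivity) h3) (by linarith)
      linarith
    · exact hgen _ _ (by linarith) (by linarith) (by linarith)
  have hvpos : ∀ w, 0 < normAtAllPlaces y w := fun w => by
    rw [normAtAllPlaces_apply]; linarith [hv w]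
  have hvt : normAtAllPlaces y ∈ (expMap (K := K)).target := by
    rw [expMap_target]; exact fun w _ => hvpos w
  refine ⟨(completeBasis K).equivFunL (expMap.symm (normAtAllPlaces y)), ?_, ?_⟩
  · rw [expMapBasis_apply]
    have : (completeBasis K).equivFun.symm ((completeBasis K).equivFunL (expMap.symm (normAtAllPlaces y))) = expMap.symm (normAtAllPlaces y) :=
      (completeBasis K).equivFun.symm_apply_apply _
    rw [this, expMap.right_inv hvt]
  · have hcc : c = (completeBasis K).equivFunL (expMap.symm (expMapBasis c)) := by
      rw [expMapBasis_apply, expMap.left_inv (by rw [expMap_source]; trivial)]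
      exact ((completeBasis K).equivFun.apply_symm_apply _).symm
    intro i
    set d := expMap.symm (normAtAllPlaces y) - expMap.symm (expMapBasis c) with hd
    have hdn : ‖d‖ ≤ 2 * (ε / (κ * M / 2)) := by
      rw [pi_norm_le_iff_of_nonneg (by positivity)]
      intro w
      rw [hd, Pi.sub_apply, expMap_symm_apply, expMap_symm_apply, ← mul_sub, normAtAllPlaces_apply, norm_mul, Real.norm_eq_abs, Real.norm_eq_abs]
      have : |(w.mult : ℝ)| ≤ 2 := by
        rw [abs_of_nonneg (by positivity)]
        unfold InfinitePlace.mult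
        split_ifs <;> norm_num
      exact mul_le_mul this (hlog w) (abs_nonneg _) (by norm_num)
    have h1 : ((completeBasis K).equivFunL (expMap.symm (normAtAllPlaces y))) i - c i = ((completeBasis K).equivFunL d) i := by
      conv_lhs => rw [hcc]
      rw [hd, map_sub, Pi.sub_apply, ← hcc]
    rw [h1, ← Real.norm_eq_abs]
    calc _ ≤ ‖(completeBasis K).equivFunL d‖ := norm_le_pi_norm _ i
      _ ≤ Lf * ‖d‖ := ((completeBasis K).equivFunL : realSpace K →L[ℝ] realSpace K).le_opNorm d
      _ ≤ Lf * (2 * (ε / (κ * M / 2))) := by gcongr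
      _ = Lf * (4 / κ) * ε / M := by field_simp; ring
      _ ≤ _ := by gcongr; linarith
end QD

namespace QD
open MeasureTheory Filter Topology Set
open NumberField NumberField.InfinitePlace NumberField.mixedEmbedding NumberField.mixedEmbedding.fundamentalCone NumberField.Units NumberField.Units.dirichletUnitTheorem

variable (K : Type*) [Field K] [NumberField K]

lemma vol_D_ne_top : volume (normLeOne K) ≠ ⊤ := (isBounded_normLeOne K).measure_lt_top.ne

lemma Rg_real (τ a b : ℝ) (hab : a ≤ b) : volume.real (Rg K τ a b) =
    volume.real (normLeOne K) * (Real.exp (Module.finrank ℚ K * τ) * (b - a) ^ (Fintype.card (InfinitePlace K) - 1)) := by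
  rw [measureReal_def, Rg_vol, ENNReal.toReal_mul, ENNReal.toReal_mul, ENNReal.toReal_pow, ENNReal.toReal_ofReal (Real.exp_pos _).le, ENNReal.toReal_ofReal (by linarith), measureReal_def]

lemma Rg_ne_top (τ a b : ℝ) : volume (Rg K τ a b) ≠ ⊤ := by
  rw [Rg_vol]
  exact ENNReal.mul_ne_top (vol_D_ne_top K) (ENNReal.mul_ne_top ENNReal.ofReal_ne_top (ENNReal.pow_ne_top ENNReal.ofReal_ne_top))

lemma vol_ball_small : ∃ C : ℝ, 0 ≤ C ∧ ∀ r : ℝ, 0 ≤ r → r ≤ 1 → volume.real (Metric.closedBall (0 : mixedSpace K) r) ≤ C * r := by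
  refine ⟨volume.real (Metric.ball (0 : mixedSpace K) 1), measureReal_nonneg, fun r hr hr1 => ?_⟩
  rw [measureReal_def, Measure.addHaar_closedBall _ _ hr, ENNReal.toReal_mul, ENNReal.toReal_ofReal (by positivity), mul_comm]
  rw [← measureReal_def]
  gcongr
  refine pow_le_of_le_one hr hr1 ?_
  rw [mixedEmbedding.finrank]
  exact Module.finrank_pos.ne'

lemma sandwich : ∃ C s0 : ℝ, 0 < s0 ∧ ∀ s : ℝ, 0 < s → s ≤ s0 → ∃ A B : Set (mixedSpace K),
    (∀ x ∈ A, ∀ y, ‖x - y‖ ≤ s ^ 2 → y ∈ normLeOne K) ∧ (∀ x ∈ normLeOne K, ∀ y, ‖x - y‖ ≤ s ^ 2 → y ∈ B) ∧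
    volume B ≠ ⊤ ∧ volume.real (normLeOne K) - C * s ≤ volume.real A ∧ volume.real B ≤ volume.real (normLeOne K) + C * s := by
  obtain ⟨κ, C1, hκ, hκ1, hC1, hp⟩ := perturb K
  obtain ⟨Cb, hCb, hb⟩ := vol_ball_small K
  set n := Module.finrank ℚ K with hn
  set r := Fintype.card (InfinitePlace K) - 1 with hr
  set V := volume.real (normLeOne K) with hV
  have hV0 : 0 ≤ V := measureReal_nonneg
  set q : ℝ := (n + 2 * r) * C1 with hq
  have hq0 : 0 ≤ q := by positivity
  refine ⟨V * (2 * q) + 2 * Cb, min (κ / 2) (min (1 / (q + 1)) (1 / (4 * (C1 + 1)))), by positivity, fun s hs hs0 => ?_⟩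
  have hs1 : s ≤ κ / 2 := hs0.trans (min_le_left _ _)
  have hs2 : q * s ≤ 1 := by
    have : s ≤ 1 / (q + 1) := hs0.trans ((min_le_right _ _).trans (min_le_left _ _))
    rw [le_div_iff₀ (by positivity)] at this
    nlinarith
  have hs3 : C1 * s ≤ 1 / 4 := by
    have : s ≤ 1 / (4 * (C1 + 1)) := hs0.trans ((min_le_right _ _).trans (min_le_right _ _))
    rw [le_div_iff₀ (by positivity)] at this
    nlinarith
  have hs4 : s ≤ 1 / 2 := by linarith
  set η := C1 * s with hη
  have hη0 : 0 < η := by positivity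
  have hηM : C1 * s ^ 2 / s = η := by field_simp; rfl
  have hsk : s ^ 2 ≤ κ * s / 2 := by nlinarith
  refine ⟨Rg K (-η) η (1 - η) \ Metric.closedBall 0 s, Rg K η (-η) (1 + η) ∪ Metric.closedBall 0 (2 * s), ?_, ?_, ?_, ?_, ?_⟩
  · rintro x ⟨⟨c, hc, hx⟩, hxs⟩ y hxy
    rw [mem_closedBall_zero_iff, not_le] at hxs
    rw [pset, Set.mem_univ_pi] at hc
    obtain ⟨c', hy, hc'⟩ := hp x y c s (s ^ 2) hx.symm (fun i hi => by
      have := hc i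
      rw [if_neg hi] at this
      exact ⟨by linarith [this.1], by linarith [this.2]⟩) hs hxs.le hxy hsk
    rw [normLeOne_eq_Rg]
    refine ⟨c', ?_, hy.symm⟩
    rw [pset, Set.mem_univ_pi]
    intro i
    have h1 := hc i
    have h2 := abs_le.mp (hc' i)
    rw [hηM] at h2
    split_ifs at h1 ⊢ with hi
    · simp only [mem_Iic] at h1 ⊢; linarith
    · exact ⟨by linarith [h1.1], by linarith [h1.2]⟩
  · intro x hx y hxy
    by_cases hxs : s ≤ ‖x‖
    · left
      rw [normLeOne_eq_Rg] at hx
      obtain ⟨c, hc, hx⟩ := hx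
      rw [pset, Set.mem_univ_pi] at hc
      obtain ⟨c', hy, hc'⟩ := hp x y c s (s ^ 2) hx.symm (fun i hi => by
        have := hc i
        rw [if_neg hi] at this
        exact ⟨by linarith [this.1], by linarith [this.2]⟩) hs hxs hxy hsk
      refine ⟨c', ?_, hy.symm⟩
      rw [pset, Set.mem_univ_pi]
      intro i
      have h1 := hc i
      have h2 := abs_le.mp (hc' i)
      rw [hηM] at h2
      split_ifs at h1 ⊢ with hi
      · simp only [mem_Iic] at h1 ⊢; linarith
      · exact ⟨by linarith [h1.1], by linarith [h1.2]⟩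
    · right
      rw [mem_closedBall_zero_iff]
      have h1 : ‖y‖ ≤ ‖x‖ + ‖x - y‖ := by
        rw [norm_sub_rev]
        simpa using norm_add_le x (y - x)
      nlinarith
  · refine (measure_union_lt_top (Rg_ne_top K _ _ _).lt_top ?_).ne
    exact measure_closedBall_lt_top
  · have h1 : volume.real (Rg K (-η) η (1 - η)) ≤ volume.real (Rg K (-η) η (1 - η) \ Metric.closedBall 0 s) + volume.real (Metric.closedBall (0 : mixedSpace K) s) := by
      refine le_trans ?_ (measureReal_union_le _ _)
      refine measureReal_mono ?_ ?_
      · rw [Set.sdiff_union_self]; exact subset_union_left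
      · refine (measure_union_lt_top ?_ measure_closedBall_lt_top).ne
        exact (measure_mono sdiff_subset).trans_lt (Rg_ne_top K _ _ _).lt_top
    rw [Rg_real K _ _ _ (by linarith)] at h1
    have h2 := hb s hs.le (by linarith)
    have h3 : 1 - (n:ℝ) * η ≤ Real.exp (n * -η) := by linarith [Real.add_one_le_exp (n * -η)]
    have h4 : 1 - 2 * r * η ≤ (1 - η - η) ^ r := by
      have := one_add_mul_le_pow (a := -(2 * η)) (by linarith) r
      calc _ = 1 + (r:ℝ) * -(2 * η) := by ring
        _ ≤ _ := this
        _ = _ := by ring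
    have h5 : (1 - η - η) ^ r ≤ 1 := pow_le_one₀ (by linarith) (by linarith)
    have h5' : 0 ≤ (1 - η - η) ^ r := pow_nonneg (by linarith) _
    have h6 : 1 - q * s ≤ Real.exp (n * -η) * (1 - η - η) ^ r := by
      have h7 : q * s = n * η + 2 * r * η := by rw [hq, hη]; ring
      have h8 : 0 ≤ (n:ℝ) * η := by positivity
      rw [h7]
      nlinarith
    have h9 : V * (1 - q * s) ≤ V * (Real.exp (n * -η) * (1 - η - η) ^ r) := by gcongr
    have h10 : 0 ≤ V * q * s := by positivity
    have h11 : 0 ≤ Cb * s := by positivity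
    nlinarith
  · have h1 := measureReal_union_le (μ := volume) (Rg K η (-η) (1 + η)) (Metric.closedBall 0 (2 * s))
    rw [Rg_real K _ _ _ (by linarith)] at h1
    have h2 := hb (2 * s) (by positivity) (by linarith)
    have h3 : (1 + η - -η) ^ r ≤ Real.exp (2 * r * η) := by
      calc _ = (2 * η + 1) ^ r := by ring
        _ ≤ (Real.exp (2 * η)) ^ r := by
          gcongr
          exact Real.add_one_le_exp _
        _ = _ := by rw [← Real.exp_nat_mul]; ring_nf
    have h4 : Real.exp (n * η) * (1 + η - -η) ^ r ≤ 1 + 2 * (q * s) := by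
      calc _ ≤ Real.exp (n * η) * Real.exp (2 * r * η) := by gcongr
        _ = Real.exp (q * s) := by rw [← Real.exp_add]; congr 1; rw [hq, hη]; ring
        _ ≤ _ := by
          have h0 : |q * s| = q * s := abs_of_nonneg (by positivity)
          have := Real.abs_exp_sub_one_le (x := q * s) (by rw [h0]; exact hs2)
          rw [h0] at this
          linarith [(abs_le.mp this).2]
    have h5 : V * (Real.exp (n * η) * (1 + η - -η) ^ r) ≤ V * (1 + 2 * (q * s)) := by gcongr
    nlinarith
end QD

namespace QD
open MeasureTheory Filter Topology Set
open scoped nonZeroDivisors Pointwise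
open NumberField NumberField.InfinitePlace NumberField.mixedEmbedding NumberField.mixedEmbedding.fundamentalCone NumberField.Units NumberField.Units.dirichletUnitTheorem Ideal

variable (K : Type*) [Field K] [NumberField K]

lemma smul_normLeOne_iff (t : ℝ) (ht : 0 < t) (x : mixedSpace K) :
    t⁻¹ • x ∈ normLeOne K ↔ x ∈ fundamentalCone K ∧ mixedEmbedding.norm x ≤ t ^ Module.finrank ℚ K := by
  rw [mem_normLeOne, smul_mem_iff_mem (inv_pos.mpr ht).ne', mixedEmbedding.norm_smul, abs_of_pos (inv_pos.mpr ht), inv_pow, inv_mul_le_iff₀ (by positivity), mul_one]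

lemma idealSet_card (J : (Ideal (𝓞 K))⁰) (t : ℝ) (ht : 0 < t) :
    Nat.card {a : idealSet K J // mixedEmbedding.norm (a : mixedSpace K) ≤ t ^ Module.finrank ℚ K} =
    Nat.card {x : mixedEmbedding.idealLattice K (FractionalIdeal.mk0 K J) // (x : mixedSpace K) ∈ {y : mixedSpace K | t⁻¹ • y ∈ normLeOne K}} := by
  refine Nat.card_congr ⟨fun a => ⟨⟨a.1.1, a.1.2.2⟩, (smul_normLeOne_iff K t ht _).mpr ⟨a.1.2.1, a.2⟩⟩,
    fun x => ⟨⟨x.1.1, ((smul_normLeOne_iff K t ht _).mp x.2).1, x.1.2⟩, ((smul_normLeOne_iff K t ht _).mp x.2).2⟩, fun _ => rfl, fun _ => rfl⟩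

lemma cone_count (J : (Ideal (𝓞 K))⁰) : ∃ c C t0 : ℝ, 0 < c ∧ 0 < t0 ∧ ∀ t : ℝ, t0 ≤ t →
    |(Nat.card {a : idealSet K J // mixedEmbedding.norm (a : mixedSpace K) ≤ t ^ Module.finrank ℚ K} : ℝ) - c * t ^ Module.finrank ℚ K| ≤ C * (t ^ Module.finrank ℚ K / √t) := by
  obtain ⟨C, s0, hs0, hsw⟩ := sandwich K
  set n := Module.finrank ℚ K with hn
  set Λ := mixedEmbedding.idealLattice K (FractionalIdeal.mk0 K J)
  set F := ZSpan.fundamentalDomain (fractionalIdealLatticeBasis K (FractionalIdeal.mk0 K J)) with hF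
  have hFb : Bornology.IsBounded F := ZSpan.fundamentalDomain_isBounded _
  have hFt : volume F ≠ ⊤ := hFb.measure_lt_top.ne
  have hF0 : volume F ≠ 0 := ZSpan.measure_fundamentalDomain_ne_zero _
  obtain ⟨r, hr0, hr⟩ := hFb.exists_pos_norm_le
  set V := volume.real (normLeOne K) with hV
  set vF := volume.real F with hvF
  have hvF0 : 0 < vF := ENNReal.toReal_pos hF0 hFt
  have hV0 : 0 < V := by
    refine ENNReal.toReal_pos ?_ (vol_D_ne_top K)
    rw [volume_normLeOne]
    refine mul_ne_zero (mul_ne_zero (pow_ne_zero _ two_ne_zero) (pow_ne_zero _ ?_)) ?_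
    · exact_mod_cast NNReal.pi_ne_zero
    · simpa using regulator_pos K
  refine ⟨V / vF, C * √r / vF, r / s0 ^ 2, by positivity, by positivity, fun t ht => ?_⟩
  have ht0 : 0 < t := lt_of_lt_of_le (by positivity) ht
  rw [idealSet_card K J t ht0]
  have hrt : √(r / t) ≤ s0 := by
    rw [Real.sqrt_le_left hs0.le, div_le_iff₀ ht0]
    rw [div_le_iff₀ (by positivity)] at ht
    linarith
  obtain ⟨A, B, hA, hB, hBt, hvA, hvB⟩ := hsw (√(r / t)) (by positivity) hrt
  rw [Real.sq_sqrt (by positivity)] at hA hB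
  have hscale : ∀ x y : mixedSpace K, ‖x - y‖ ≤ r → ‖t⁻¹ • x - t⁻¹ • y‖ ≤ r / t := by
    intro x y h
    rw [← smul_sub, _root_.norm_smul, Real.norm_eq_abs, abs_of_pos (inv_pos.mpr ht0), div_eq_inv_mul]
    gcongr
  have hmem : ∀ (S : Set (mixedSpace K)) x, x ∈ t • S ↔ t⁻¹ • x ∈ S := fun S x => Set.mem_smul_set_iff_inv_smul_mem₀ ht0.ne' S x
  have hvol : ∀ S : Set (mixedSpace K), volume.real (t • S) = t ^ n * volume.real S := by
    intro S
    rw [measureReal_def, Measure.addHaar_smul, mixedEmbedding.finrank, ENNReal.toReal_mul, ENNReal.toReal_ofReal (by positivity), abs_of_pos (by positivity), measureReal_def]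
  obtain ⟨h1, h2⟩ := lat_count (volume : Measure (mixedSpace K)) Λ F (fundamentalDomain_idealLattice K _) r hr
    {y : mixedSpace K | t⁻¹ • y ∈ normLeOne K} (t • A) (t • B)
    (fun x hx y hxy => hA _ ((hmem _ _).mp hx) _ (hscale x y hxy))
    (fun x hx y hxy => (hmem _ _).mpr (hB _ hx _ (hscale x y hxy)))
    (by rw [Measure.addHaar_smul]; exact ENNReal.mul_ne_top ENNReal.ofReal_ne_top hBt) hF0 hFt
  rw [hvol] at h1 h2
  set N : ℝ := (Nat.card {x : Λ // (x : mixedSpace K) ∈ {y : mixedSpace K | t⁻¹ • y ∈ normLeOne K}} : ℝ) with hN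
  have h3 : t ^ n * (V - C * √(r / t)) ≤ N * vF := le_trans (by gcongr) h1
  have h4 : N * vF ≤ t ^ n * (V + C * √(r / t)) := h2.trans (by gcongr)
  have h5 : N - V / vF * t ^ n = (N * vF - V * t ^ n) / vF := by field_simp
  have h6 : C * √r / vF * (t ^ n / √t) = (t ^ n * (C * √(r / t))) / vF := by
    rw [Real.sqrt_div hr0.le]; ring
  rw [h5, h6, abs_div, abs_of_pos hvF0]
  gcongr
  rw [abs_le]
  constructor <;> nlinarith

lemma class_aux {C : ClassGroup (𝓞 K)} {J : (Ideal (𝓞 K))⁰} {s : ℝ} (hJ : ClassGroup.mk0 J = C⁻¹) :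
    Nat.card {I : (Ideal (𝓞 K))⁰ // absNorm (I : Ideal (𝓞 K)) ≤ s ∧ ClassGroup.mk0 I = C}
      = Nat.card {I : (Ideal (𝓞 K))⁰ // (J : Ideal (𝓞 K)) ∣ I ∧ Submodule.IsPrincipal (I : Ideal (𝓞 K)) ∧
        absNorm (I : Ideal (𝓞 K)) ≤ s * absNorm (J : Ideal (𝓞 K))} := by
  simp_rw [← nonZeroDivisors_dvd_iff_dvd_coe]
  refine Nat.card_congr ?_
  refine ((Equiv.dvd J).subtypeEquiv fun I ↦ ?_).trans
    (Equiv.subtypeSubtypeEquivSubtypeInter (fun I : (Ideal (𝓞 K))⁰ ↦ J ∣ I) _)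
  rw [← ClassGroup.mk0_eq_one_iff (SetLike.coe_mem _)]
  simp_rw [Equiv.dvd_apply, Submonoid.coe_mul, ← Submonoid.mul_def, _root_.map_mul, hJ,
    inv_mul_eq_one, Nat.cast_mul, mul_comm s, eq_comm, and_comm, and_congr_left_iff]
  exact fun _ ↦
    (mul_le_mul_iff_of_pos_left (Nat.cast_pos.mpr (absNorm_pos_of_nonZeroDivisors J))).symm

lemma class_count (Cl : ClassGroup (𝓞 K)) : ∃ c C s0 : ℝ, 0 < c ∧ 0 < s0 ∧ ∀ s : ℝ, s0 ≤ s →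
    |(Nat.card {I : (Ideal (𝓞 K))⁰ // absNorm (I : Ideal (𝓞 K)) ≤ s ∧ ClassGroup.mk0 I = Cl} : ℝ) - c * s| ≤ C * s ^ (1 - 1 / (2 * (Module.finrank ℚ K : ℝ))) := by
  obtain ⟨J, hJ⟩ := ClassGroup.mk0_surjective Cl⁻¹
  obtain ⟨c, C, t0, hc, ht0, h⟩ := cone_count K J
  set n := Module.finrank ℚ K with hn
  have hnp : 0 < n := Module.finrank_pos
  have hnp' : (n:ℝ) ≠ 0 := by positivity
  set j : ℝ := (absNorm (J : Ideal (𝓞 K)) : ℝ) with hj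
  have hj0 : 0 < j := Nat.cast_pos.mpr (absNorm_pos_of_nonZeroDivisors J)
  set w : ℝ := (torsionOrder K : ℝ) with hw
  have hw0 : 0 < w := Nat.cast_pos.mpr (Nat.pos_of_ne_zero (torsionOrder_ne_zero K))
  refine ⟨c * j / w, C * j ^ (1 - 1 / (2 * (n : ℝ))) / w, t0 ^ n / j, by positivity, by positivity, fun s hs => ?_⟩
  have hs0 : 0 < s := lt_of_lt_of_le (by positivity) hs
  have hsj : 0 < s * j := by positivity
  set t := (s * j) ^ ((1:ℝ) / n) with ht
  have htn : t ^ n = s * j := by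
    rw [ht, ← Real.rpow_natCast, ← Real.rpow_mul hsj.le, one_div_mul_cancel hnp', Real.rpow_one]
  have htt : t0 ≤ t := by
    rw [div_le_iff₀ hj0] at hs
    have : 0 ≤ t := by positivity
    exact le_of_pow_le_pow_left₀ hnp.ne' this (by rw [htn]; exact hs)
  have h1 := h t htt
  rw [htn] at h1
  rw [class_aux K hJ]
  have h2 := card_isPrincipal_dvd_norm_le K J (s * j)
  rw [← h2] at h1
  set N := Nat.card {I : (Ideal (𝓞 K))⁰ // (J : Ideal (𝓞 K)) ∣ I ∧ Submodule.IsPrincipal (I : Ideal (𝓞 K)) ∧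
        absNorm (I : Ideal (𝓞 K)) ≤ s * j} with hN
  push_cast at h1
  have h3 : s * j / √t = (s * j) ^ (1 - 1 / (2 * (n : ℝ))) := by
    rw [Real.sqrt_eq_rpow, ht, ← Real.rpow_mul hsj.le, Real.rpow_sub hsj, Real.rpow_one]
    congr 2
    field_simp
  rw [h3, Real.mul_rpow hs0.le hj0.le] at h1
  have h4 : (N:ℝ) - c * j / w * s = ((N:ℝ) * w - c * (s * j)) / w := by field_simp
  rw [h4, abs_div, abs_of_pos hw0, div_le_iff₀ hw0]
  refine h1.trans (le_of_eq ?_)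
  field_simp

lemma ideal_count : ∃ c C : ℝ, 0 < c ∧ ∀ s : ℝ, 1 ≤ s →
    |(Nat.card {I : (Ideal (𝓞 K))⁰ // absNorm (I : Ideal (𝓞 K)) ≤ s} : ℝ) - c * s| ≤ C * s ^ (1 - 1 / (2 * (Module.finrank ℚ K : ℝ))) := by
  choose c C s0 hc hs0 h using class_count K
  set θ := (1 - 1 / (2 * (Module.finrank ℚ K : ℝ))) with hθ
  have hθ0 : 0 ≤ θ := by
    have : (1:ℝ) ≤ Module.finrank ℚ K := by exact_mod_cast Module.finrank_pos (R := ℚ) (M := K)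
    rw [hθ, sub_nonneg, div_le_one (by positivity)]; linarith
  have hfin : ∀ s : ℝ, 0 ≤ s → Finite {I : (Ideal (𝓞 K))⁰ // absNorm (I : Ideal (𝓞 K)) ≤ s} := by
    intro s hs
    simp_rw [← Nat.le_floor_iff hs]
    exact finite_setOfPred_absNorm_le₀ ⌊s⌋₊
  have hsum : ∀ s : ℝ, 0 ≤ s → (Nat.card {I : (Ideal (𝓞 K))⁰ // absNorm (I : Ideal (𝓞 K)) ≤ s} : ℝ) = ∑ Cl, (Nat.card {I : (Ideal (𝓞 K))⁰ // absNorm (I : Ideal (𝓞 K)) ≤ s ∧ ClassGroup.mk0 I = Cl} : ℝ) := by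
    intro s hs
    have := hfin s hs
    have : Fintype {I : (Ideal (𝓞 K))⁰ // absNorm (I : Ideal (𝓞 K)) ≤ s} := Fintype.ofFinite _
    let e := fun C : ClassGroup (𝓞 K) ↦ Equiv.subtypeSubtypeEquivSubtypeInter
      (fun I : (Ideal (𝓞 K))⁰ ↦ absNorm I.1 ≤ s) (fun I ↦ ClassGroup.mk0 I = C)
    simp_rw [← Nat.card_congr (e _), Nat.card_eq_fintype_card, Fintype.subtype_card]
    rw [Fintype.card, Finset.card_eq_sum_card_fiberwise (f := fun I ↦ ClassGroup.mk0 I.1)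
      (t := Finset.univ) (fun _ _ ↦ Finset.mem_univ _), Nat.cast_sum]
  set S := 1 + ∑ Cl, s0 Cl with hS
  have hSs : ∀ Cl, s0 Cl ≤ S := fun Cl => by
    have := Finset.single_le_sum (f := s0) (fun i _ => (hs0 i).le) (Finset.mem_univ Cl)
    linarith
  have hS1 : 1 ≤ S := by
    have := Finset.sum_nonneg (s := Finset.univ) (f := s0) (fun i _ => (hs0 i).le)
    linarith
  set c' := ∑ Cl, c Cl with hc'
  have hc'0 : 0 < c' := Finset.sum_pos (fun i _ => hc i) ⟨1, Finset.mem_univ _⟩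
  set N : ℝ → ℝ := fun s => (Nat.card {I : (Ideal (𝓞 K))⁰ // absNorm (I : Ideal (𝓞 K)) ≤ s} : ℝ) with hN
  refine ⟨c', max (∑ Cl, C Cl) (N S + c' * S), hc'0, fun s hs => ?_⟩
  rcases le_total S s with hSs' | hSs'
  · rw [hsum s (by linarith), hc', Finset.sum_mul, ← Finset.sum_sub_distrib]
    refine (Finset.abs_sum_le_sum_abs _ _).trans ?_
    calc _ ≤ ∑ Cl, C Cl * s ^ θ := Finset.sum_le_sum fun Cl _ => h Cl s ((hSs Cl).trans hSs')
      _ = (∑ Cl, C Cl) * s ^ θ := by rw [Finset.sum_mul]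
      _ ≤ _ := by gcongr; exact le_max_left _ _
  · have h1 : N s ≤ N S := by
      have := hfin S (by linarith)
      simp only [hN, Nat.cast_le]
      exact Nat.card_le_card_of_injective (fun I : {I : (Ideal (𝓞 K))⁰ // absNorm (I : Ideal (𝓞 K)) ≤ s} => (⟨I.1, I.2.trans hSs'⟩ : {I : (Ideal (𝓞 K))⁰ // absNorm (I : Ideal (𝓞 K)) ≤ S})) (fun a b hab => by
        exact Subtype.ext (congrArg (fun x => x.1) hab))
    have h2 : 0 ≤ N s := Nat.cast_nonneg _
    have h3 : 1 ≤ s ^ θ := Real.one_le_rpow hs hθ0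
    have h4 : |N s - c' * s| ≤ N S + c' * S := by
      rw [abs_le]
      constructor <;> nlinarith
    refine h4.trans ?_
    have h5 : N S + c' * S ≤ max (∑ Cl, C Cl) (N S + c' * S) := le_max_right _ _
    have h6 : 0 ≤ N S + c' * S := (abs_nonneg _).trans h4
    nlinarith
end QD

namespace QD
open MeasureTheory Filter Topology Set
open scoped nonZeroDivisors
open NumberField Ideal

variable (K : Type*) [Field K] [NumberField K]

noncomputable def ids (n : ℕ) : Finset (Ideal (𝓞 K)) := (finite_setOfPred_absNorm_eq (S := 𝓞 K) n).toFinset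
noncomputable def aK (n : ℕ) : ℝ := if n = 0 then 0 else ((ids K n).card : ℝ)
noncomputable def prs (n : ℕ) : Finset (Ideal (𝓞 K)) := (finite_setOfPred_absNorm_le (S := 𝓞 K) n).toFinset.filter Prime
noncomputable def LamK (n : ℕ) : ℝ := ∑ P ∈ prs K n, ∑ k ∈ Finset.Icc 1 n, if absNorm P ^ k = n then Real.log (absNorm P) else 0

variable {K}
lemma mem_ids {n : ℕ} {I : Ideal (𝓞 K)} : I ∈ ids K n ↔ absNorm I = n := by simp [ids]
lemma mem_prs {n : ℕ} {I : Ideal (𝓞 K)} : I ∈ prs K n ↔ absNorm I ≤ n ∧ Prime I := by simp [prs]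

lemma two_le_norm {P : Ideal (𝓞 K)} (hP : Prime P) : 2 ≤ absNorm P := by
  have h0 : absNorm P ≠ 0 := fun h => hP.ne_zero (absNorm_eq_zero_iff.mp h)
  have h1 : absNorm P ≠ 1 := fun h => hP.not_isUnit (by rw [absNorm_eq_one_iff.mp h, ← Ideal.one_eq_top]; exact isUnit_one)
  omega

lemma LamK_eq {d n : ℕ} (h : d ≤ n) : LamK K d = ∑ P ∈ prs K n, ∑ k ∈ Finset.Icc 1 n, if absNorm P ^ k = d then Real.log (absNorm P) else 0 := by
  unfold LamK
  have h1 : ∀ P ∈ prs K n, (∑ k ∈ Finset.Icc 1 d, if absNorm P ^ k = d then Real.log (absNorm P) else 0) = ∑ k ∈ Finset.Icc 1 n, if absNorm P ^ k = d then Real.log (absNorm P) else 0 := by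
    intro P hP
    refine Finset.sum_subset (Finset.Icc_subset_Icc_right h) ?_
    intro k hk hk'
    rw [if_neg]
    intro he
    apply hk'
    rw [Finset.mem_Icc] at hk ⊢
    refine ⟨hk.1, ?_⟩
    rw [← he]
    exact (Nat.lt_pow_self (two_le_norm (mem_prs.mp hP).2)).le
  rw [← Finset.sum_congr rfl h1]
  refine Finset.sum_subset ?_ ?_
  · intro P hP
    rw [mem_prs] at hP ⊢
    exact ⟨hP.1.trans h, hP.2⟩
  · intro P hP hP'
    refine Finset.sum_eq_zero fun k hk => ?_
    rw [if_neg]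
    intro he
    apply hP'
    rw [mem_prs] at hP ⊢
    refine ⟨?_, hP.2⟩
    rw [← he]
    exact Nat.le_self_pow (by rw [Finset.mem_Icc] at hk; omega) _

lemma log_norm {I : Ideal (𝓞 K)} (hI : I ≠ ⊥) {n : ℕ} (hn : absNorm I ≤ n) :
    Real.log (absNorm I) = ∑ P ∈ prs K n, ∑ k ∈ Finset.Icc 1 n, if P ^ k ∣ I then Real.log (absNorm P) else 0 := by
  have hI0 : 0 < absNorm I := Nat.pos_of_ne_zero (fun h => hI (absNorm_eq_zero_iff.mp h))
  set nf := UniqueFactorizationMonoid.normalizedFactors I with hnf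
  have hdvd : ∀ P : Ideal (𝓞 K), Prime P → ∀ k, P ^ k ∣ I ↔ k ≤ nf.count P := by
    intro P hP k
    have := UniqueFactorizationMonoid.emultiplicity_eq_count_normalizedFactors hP.irreducible hI
    rw [normalize_eq] at this
    rw [pow_dvd_iff_le_emultiplicity, this]
    exact_mod_cast Iff.rfl
  have hsubn : ∀ J : Ideal (𝓞 K), J ∣ I → absNorm J ≤ n := fun J hJ => (Nat.le_of_dvd hI0 (map_dvd absNorm hJ)).trans hn
  have h1 : ∀ P ∈ prs K n, (∑ k ∈ Finset.Icc 1 n, if P ^ k ∣ I then Real.log (absNorm P) else 0) = nf.count P * Real.log (absNorm P) := by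
    intro P hP
    have hP' := (mem_prs.mp hP).2
    rw [← Finset.sum_filter, Finset.sum_const, nsmul_eq_mul]
    congr 2
    have : (Finset.Icc 1 n).filter (fun k => P ^ k ∣ I) = Finset.Icc 1 (nf.count P) := by
      ext k
      rw [Finset.mem_filter, Finset.mem_Icc, Finset.mem_Icc, hdvd P hP']
      constructor
      · rintro ⟨h, h'⟩; exact ⟨h.1, h'⟩
      · rintro ⟨h, h'⟩
        refine ⟨⟨h, ?_⟩, h'⟩
        have h2 := hsubn _ ((hdvd P hP' k).mpr h')
        rw [map_pow] at h2
        exact (Nat.lt_pow_self (two_le_norm hP')).le.trans h2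
    rw [this, Nat.card_Icc, Nat.add_sub_cancel]
  rw [Finset.sum_congr rfl h1]
  have h2 : Real.log (absNorm I) = (nf.map (fun P => Real.log (absNorm P))).sum := by
    conv_lhs => rw [← Ideal.prod_normalizedFactors_eq_self hI, ← hnf]
    have : ∀ s : Multiset (Ideal (𝓞 K)), (∀ P ∈ s, Prime P) → Real.log (absNorm s.prod) = (s.map (fun P => Real.log (absNorm P))).sum := by
      intro s
      induction s using Multiset.induction with
      | empty => simp
      | cons P s ih =>
        intro h
        have hpos : ∀ Q ∈ P ::ₘ s, (absNorm Q : ℝ) ≠ 0 := fun Q hQ => by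
          have := two_le_norm (h Q hQ); positivity
        have hs0 : (absNorm s.prod : ℝ) ≠ 0 := by
          rw [map_multiset_prod, Nat.cast_multiset_prod]
          intro h0
          rw [Multiset.prod_eq_zero_iff] at h0
          simp only [Multiset.map_map, Multiset.mem_map, Function.comp_apply] at h0
          obtain ⟨Q, hQ, hQ0⟩ := h0
          exact hpos Q (Multiset.mem_cons_of_mem hQ) hQ0
        rw [Multiset.prod_cons, Multiset.map_cons, Multiset.sum_cons, map_mul, Nat.cast_mul, Real.log_mul (hpos P (Multiset.mem_cons_self _ _)) hs0, ih (fun Q hQ => h Q (Multiset.mem_cons_of_mem hQ))]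
    exact this nf (fun P hP => UniqueFactorizationMonoid.prime_of_normalized_factor P hP)
  rw [h2, Finset.sum_multiset_map_count]
  simp only [nsmul_eq_mul]
  refine Finset.sum_subset ?_ ?_
  · intro P hP
    rw [Multiset.mem_toFinset] at hP
    exact mem_prs.mpr ⟨hsubn P (UniqueFactorizationMonoid.dvd_of_mem_normalizedFactors hP), UniqueFactorizationMonoid.prime_of_normalized_factor P hP⟩
  · intro P _ hP
    rw [Multiset.mem_toFinset] at hP
    rw [Multiset.count_eq_zero_of_notMem hP]; simp

lemma card_dvd {n : ℕ} (hn : n ≠ 0) (Q : Ideal (𝓞 K)) :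
    (((ids K n).filter (fun I => Q ∣ I)).card : ℝ) = ∑ d ∈ n.divisorsAntidiagonal, if absNorm Q = d.1 then aK K d.2 else 0 := by
  by_cases h : absNorm Q ∣ n
  · obtain ⟨m, hm⟩ := h
    have hQ0 : absNorm Q ≠ 0 := by rintro h0; rw [h0, zero_mul] at hm; exact hn hm
    have hm0 : m ≠ 0 := by rintro h0; rw [h0, mul_zero] at hm; exact hn hm
    rw [Finset.sum_eq_single (absNorm Q, m)]
    · rw [if_pos rfl, aK, if_neg hm0]
      norm_cast
      symm
      refine Finset.card_bij (fun J _ => Q * J) ?_ ?_ ?_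
      · intro J hJ
        rw [mem_ids] at hJ
        rw [Finset.mem_filter, mem_ids, map_mul, hJ, hm]
        exact ⟨rfl, dvd_mul_right _ _⟩
      · intro J _ J' _ h
        have : Q ≠ 0 := fun h => hQ0 (by rw [h]; simp)
        exact mul_left_cancel₀ this h
      · intro I hI
        rw [Finset.mem_filter, mem_ids] at hI
        obtain ⟨h1, J, rfl⟩ := hI
        refine ⟨J, ?_, rfl⟩
        rw [mem_ids]
        rw [map_mul, hm] at h1
        exact mul_left_cancel₀ hQ0 h1
    · rintro ⟨d, e⟩ hde hne
      rw [if_neg]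
      rintro h
      simp only at h
      subst h
      apply hne
      rw [Nat.mem_divisorsAntidiagonal] at hde
      have : absNorm Q * e = absNorm Q * m := by rw [← hm, ← hde.1]
      rw [mul_left_cancel₀ hQ0 this]
    · intro h
      exact absurd (Nat.mem_divisorsAntidiagonal.mpr ⟨hm.symm, hn⟩) h
  · rw [Finset.sum_eq_zero, Finset.filter_eq_empty_iff.mpr]
    · simp
    · intro I hI hd
      rw [mem_ids] at hI
      exact h (hI ▸ map_dvd absNorm hd)
    · rintro ⟨d, e⟩ hde
      rw [if_neg]
      rintro rfl
      exact h ⟨e, (Nat.mem_divisorsAntidiagonal.mp hde).1.symm⟩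

lemma conv_K (n : ℕ) : aK K n * Real.log n = ∑ d ∈ n.divisorsAntidiagonal, LamK K d.1 * aK K d.2 := by
  by_cases hn : n = 0
  · subst hn; simp
  have h1 : aK K n * Real.log n = ∑ I ∈ ids K n, Real.log (absNorm I) := by
    rw [Finset.sum_congr rfl (g := fun _ => Real.log n) (fun I hI => by rw [mem_ids.mp hI]), Finset.sum_const, nsmul_eq_mul, aK, if_neg hn]
  rw [h1, Finset.sum_congr rfl (fun I hI => log_norm (n := n) (fun h => hn (by rw [← mem_ids.mp hI, h]; simp)) (mem_ids.mp hI).le)]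
  rw [Finset.sum_comm]
  have h2 : ∀ d ∈ n.divisorsAntidiagonal, LamK K d.1 * aK K d.2 = ∑ P ∈ prs K n, ∑ k ∈ Finset.Icc 1 n, Real.log (absNorm P) * (if absNorm (P ^ k) = d.1 then aK K d.2 else 0) := by
    rintro ⟨d, e⟩ hde
    rw [Nat.mem_divisorsAntidiagonal] at hde
    simp only at hde ⊢
    have hd0 : d ≠ 0 := by rintro rfl; rw [zero_mul] at hde; exact hde.2 hde.1.symm
    rw [LamK_eq (Nat.le_of_dvd (Nat.pos_of_ne_zero hn) ⟨e, hde.1.symm⟩), Finset.sum_mul]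
    refine Finset.sum_congr rfl fun P _ => ?_
    rw [Finset.sum_mul]
    refine Finset.sum_congr rfl fun k _ => ?_
    rw [map_pow]
    split_ifs <;> simp
  rw [Finset.sum_congr rfl h2]
  refine Eq.trans ?_ Finset.sum_comm
  refine Finset.sum_congr rfl fun P _ => ?_
  rw [Finset.sum_comm]
  refine Eq.trans ?_ Finset.sum_comm
  refine Finset.sum_congr rfl fun k _ => ?_
  rw [← Finset.mul_sum, ← card_dvd hn, ← Finset.sum_filter, Finset.sum_const, nsmul_eq_mul, mul_comm]

lemma LamK_nonneg (n : ℕ) : 0 ≤ LamK K n := by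
  refine Finset.sum_nonneg fun P _ => Finset.sum_nonneg fun k _ => ?_
  split_ifs
  · exact Real.log_natCast_nonneg _
  · rfl

lemma aK_nonneg (n : ℕ) : 0 ≤ aK K n := by
  unfold aK; split_ifs <;> positivity

def gd (n : ℕ) (P : Ideal (𝓞 K)) : Prop := ∃ k ∈ Finset.Icc 1 n, absNorm P ^ k = n

lemma LamK_le (n : ℕ) : LamK K n ≤ Module.finrank ℚ K * ArithmeticFunction.vonMangoldt n := by
  by_cases hex : ∃ P ∈ prs K n, ∃ k ∈ Finset.Icc 1 n, absNorm P ^ k = n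
  swap
  · have : LamK K n = 0 := by
      refine Finset.sum_eq_zero fun P hP => Finset.sum_eq_zero fun k hk => ?_
      rw [if_neg]
      intro h
      exact hex ⟨P, hP, k, hk, h⟩
    rw [this]
    exact mul_nonneg (Nat.cast_nonneg _) ArithmeticFunction.vonMangoldt_nonneg
  obtain ⟨P, hP, k, hk, hPk⟩ := hex
  have hmax : ∀ P : Ideal (𝓞 K), Prime P → P.IsMaximal := fun P hP =>
    (Ideal.isPrime_of_prime hP).isMaximal hP.ne_zero
  obtain ⟨p, hp, m, hm, hn⟩ : ∃ p : ℕ, p.Prime ∧ ∃ m : ℕ, m ≠ 0 ∧ n = p ^ m := by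
    have := hmax P (mem_prs.mp hP).2
    obtain ⟨p, f, hf, _, hp, hPf⟩ := exists_prime_and_absNorm_eq_pow P
    refine ⟨p, hp, f * k, ?_, ?_⟩
    · rw [Finset.mem_Icc] at hk
      exact mul_ne_zero (by omega) (by omega)
    · rw [← hPk, hPf, pow_mul]
  set S := (prs K n).filter (gd n) with hS
  have hSd : ∀ Q ∈ S, Q ∣ span {(p : 𝓞 K)} := by
    intro Q hQ
    rw [hS, Finset.mem_filter] at hQ
    obtain ⟨hQ, k, hk, hk'⟩ := hQ
    rw [Ideal.dvd_span_singleton]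
    have hQp := Ideal.isPrime_of_prime (mem_prs.mp hQ).2
    have h1 : ((n : ℕ) : 𝓞 K) ∈ Q := by
      rw [← hk', Nat.cast_pow]
      exact Ideal.pow_mem_of_mem _ (absNorm_mem Q) _ (by rw [Finset.mem_Icc] at hk; omega)
    rw [hn, Nat.cast_pow] at h1
    exact hQp.mem_of_pow_mem _ h1
  have h1 : LamK K n ≤ ∑ P ∈ S, Real.log (absNorm P) := by
    rw [hS, Finset.sum_filter]
    refine Finset.sum_le_sum fun Q hQ => ?_
    split_ifs with h
    · obtain ⟨k0, hk0, hk1⟩ := h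
      rw [Finset.sum_eq_single k0]
      · rw [if_pos hk1]
      · intro j _ hj
        rw [if_neg]
        intro hj'
        exact hj (Nat.pow_right_injective (two_le_norm (mem_prs.mp hQ).2) (hj'.trans hk1.symm))
      · intro h; exact absurd hk0 h
    · refine (Finset.sum_eq_zero fun k hk => ?_).le
      rw [if_neg]
      intro h'
      exact h ⟨k, hk, h'⟩
  have h2 : ∏ P ∈ S, P ∣ span {(p : 𝓞 K)} := Finset.prod_primes_dvd _ (fun Q hQ => (mem_prs.mp (Finset.mem_filter.mp hQ).1).2) hSd
  have h3 := map_dvd absNorm h2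
  rw [absNorm_span_natCast, map_prod] at h3
  have h4 := Nat.le_of_dvd (pow_pos hp.pos _) h3
  have h5 : ∑ P ∈ S, Real.log (absNorm P) = Real.log ((∏ P ∈ S, absNorm P : ℕ) : ℝ) := by
    rw [Nat.cast_prod, Real.log_prod]
    intro Q hQ
    have := two_le_norm (mem_prs.mp (Finset.mem_filter.mp hQ).1).2
    positivity
  refine h1.trans ?_
  rw [h5, hn, ArithmeticFunction.vonMangoldt_apply_pow hm, ArithmeticFunction.vonMangoldt_apply_prime hp]
  have h6 : Module.finrank ℤ (𝓞 K) = Module.finrank ℚ K := RingOfIntegers.rank K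
  rw [h6] at h4
  rw [← Real.log_pow]
  refine Real.log_le_log ?_ (by exact_mod_cast h4)
  have : 0 < ∏ P ∈ S, absNorm P := Finset.prod_pos fun Q hQ => by
    have := two_le_norm (mem_prs.mp (Finset.mem_filter.mp hQ).1).2
    omega
  exact_mod_cast this

lemma aK_sum (x : ℝ) (hx : 1 ≤ x) : ∑ n ∈ Finset.Icc 1 ⌊x⌋₊, aK K n = (Nat.card {I : (Ideal (𝓞 K))⁰ // absNorm (I : Ideal (𝓞 K)) ≤ x} : ℝ) := by
  have h1 : ∑ n ∈ Finset.Icc 1 ⌊x⌋₊, aK K n = ((∑ n ∈ Finset.Icc 1 ⌊x⌋₊, (ids K n).card : ℕ) : ℝ) := by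
    rw [Nat.cast_sum]
    refine Finset.sum_congr rfl fun n hn => ?_
    rw [aK, if_neg (by rw [Finset.mem_Icc] at hn; omega)]
  rw [h1, ← Finset.card_biUnion]
  · congr 1
    rw [← Nat.card_eq_finsetCard]
    refine Nat.card_congr ⟨fun I => ⟨⟨I.1, ?_⟩, ?_⟩, fun I => ⟨I.1.1, ?_⟩, fun _ => rfl, fun _ => rfl⟩
    · have := I.2
      rw [Finset.mem_biUnion] at this
      obtain ⟨n, hn, hI⟩ := this
      rw [mem_ids] at hI
      rw [Finset.mem_Icc] at hn
      exact absNorm_pos_iff_mem_nonZeroDivisors.mp (by omega)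
    · have := I.2
      rw [Finset.mem_biUnion] at this
      obtain ⟨n, hn, hI⟩ := this
      rw [mem_ids] at hI
      rw [Finset.mem_Icc] at hn
      exact (Nat.le_floor_iff (by linarith)).mp (by simp only; omega)
    · rw [Finset.mem_biUnion]
      refine ⟨_, ?_, mem_ids.mpr rfl⟩
      rw [Finset.mem_Icc]
      exact ⟨absNorm_pos_of_nonZeroDivisors I.1, (Nat.le_floor_iff (by linarith)).mpr I.2⟩
  · intro a _ b _ hab
    rw [Function.onFun, Finset.disjoint_left]
    intro I h1 h2
    rw [mem_ids] at h1 h2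
    exact hab (h1.symm.trans h2)

variable (K)
theorem LamK_asymp : Tendsto (fun x : ℝ => (∑ n ∈ Finset.Icc 1 ⌊x⌋₊, LamK K n)/x) atTop (𝓝 1) := by
  obtain ⟨c, C, hc, h⟩ := ideal_count K
  have hK : (1:ℝ) ≤ Module.finrank ℚ K := by exact_mod_cast Module.finrank_pos (R := ℚ) (M := K)
  refine PIT (aK K) (LamK K) aK_nonneg LamK_nonneg (Module.finrank ℚ K) (by positivity) LamK_le conv_K c (1 - 1 / (2 * (Module.finrank ℚ K : ℝ))) C hc ?_ ?_ ?_
  · rw [sub_nonneg, div_le_one (by positivity)]; linarith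
  · have : 0 < 1 / (2 * (Module.finrank ℚ K : ℝ)) := by positivity
    linarith
  · intro x hx
    rw [aK_sum x hx]
    exact h x hx

lemma LamK_prime (p : ℕ) (hp : p.Prime) : LamK K p = (ids K p).card * Real.log p := by
  have h := conv_K (K := K) p
  rw [Nat.sum_divisorsAntidiagonal (f := fun d e => LamK K d * aK K e), Nat.Prime.divisors hp] at h
  have h1 : LamK K 1 = 0 := le_antisymm (by simpa using LamK_le (K := K) 1) (LamK_nonneg 1)
  have h2 : ids K 1 = {⊤} := by ext I; rw [mem_ids, absNorm_eq_one_iff]; simp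
  rw [Finset.sum_pair (Ne.symm hp.ne_one)] at h
  simp only [aK, h1] at h
  simpa [hp.ne_zero, Nat.div_self hp.pos, h2] using h.symm

theorem primes_asymp : Tendsto (fun x : ℝ => (∑ p ∈ (Finset.Icc 1 ⌊x⌋₊).filter Nat.Prime, ((ids K p).card : ℝ) * Real.log p)/x) atTop (𝓝 1) := by
  have h := LamK_asymp K
  have hd : ∀ x : ℝ, 1 ≤ x → |(∑ n ∈ Finset.Icc 1 ⌊x⌋₊, LamK K n) - ∑ p ∈ (Finset.Icc 1 ⌊x⌋₊).filter Nat.Prime, ((ids K p).card : ℝ) * Real.log p| ≤ Module.finrank ℚ K * (Chebyshev.psi x - Chebyshev.theta x) := by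
    intro x hx
    rw [← Finset.sum_filter_add_sum_filter_not (Finset.Icc 1 ⌊x⌋₊) Nat.Prime]
    rw [Finset.sum_congr rfl (fun p hp => LamK_prime K p (Finset.mem_filter.mp hp).2), add_sub_cancel_left, abs_of_nonneg (Finset.sum_nonneg fun n _ => LamK_nonneg n)]
    rw [Chebyshev.psi_sub_theta_eq_sum_not_prime, Finset.mul_sum]
    exact Finset.sum_le_sum fun n _ => LamK_le n
  have h0 : Tendsto (fun x : ℝ => Module.finrank ℚ K * (Chebyshev.psi x - Chebyshev.theta x) / x) atTop (𝓝 0) := by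
    have := Chebyshev.isBigO_psi_sub_theta_sqrt
    have h1 : (fun x : ℝ => √x) =o[atTop] (fun x : ℝ => x) := by
      refine Asymptotics.isLittleO_of_tendsto' ?_ ?_
      · filter_upwards [eventually_gt_atTop 0] with x hx h0
        exact absurd h0 hx.ne'
      · simp_rw [Real.sqrt_div_self]
        exact Real.tendsto_sqrt_atTop.inv_tendsto_atTop
    have h2 := (this.trans_isLittleO h1).tendsto_div_nhds_zero
    have h3 := h2.const_mul (Module.finrank ℚ K : ℝ)
    rw [mul_zero] at h3
    refine h3.congr fun x => ?_
    simp only [Pi.sub_apply]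
    ring
  have hdiff : Tendsto (fun x : ℝ => (∑ n ∈ Finset.Icc 1 ⌊x⌋₊, LamK K n)/x - (∑ p ∈ (Finset.Icc 1 ⌊x⌋₊).filter Nat.Prime, ((ids K p).card : ℝ) * Real.log p)/x) atTop (𝓝 0) := by
    refine squeeze_zero_norm' ?_ h0
    filter_upwards [eventually_ge_atTop 1] with x hx
    rw [← sub_div, Real.norm_eq_abs, abs_div, abs_of_pos (by linarith : 0 < x)]
    gcongr
    exact hd x hx
  have := h.sub hdiff
  simpa using this
end QD

namespace QD
open MeasureTheory Filter Topology Set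
open NumberField Ideal

noncomputable def cnt (S : ℕ → Prop) (x : ℝ) : ℝ := (((Finset.Icc 1 ⌊x⌋₊).filter (fun p => p.Prime ∧ S p)).card : ℝ)
noncomputable def tht (S : ℕ → Prop) (x : ℝ) : ℝ := ∑ p ∈ (Finset.Icc 1 ⌊x⌋₊).filter (fun p => p.Prime ∧ S p), Real.log p
def HasDens (S : ℕ → Prop) (δ : ℝ) : Prop := Tendsto (fun x : ℝ => cnt S x / cnt (fun _ => True) x) atTop (𝓝 δ)

lemma theta_asymp : Tendsto (fun x : ℝ => tht (fun _ => True) x / x) atTop (𝓝 1) := by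
  have h : Tendsto (fun x : ℝ => (∑ n ∈ Finset.Icc 1 ⌊x⌋₊, ArithmeticFunction.vonMangoldt n)/x) atTop (𝓝 1) := by
    refine PIT (fun _ => 1) (fun n => ArithmeticFunction.vonMangoldt n) (fun _ => zero_le_one) (fun _ => ArithmeticFunction.vonMangoldt_nonneg) 1 zero_le_one (fun n => by simp) ?_ 1 0 1 one_pos le_rfl one_pos ?_
    · intro n
      rw [one_mul, ← ArithmeticFunction.vonMangoldt_sum, Nat.sum_divisorsAntidiagonal (f := fun d _ => ArithmeticFunction.vonMangoldt d * 1)]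
      simp
    · intro x hx
      simp only [Finset.sum_const, Nat.card_Icc, nsmul_eq_mul, Real.rpow_zero]
      simp only [Nat.add_sub_cancel, mul_one, one_mul]
      have h1 := Nat.floor_le (by linarith : 0 ≤ x)
      have h2 := Nat.lt_floor_add_one x
      rw [abs_le]; constructor <;> linarith
  have h0 : Tendsto (fun x : ℝ => (Chebyshev.psi x - Chebyshev.theta x) / x) atTop (𝓝 0) := by
    have h1 : (fun x : ℝ => √x) =o[atTop] (fun x : ℝ => x) := by
      refine Asymptotics.isLittleO_of_tendsto' ?_ ?_
      · filter_upwards [eventually_gt_atTop 0] with x hx h0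
        exact absurd h0 hx.ne'
      · simp_rw [Real.sqrt_div_self]
        exact Real.tendsto_sqrt_atTop.inv_tendsto_atTop
    exact (Chebyshev.isBigO_psi_sub_theta_sqrt.trans_isLittleO h1).tendsto_div_nhds_zero
  have h2 := h.sub h0
  rw [sub_zero] at h2
  refine h2.congr fun x => ?_
  rw [← sub_div]
  congr 1
  have e1 : Chebyshev.psi x = ∑ n ∈ Finset.Icc 1 ⌊x⌋₊, ArithmeticFunction.vonMangoldt n := rfl
  have e2 : Chebyshev.theta x = tht (fun _ => True) x := by
    unfold tht; simp only [and_true]; rfl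
  rw [← e1, ← e2]; ring

lemma cnt_nonneg (S : ℕ → Prop) (x : ℝ) : 0 ≤ cnt S x := Nat.cast_nonneg _

lemma gap (S : ℕ → Prop) (x : ℝ) (hx : 1 ≤ x) : 0 ≤ cnt S x * Real.log x - tht S x ∧ cnt S x * Real.log x - tht S x ≤ cnt (fun _ => True) x * Real.log x - tht (fun _ => True) x := by
  have e : ∀ S : ℕ → Prop, cnt S x * Real.log x - tht S x = ∑ p ∈ (Finset.Icc 1 ⌊x⌋₊).filter (fun p => p.Prime ∧ S p), (Real.log x - Real.log p) := by
    intro S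
    rw [Finset.sum_sub_distrib, Finset.sum_const, nsmul_eq_mul]; rfl
  have hp : ∀ p ∈ Finset.Icc 1 ⌊x⌋₊, 0 ≤ Real.log x - Real.log p := by
    intro p hp
    rw [Finset.mem_Icc] at hp
    rw [sub_nonneg]
    refine Real.log_le_log (by exact_mod_cast hp.1) ?_
    exact (Nat.le_floor_iff (by linarith)).mp hp.2
  have key : ∀ T : ℕ → Prop, (∀ p, S p → T p) → cnt S x * Real.log x - tht S x ≤ cnt T x * Real.log x - tht T x := by
    intro T hST
    rw [e S, e T]
    refine Finset.sum_le_sum_of_subset_of_nonneg ?_ ?_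
    · intro p h
      rw [Finset.mem_filter] at h ⊢
      exact ⟨h.1, h.2.1, hST p h.2.2⟩
    · intro p h _
      exact hp p (Finset.mem_filter.mp h).1
  refine ⟨?_, key _ (fun _ _ => trivial)⟩
  rw [e S]
  exact Finset.sum_nonneg fun p h => hp p (Finset.mem_filter.mp h).1

lemma gap_lim : Tendsto (fun x : ℝ => (cnt (fun _ => True) x * Real.log x - tht (fun _ => True) x) / x) atTop (𝓝 0) := by
  have h := Chebyshev.primeCounting_sub_theta_div_log_isBigO
  have h2 : (fun x : ℝ => x / Real.log x ^ 2) =o[atTop] (fun x : ℝ => x / Real.log x) := by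
    refine Asymptotics.isLittleO_of_tendsto' ?_ ?_
    · filter_upwards [eventually_gt_atTop 1] with x hx h0
      have := Real.log_pos hx
      have : 0 < x / Real.log x := by positivity
      exact absurd h0 this.ne'
    · have : Tendsto (fun x : ℝ => (Real.log x)⁻¹) atTop (𝓝 0) := Real.tendsto_log_atTop.inv_tendsto_atTop
      refine this.congr' ?_
      filter_upwards [eventually_gt_atTop 1] with x hx
      have := Real.log_pos hx
      field_simp
  have h3 := (h.trans_isLittleO h2).tendsto_div_nhds_zero
  refine h3.congr' ?_
  filter_upwards [eventually_gt_atTop 1] with x hx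
  have hl := Real.log_pos hx
  have e2 : Chebyshev.theta x = tht (fun _ => True) x := by
    unfold tht; simp only [and_true]; rfl
  have e1 : (Nat.primeCounting ⌊x⌋₊ : ℝ) = cnt (fun _ => True) x := by
    unfold cnt
    simp only [and_true]
    rw [Nat.primeCounting, Nat.primeCounting', Nat.count_eq_card_filter_range]
    congr 2
    ext p
    simp only [Finset.mem_filter, Finset.mem_range, Finset.mem_Icc]
    constructor
    · rintro ⟨h, hp⟩; exact ⟨⟨hp.one_lt.le, by omega⟩, hp⟩
    · rintro ⟨h, hp⟩; exact ⟨by omega, hp⟩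
  rw [e1, e2]
  field_simp

lemma cnt_asymp (S : ℕ → Prop) (δ : ℝ) (h : Tendsto (fun x : ℝ => tht S x / x) atTop (𝓝 δ)) :
    Tendsto (fun x : ℝ => cnt S x * Real.log x / x) atTop (𝓝 δ) := by
  have h1 : Tendsto (fun x : ℝ => (cnt S x * Real.log x - tht S x) / x) atTop (𝓝 0) := by
    refine tendsto_of_tendsto_of_tendsto_of_le_of_le' tendsto_const_nhds gap_lim ?_ ?_
    · filter_upwards [eventually_ge_atTop 1] with x hx
      exact div_nonneg (gap S x hx).1 (by linarith)
    · filter_upwards [eventually_ge_atTop 1] with x hx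
      have := (gap S x hx).2
      gcongr
  have := h.add h1
  rw [add_zero] at this
  refine this.congr fun x => ?_
  rw [← add_div]; ring

lemma dens_of_tht (S : ℕ → Prop) (δ : ℝ) (h : Tendsto (fun x : ℝ => tht S x / x) atTop (𝓝 δ)) : HasDens S δ := by
  have h1 := cnt_asymp S δ h
  have h2 := cnt_asymp _ 1 theta_asymp
  have := h1.div h2 one_ne_zero
  rw [div_one] at this
  refine this.congr' ?_
  filter_upwards [eventually_gt_atTop 1] with x hx
  have := Real.log_pos hx
  simp only [Pi.div_apply]
  rw [div_div_div_cancel_right₀ (by linarith), mul_div_mul_right _ _ this.ne']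

theorem dens_of_K (K : Type*) [Field K] [NumberField K] (S : ℕ → Prop) (m : ℕ) (hm : m ≠ 0)
    (h : ∀ p : ℕ, p.Prime → ¬ p ∣ m → (ids K p).card = if S p then Module.finrank ℚ K else 0) :
    HasDens S (1 / (Module.finrank ℚ K : ℝ)) := by
  set D : ℝ := (Module.finrank ℚ K : ℝ) with hD
  have hD0 : 0 < D := by rw [hD]; exact_mod_cast Module.finrank_pos (R := ℚ) (M := K)
  refine dens_of_tht S _ ?_
  have h1 := primes_asymp K
  set C0 := ∑ p ∈ m.divisors, ((ids K p).card + D) * Real.log p with hC0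
  have hterm : ∀ p ∈ m.divisors, 0 ≤ ((ids K p).card + D) * Real.log p := fun p _ =>
    mul_nonneg (by positivity) (Real.log_natCast_nonneg p)
  have hb : ∀ x : ℝ, |D * tht S x - ∑ p ∈ (Finset.Icc 1 ⌊x⌋₊).filter Nat.Prime, ((ids K p).card : ℝ) * Real.log p| ≤ C0 := by
    intro x
    have e1 : D * tht S x = ∑ p ∈ (Finset.Icc 1 ⌊x⌋₊).filter Nat.Prime, (if S p then D else 0) * Real.log p := by
      unfold tht
      rw [← Finset.filter_filter, Finset.sum_filter, Finset.mul_sum]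
      refine Finset.sum_congr rfl fun p _ => ?_
      split_ifs <;> simp
    rw [e1, ← Finset.sum_sub_distrib]
    refine (Finset.abs_sum_le_sum_abs _ _).trans ?_
    have e2 : ∀ p ∈ (Finset.Icc 1 ⌊x⌋₊).filter Nat.Prime, |(if S p then D else 0) * Real.log p - ((ids K p).card : ℝ) * Real.log p| ≤ if p ∈ m.divisors then ((ids K p).card + D) * Real.log p else 0 := by
      intro p hp
      have hp' := (Finset.mem_filter.mp hp).2
      split_ifs with hS hd hd
      · rw [← sub_mul, abs_mul, abs_of_nonneg (Real.log_natCast_nonneg p)]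
        have := Real.log_natCast_nonneg p
        gcongr
        rw [abs_le]
        have : (0:ℝ) ≤ (ids K p).card := by positivity
        constructor <;> linarith
      · rw [h p hp' (fun hh => hd (Nat.mem_divisors.mpr ⟨hh, hm⟩)), if_pos hS]; simp [hD]
      · rw [zero_mul, zero_sub, abs_neg, abs_of_nonneg (mul_nonneg (by positivity) (Real.log_natCast_nonneg p))]
        have := Real.log_natCast_nonneg p
        gcongr
        linarith
      · rw [h p hp' (fun hh => hd (Nat.mem_divisors.mpr ⟨hh, hm⟩)), if_neg hS]; simp
    refine (Finset.sum_le_sum e2).trans ?_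
    rw [← Finset.sum_filter]
    refine Finset.sum_le_sum_of_subset_of_nonneg ?_ (fun p hp _ => hterm p hp)
    intro p hp
    exact (Finset.mem_filter.mp hp).2
  have h2 : Tendsto (fun x : ℝ => D * tht S x / x - (∑ p ∈ (Finset.Icc 1 ⌊x⌋₊).filter Nat.Prime, ((ids K p).card : ℝ) * Real.log p)/x) atTop (𝓝 0) := by
    refine squeeze_zero_norm' (a := fun x => C0 / x) ?_ (tendsto_const_nhds.div_atTop tendsto_id)
    filter_upwards [eventually_ge_atTop 1] with x hx
    rw [← sub_div, Real.norm_eq_abs, abs_div, abs_of_pos (by linarith : 0 < x)]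
    gcongr
    exact hb x
  have h3 := (h2.add h1).const_mul (1 / D)
  rw [zero_add, mul_one] at h3
  refine h3.congr fun x => ?_
  field_simp
  ring
end QD

namespace QD
open MeasureTheory Filter Topology Set
open NumberField Ideal

lemma mem_prime_field {k : Type*} [Field k] (p : ℕ) [Fact p.Prime] [CharP k p] (x : k) (hx : x ^ p = x) :
    ∃ n : ℕ, (n : k) = x := by
  let f := ZMod.castHom (dvd_refl p) k
  have hp := (Fact.out : p.Prime)
  have hne : (Polynomial.X ^ p - Polynomial.X : Polynomial k) ≠ 0 := FiniteField.X_pow_card_sub_X_ne_zero k hp.one_lt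
  have hsub : (Finset.univ.image f) ⊆ (Polynomial.X ^ p - Polynomial.X : Polynomial k).roots.toFinset := by
    intro y hy
    obtain ⟨c, -, rfl⟩ := Finset.mem_image.mp hy
    rw [Multiset.mem_toFinset, Polynomial.mem_roots hne]
    simp [Polynomial.IsRoot, ← map_pow, ZMod.pow_card]
  have hcard : (Polynomial.X ^ p - Polynomial.X : Polynomial k).roots.toFinset.card ≤ (Finset.univ.image f).card := by
    rw [Finset.card_image_of_injective _ f.injective, Finset.card_univ, ZMod.card]
    refine (Multiset.toFinset_card_le _).trans ((Polynomial.card_roots' _).trans ?_)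
    rw [FiniteField.X_pow_card_sub_X_natDegree_eq k hp.one_lt]
  have heq := Finset.eq_of_subset_of_card_le hsub hcard
  have hx' : x ∈ Finset.univ.image f := by
    rw [heq, Multiset.mem_toFinset, Polynomial.mem_roots hne]
    simp [Polynomial.IsRoot, hx]
  obtain ⟨c, -, rfl⟩ := Finset.mem_image.mp hx'
  refine ⟨c.val, ?_⟩
  have : f ((c.val : ℕ) : ZMod p) = f c := by rw [ZMod.natCast_zmod_val]
  rw [← this, map_natCast]

variable (L : Type*) [Field L] [NumberField L]

lemma clear_den (z w : 𝓞 L) (h : Algebra.adjoin ℚ {(z : L), (w : L)} = ⊤) :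
    ∃ m : ℕ, m ≠ 0 ∧ ∀ x : 𝓞 L, (m : 𝓞 L) * x ∈ Algebra.adjoin ℤ ({z, w} : Set (𝓞 L)) := by
  set A := Algebra.adjoin ℤ ({z, w} : Set (𝓞 L)) with hA
  have h1 : ∀ x : L, ∃ m : ℕ, m ≠ 0 ∧ ∃ y ∈ A, (y : L) = m * x := by
    intro x
    have hx : x ∈ Algebra.adjoin ℚ {(z : L), (w : L)} := by rw [h]; trivial
    induction hx using Algebra.adjoin_induction with
    | mem x hx =>
      rcases hx with rfl | rfl
      · exact ⟨1, one_ne_zero, z, Algebra.subset_adjoin (by simp), by simp⟩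
      · exact ⟨1, one_ne_zero, w, Algebra.subset_adjoin (by simp), by simp⟩
    | algebraMap r =>
      refine ⟨r.den, r.den_ne_zero, (r.num : 𝓞 L), ?_, ?_⟩
      · exact A.intCast_mem r.num
      · have : ((r.num : ℚ) : L) = ((r.den * r : ℚ) : L) := by rw [Rat.den_mul_eq_num]
        push_cast at this
        simpa using this
    | add x y _ _ hx hy =>
      obtain ⟨m, hm, u, hu, hux⟩ := hx
      obtain ⟨n, hn, v, hv, hvy⟩ := hy
      refine ⟨m * n, mul_ne_zero hm hn, n * u + m * v, A.add_mem (A.mul_mem (natCast_mem A n) hu) (A.mul_mem (natCast_mem A m) hv), ?_⟩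
      push_cast
      simp only [map_add, map_mul, map_natCast, hux, hvy]; ring
    | mul x y _ _ hx hy =>
      obtain ⟨m, hm, u, hu, hux⟩ := hx
      obtain ⟨n, hn, v, hv, hvy⟩ := hy
      refine ⟨m * n, mul_ne_zero hm hn, u * v, A.mul_mem hu hv, ?_⟩
      push_cast
      simp only [map_mul, hux, hvy]; ring
  let b := Module.Free.chooseBasis ℤ (𝓞 L)
  choose m hm y hy hyx using fun i => h1 (b i : L)
  refine ⟨∏ i, m i, Finset.prod_ne_zero_iff.mpr fun i _ => hm i, fun x => ?_⟩
  rw [← b.sum_repr x, Finset.mul_sum]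
  refine Subalgebra.sum_mem _ fun i _ => ?_
  rw [mul_smul_comm]
  refine Subalgebra.smul_mem _ ?_ _
  rw [← Finset.prod_erase_mul _ _ (Finset.mem_univ i)]
  push_cast
  rw [mul_assoc]
  refine A.mul_mem (A.prod_mem fun i _ => natCast_mem A _) ?_
  have : (m i : 𝓞 L) * b i = y i := by
    apply RingOfIntegers.ext
    rw [hyx]; simp
  rw [this]; exact hy i

lemma ids_card_full (p : ℕ) (hp : p.Prime) (hd : ¬ (p : ℤ) ∣ discr L)
    (hall : ∀ P : Ideal (𝓞 L), P.IsPrime → (p : 𝓞 L) ∈ P → absNorm P = p) :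
    (ids L p).card = Module.finrank ℚ L := by
  have hpp := Nat.prime_iff_prime_int.mp hp
  have hun := (not_dvd_discr_iff_isUnramifiedIn L (𝓞 L) hpp).mp hd
  have : (Ideal.span {(p : ℤ)}).IsPrime := (Ideal.span_singleton_prime hpp.ne_zero).mpr hpp
  have hmax : (Ideal.span {(p : ℤ)}).IsMaximal := this.isMaximal (by simpa using hp.ne_zero)
  have key := sum_ramification_inertia_eq_finrank (S := 𝓞 L) (Ideal.span {(p : ℤ)})
  rw [RingOfIntegers.rank] at key
  rw [← key]
  have hover : ∀ P : (Ideal.span {(p : ℤ)}).primesOver (𝓞 L), absNorm P.1 = p := by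
    intro P
    have := P.2.2
    refine hall P.1 P.2.1 ?_
    have h := (Ideal.mem_of_liesOver P.1 (Ideal.span {(p : ℤ)}) (p : ℤ)).mp (Ideal.mem_span_singleton_self _)
    simpa using h
  have h1 : ∀ q : (Ideal.span {(p : ℤ)}).primesOver (𝓞 L), q.1.ramificationIdx ℤ * q.1.inertiaDeg ℤ = 1 := by
    intro q
    have hq1 := q.2.1
    have hq := q.2.2
    rw [hun.ramificationIdx_eq_one hq, one_mul]
    have h2 := absNorm_eq_pow_inertiaDeg' q.1 hp
    rw [hover q] at h2
    have hqm : q.1.IsMaximal := .of_liesOver_isMaximal q.1 (Ideal.span {(p : ℤ)})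
    rw [inertiaDeg_eq_of_isMaximal (Ideal.span {(p : ℤ)}) q.1]
    rw [inertiaDeg'_algebraMap] at h2
    exact (Nat.pow_right_injective hp.two_le (by simpa using h2)).symm
  rw [Finset.sum_congr rfl fun q _ => h1 q, Finset.sum_const, smul_eq_mul, mul_one, Finset.card_univ]
  symm
  rw [← Fintype.card_coe]
  refine Fintype.card_congr (Equiv.subtypeEquivRight fun P => ?_)
  constructor
  · intro h
    exact mem_ids.mpr (hover ⟨P, h⟩)
  · intro h
    have h := mem_ids.mp h
    have hP : P.IsPrime := isPrime_of_irreducible_absNorm (by rw [h]; exact hp)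
    refine ⟨hP, ?_⟩
    have hmem : (p : 𝓞 L) ∈ P := by rw [← h]; exact absNorm_mem P
    constructor
    refine hmax.eq_of_le (Ideal.IsPrime.ne_top inferInstance) ?_
    rw [Ideal.span_singleton_le_iff_mem, Ideal.mem_under]
    simpa using hmem
end QD

namespace QD
open MeasureTheory Filter Topology Set
open NumberField Ideal

def SS (a j k p : ℕ) : Prop := 2 ^ j ∣ p - 1 ∧ ∃ c : ZMod p, c ^ (2 ^ k) = (a : ZMod p)

lemma pow_dvd_prime_sub_one {k : Type*} [Field k] (p : ℕ) [Fact p.Prime] (z : ZMod p) (hp2 : p ≠ 2) (j : ℕ)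
    (hz : z ^ (2 ^ j) = -1) : 2 ^ (j + 1) ∣ p - 1 := by
  have hne : (-1 : ZMod p) ≠ 1 := by
    have : Fact (2 < p) := ⟨lt_of_le_of_ne (Fact.out : p.Prime).two_le (Ne.symm hp2)⟩
    exact ZMod.neg_one_ne_one
  have ho : orderOf z = 2 ^ (j + 1) := by
    refine orderOf_eq_prime_pow ?_ ?_
    · rw [hz]; exact hne
    · rw [pow_succ, pow_mul, hz]; ring
  rw [← ho]
  refine orderOf_dvd_of_pow_eq_one (ZMod.pow_card_sub_one_eq_one ?_)
  rintro rfl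
  rw [zero_pow (by positivity)] at hz
  exact (neg_ne_zero.mpr one_ne_zero) hz.symm

theorem split_count (L : Type*) [Field L] [NumberField L] (a j k : ℕ) (ha : a ≠ 0) (hk : k ≤ j + 1) (ζ α : L)
    (hζ : ζ ^ (2 ^ j) = -1) (hα : α ^ (2 ^ k) = a) (hgen : Algebra.adjoin ℚ {ζ, α} = ⊤) :
    ∃ m : ℕ, m ≠ 0 ∧ ∀ p : ℕ, p.Prime → ¬ p ∣ m → (ids L p).card = if SS a (j + 1) k p then Module.finrank ℚ L else 0 := by
  have iz : IsIntegral ℤ ζ := IsIntegral.of_pow (n := 2 ^ j) (by positivity) (by rw [hζ]; exact isIntegral_one.neg)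
  have iw : IsIntegral ℤ α := IsIntegral.of_pow (n := 2 ^ k) (by positivity) (by rw [hα]; exact isIntegral_algebraMap (x := (a : ℤ)) |> fun h => by simpa using h)
  obtain ⟨z, rfl⟩ : ∃ z : 𝓞 L, (z : L) = ζ := ⟨⟨ζ, iz⟩, rfl⟩
  obtain ⟨w, rfl⟩ : ∃ w : 𝓞 L, (w : L) = α := ⟨⟨α, iw⟩, rfl⟩
  have hz : z ^ (2 ^ j) = -1 := by apply RingOfIntegers.ext; simpa using hζ
  have hw : w ^ (2 ^ k) = a := by apply RingOfIntegers.ext; simpa using hα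
  obtain ⟨m, hm, hmA⟩ := clear_den L z w hgen
  refine ⟨2 * a * m * (discr L).natAbs, ?_, ?_⟩
  · have := discr_ne_zero L
    positivity
  intro p hp hpm
  have := Fact.mk hp
  have h2 : p ≠ 2 := fun h => hpm (by rw [h, mul_assoc, mul_assoc]; exact dvd_mul_right _ _)
  have hpa : ¬ p ∣ a := fun h => hpm (((h.mul_left 2).mul_right m).mul_right _)
  have hpmm : ¬ p ∣ m := fun h => hpm ((h.mul_left _).mul_right _)
  have hd : ¬ (p : ℤ) ∣ discr L := fun h => hpm ((Int.natCast_dvd.mp h).mul_left _)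
  split_ifs with hS
  · refine ids_card_full L p hp hd ?_
    intro P hP hpP
    have hPne : P ≠ ⊥ := by
      rintro rfl
      rw [Ideal.mem_bot] at hpP
      exact hp.ne_zero (by exact_mod_cast hpP)
    have hPm := hP.isMaximal hPne
    let := Ideal.Quotient.field P
    set q := Ideal.Quotient.mk P with hq
    have hp0 : ((p : ℕ) : 𝓞 L ⧸ P) = 0 := by
      have : q (p : 𝓞 L) = 0 := Ideal.Quotient.eq_zero_iff_mem.mpr hpP
      simpa using this
    have hchar : CharP (𝓞 L ⧸ P) p := (CharP.charP_iff_prime_eq_zero hp).mpr hp0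
    obtain ⟨hdvd, c, hc⟩ := hS
    obtain ⟨t, ht⟩ := hdvd
    have hpt : p = 2 ^ (j + 1) * t + 1 := by have := hp.one_lt; omega
    have hzp : q z ^ p = q z := by
      have h : z ^ (2 ^ (j + 1)) = 1 := by rw [pow_succ, pow_mul, hz]; ring
      rw [← map_pow, hpt, pow_succ, pow_mul, h, one_pow, one_mul]
    let f := ZMod.castHom (dvd_refl p) (𝓞 L ⧸ P)
    have hc0 : c ≠ 0 := by
      rintro rfl
      rw [zero_pow (by positivity)] at hc
      exact hpa ((ZMod.natCast_eq_zero_iff a p).mp hc.symm)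
    have hwp : q w ^ p = q w := by
      have h : q w ^ (2 ^ k) = f c ^ (2 ^ k) := by
        rw [← map_pow, ← map_pow, hw, hc]; simp
      have h3 : q w ^ (p - 1) = 1 := by
        obtain ⟨e, he⟩ := Nat.exists_eq_add_of_le hk
        have : p - 1 = 2 ^ k * (2 ^ e * t) := by rw [ht, he]; ring
        rw [this, pow_mul, h, ← pow_mul, ← this, ← map_pow, ZMod.pow_card_sub_one_eq_one hc0, map_one]
      have : p = (p - 1) + 1 := by have := hp.one_lt; omega
      rw [this, pow_succ, h3, one_mul]
    obtain ⟨nz, hnz⟩ := mem_prime_field p _ hzp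
    obtain ⟨nw, hnw⟩ := mem_prime_field p _ hwp
    have hA : ∀ x ∈ Algebra.adjoin ℤ ({z, w} : Set (𝓞 L)), q x ∈ f.range := by
      intro x hx
      induction hx using Algebra.adjoin_induction with
      | mem x hx =>
        rcases hx with rfl | rfl
        · rw [← hnz]; exact natCast_mem _ _
        · rw [← hnw]; exact natCast_mem _ _
      | algebraMap r => simpa using intCast_mem f.range r
      | add x y _ _ hx hy => rw [map_add]; exact add_mem hx hy
      | mul x y _ _ hx hy => rw [map_mul]; exact mul_mem hx hy
    have hsurj : Function.Surjective f := by
      intro y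
      obtain ⟨x, rfl⟩ := Ideal.Quotient.mk_surjective y
      obtain ⟨u, hu⟩ := hA _ (hmA x)
      refine ⟨(m : ZMod p)⁻¹ * u, ?_⟩
      have hm0 : f (m : ZMod p) ≠ 0 := by
        rw [Ne, map_eq_zero]
        exact fun h => hpmm ((ZMod.natCast_eq_zero_iff m p).mp h)
      rw [map_mul, hu, map_inv₀, map_mul, map_natCast]
      rw [map_natCast] at hm0 ⊢
      rw [inv_mul_cancel_left₀ hm0]
    have hcard := Nat.card_congr (Equiv.ofBijective f ⟨f.injective, hsurj⟩)
    rw [Nat.card_zmod] at hcard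
    rw [absNorm_apply, hcard]; rfl
  · rw [Finset.card_eq_zero, Finset.eq_empty_iff_forall_notMem]
    intro P hP
    apply hS
    have h := mem_ids.mp hP
    have hPp : P.IsPrime := isPrime_of_irreducible_absNorm (by rw [h]; exact hp)
    have hcard : Nat.card (𝓞 L ⧸ P) = p := by rw [← h, absNorm_apply]; rfl
    have : Finite (𝓞 L ⧸ P) := Nat.finite_of_card_ne_zero (by rw [hcard]; exact hp.ne_zero)
    let := Fintype.ofFinite (𝓞 L ⧸ P)
    let e := ZMod.ringEquivOfPrime (𝓞 L ⧸ P) hp (by rw [← hcard, Nat.card_eq_fintype_card])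
    let g : 𝓞 L →+* ZMod p := (e.symm : (𝓞 L ⧸ P) →+* ZMod p).comp (Ideal.Quotient.mk P)
    constructor
    · refine pow_dvd_prime_sub_one (k := ℚ) p (g z) h2 j ?_
      rw [← map_pow, hz]; simp
    · exact ⟨g w, by rw [← map_pow, hw]; simp⟩

theorem dens_L (L : Type*) [Field L] [NumberField L] (a j k : ℕ) (ha : a ≠ 0) (hk : k ≤ j + 1) (ζ α : L)
    (hζ : ζ ^ (2 ^ j) = -1) (hα : α ^ (2 ^ k) = a) (hgen : Algebra.adjoin ℚ {ζ, α} = ⊤) :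
    HasDens (SS a (j + 1) k) (1 / (Module.finrank ℚ L : ℝ)) := by
  obtain ⟨m, hm, h⟩ := split_count L a j k ha hk ζ α hζ hα hgen
  exact dens_of_K L _ m hm h
end QD

namespace QD
open Polynomial IntermediateField

universe u

lemma irr2 (n : ℕ) : ∀ {K : Type u} [Field K] (a : K), (n ≤ 1 ∨ ∃ i : K, i ^ 2 = -1) → (n = 0 ∨ ∀ b : K, b ^ 2 ≠ a) →
    Irreducible (X ^ (2 ^ n) - C a) := by
  induction n with
  | zero => intro K _ a _ _; simpa using irreducible_X_sub_C a
  | succ n ih =>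
    intro K _ a hi ha
    replace ha := ha.resolve_left (by omega)
    rw [pow_succ]
    apply X_pow_mul_sub_C_irreducible (X_pow_sub_C_irreducible_of_prime Nat.prime_two ha)
    intro E _ _ x hx
    have hint : IsIntegral K x := not_not.mp fun h ↦ by
      simpa only [degree_zero, degree_X_pow_sub_C (show 0 < 2 by norm_num),
        WithBot.natCast_ne_bot] using congr_arg degree (hx.symm.trans (dif_neg h))
    rcases Nat.eq_zero_or_pos n with h0 | h0
    · subst h0; simpa using irreducible_X_sub_C _
    obtain ⟨i, hi⟩ := hi.resolve_left (by omega)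
    refine ih _ (Or.inr ⟨algebraMap K _ i, by rw [← map_pow, hi]; simp⟩) (Or.inr ?_)
    intro b hb
    have hN : Algebra.norm K (AdjoinSimple.gen K x) = -a := by
      rw [← adjoin.powerBasis_gen hint, Algebra.PowerBasis.norm_gen_eq_coeff_zero_minpoly]
      simp [minpoly_gen, hx]
    have := congrArg (Algebra.norm K) hb
    rw [map_pow, hN] at this
    refine ha (i * Algebra.norm K b) ?_
    rw [mul_pow, hi, this]; ring

/-- The Kummer extension. -/
lemma exists_L (K : Type) [Field K] [NumberField K] (n : ℕ) (b : K) (ζ : K) (hK : Algebra.adjoin ℚ {ζ} = ⊤)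
    (hirr : Irreducible (X ^ (2 ^ n) - C b)) : ∃ (L : Type) (_ : Field L) (_ : NumberField L) (f : K →+* L) (α : L),
      α ^ (2 ^ n) = f b ∧ Algebra.adjoin ℚ {f ζ, α} = ⊤ ∧ Module.finrank ℚ L = Module.finrank ℚ K * 2 ^ n := by
  have := Fact.mk hirr
  let L := AdjoinRoot (X ^ (2 ^ n) - C b)
  have hmon : (X ^ (2 ^ n) - C b).Monic := monic_X_pow_sub_C b (by positivity)
  have hfin : Module.Finite K L := hmon.finite_adjoinRoot
  have : FiniteDimensional ℚ L := Module.Finite.trans K L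
  have : CharZero L := charZero_of_injective_algebraMap (algebraMap K L).injective
  have hNF : NumberField L := ⟨⟩
  refine ⟨L, inferInstance, hNF, AdjoinRoot.of _, AdjoinRoot.root _, ?_, ?_, ?_⟩
  · have := AdjoinRoot.eval₂_root (X ^ (2 ^ n) - C b)
    simpa [sub_eq_zero] using this
  · rw [eq_top_iff]
    intro x hx0
    clear hx0
    induction x using AdjoinRoot.induction_on with
    | ih p =>
      have hof : ∀ y : K, AdjoinRoot.of (X ^ (2 ^ n) - C b) y ∈ Algebra.adjoin ℚ {AdjoinRoot.of (X ^ (2 ^ n) - C b) ζ, AdjoinRoot.root (X ^ (2 ^ n) - C b)} := by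
        intro y
        have hy : y ∈ Algebra.adjoin ℚ {ζ} := by rw [hK]; trivial
        induction hy using Algebra.adjoin_induction with
        | mem x hx => rw [Set.mem_singleton_iff] at hx; rw [hx]; exact Algebra.subset_adjoin (by simp)
        | algebraMap r => 
          have : AdjoinRoot.of (X ^ (2 ^ n) - C b) (algebraMap ℚ K r) = algebraMap ℚ L r := by
            simp
          rw [this]; exact Subalgebra.algebraMap_mem _ r
        | add x y _ _ hx hy => rw [map_add]; exact add_mem hx hy
        | mul x y _ _ hx hy => rw [map_mul]; exact mul_mem hx hy
      induction p using Polynomial.induction_on' with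
      | add p q hp hq => rw [map_add]; exact add_mem hp hq
      | monomial k c => 
        rw [← C_mul_X_pow_eq_monomial, map_mul, map_pow, AdjoinRoot.mk_C, AdjoinRoot.mk_X]
        exact mul_mem (hof c) (pow_mem (Algebra.subset_adjoin (by simp)) _)
  · rw [← Module.finrank_mul_finrank ℚ K L]
    congr 1
    rw [(AdjoinRoot.powerBasis hirr.ne_zero).finrank, AdjoinRoot.powerBasis_dim, natDegree_X_pow_sub_C]
end QD

namespace QD
open MeasureTheory Filter Topology Set
open NumberField Ideal

abbrev CK (j : ℕ) : Type := CyclotomicField (2 ^ (j + 1)) ℚ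
instance ck_inst (j : ℕ) : IsCyclotomicExtension {2 ^ (j + 1)} ℚ (CK j) :=
  have : NeZero ((2 ^ (j + 1) : ℕ) : ℚ) := ⟨by positivity⟩
  CyclotomicField.isCyclotomicExtension _ ℚ
noncomputable abbrev zt (j : ℕ) : CK j := IsCyclotomicExtension.zeta (2 ^ (j + 1)) ℚ (CK j)

lemma zt_spec (j : ℕ) : IsPrimitiveRoot (zt j) (2 ^ (j + 1)) := IsCyclotomicExtension.zeta_spec _ ℚ (CK j)

lemma zt_pow (j : ℕ) : zt j ^ (2 ^ j) = -1 := by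
  have h := zt_spec j
  have h1 : (zt j ^ (2 ^ j)) ^ 2 = 1 := by rw [← pow_mul, ← pow_succ]; exact h.pow_eq_one
  rcases sq_eq_one_iff.mp h1 with h2 | h2
  · exact absurd h2 (h.pow_ne_one_of_pos_of_lt (by positivity) (Nat.pow_lt_pow_right (by norm_num) (by omega)))
  · exact h2

lemma zt_adjoin (j : ℕ) : Algebra.adjoin ℚ {zt j} = ⊤ :=
  IsCyclotomicExtension.adjoin_primitive_root_eq_top (zt_spec j)

lemma CK_finrank (j : ℕ) : Module.finrank ℚ (CK j) = 2 ^ j := by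
  rw [IsCyclotomicExtension.finrank (n := 2 ^ (j + 1)) (CK j) (Polynomial.cyclotomic.irreducible_rat (by positivity)),
    Nat.totient_prime_pow_succ Nat.prime_two]
  simp

lemma CK_I (j : ℕ) (hj : 1 ≤ j) : ∃ i : CK j, i ^ 2 = -1 := by
  obtain ⟨t, rfl⟩ := Nat.exists_eq_add_of_le' hj
  exact ⟨zt (t + 1) ^ (2 ^ t), by rw [← pow_mul, ← pow_succ]; exact zt_pow (t + 1)⟩

lemma gal_exists (j t : ℕ) (ht : Odd t) : ∃ σ : CK j ≃ₐ[ℚ] CK j, σ (zt j) = zt j ^ t := by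
  have hc : t.Coprime (2 ^ (j + 1)) := (Nat.coprime_two_right.mpr ht).pow_right _
  exact ⟨IsCyclotomicExtension.fromZetaAut ((zt_spec j).pow_of_coprime t hc) (Polynomial.cyclotomic.irreducible_rat (by positivity)),
    IsCyclotomicExtension.fromZetaAut_spec _ _⟩

lemma gal_comm (j : ℕ) (σ τ : CK j ≃ₐ[ℚ] CK j) (x : CK j) : σ (τ x) = τ (σ x) := by
  have : σ * τ = τ * σ := by
    apply (IsCyclotomicExtension.autEquivPow (CK j) (Polynomial.cyclotomic.irreducible_rat (n := 2 ^ (j + 1)) (by positivity))).injective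
    rw [map_mul, map_mul, mul_comm]
  exact congrArg (fun f => f x) this

/-- The square root of two. -/
noncomputable def r2 (j : ℕ) : CK j := zt j ^ (2 ^ (j - 2)) - (zt j ^ (2 ^ (j - 2))) ^ 3

lemma mu4 (j : ℕ) (hj : 2 ≤ j) : (zt j ^ (2 ^ (j - 2))) ^ 4 = -1 := by
  obtain ⟨t, rfl⟩ := Nat.exists_eq_add_of_le' hj
  rw [← zt_pow (t + 2), ← pow_mul, Nat.add_sub_cancel]
  congr 1; ring

lemma r2_sq (j : ℕ) (hj : 2 ≤ j) : r2 j ^ 2 = 2 := by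
  have := mu4 j hj
  unfold r2
  linear_combination (- 2 + (zt j ^ (2 ^ (j - 2)))^2) * this

lemma nonsq_abs {K : Type*} [Field K] [CharZero K] (σ τ : K ≃+* K) (μ β : K) (hcomm : ∀ x, σ (τ x) = τ (σ x))
    (hσμ : σ μ = -μ) (hτμ : τ μ * μ = 1) (hμ4 : μ ^ 4 = -1) (a2 : ℕ) (ha2 : a2 ≠ 0) : β ^ 2 ≠ a2 * (μ - μ ^ 3) := by
  intro hβ
  have hr2 : (μ - μ ^ 3) ^ 2 = 2 := by linear_combination (- 2 + μ ^ 2) * hμ4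
  set r := μ - μ ^ 3 with hr
  have hr0 : r ≠ 0 := by rintro h; rw [h] at hr2; norm_num at hr2
  have hβ0 : β ≠ 0 := by
    rintro rfl
    rw [zero_pow two_ne_zero] at hβ
    exact mul_ne_zero (by exact_mod_cast ha2) hr0 hβ.symm
  have hμ0 : μ ≠ 0 := by rintro h; rw [h] at hμ4; norm_num at hμ4
  have hσr : σ r = - r := by rw [hr, map_sub, map_pow, hσμ]; ring
  have h1 : σ β ^ 2 = - β ^ 2 := by rw [← map_pow, hβ, map_mul, hσr, map_natCast]; ring
  have h2 : τ β ^ 4 = β ^ 4 := by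
    have e : β ^ 4 = ((a2 ^ 2 * 2 : ℕ) : K) := by push_cast; rw [← hr2]; linear_combination (β ^ 2 + a2 * r) * hβ
    rw [← map_pow, e, map_natCast]
  have hI : (μ ^ 2) ^ 2 = -1 := by rw [← hμ4]; ring
  have hσI : σ (μ ^ 2) = μ ^ 2 := by rw [map_pow, hσμ]; ring
  have hτI : τ (μ ^ 2) = - μ ^ 2 := by
    have h : τ (μ ^ 2) * μ ^ 2 = 1 := by rw [map_pow, ← mul_pow, hτμ, one_pow]
    have h5 : μ ^ 2 ≠ 0 := pow_ne_zero _ hμ0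
    apply mul_right_cancel₀ h5
    rw [h]; linear_combination hI
  obtain ⟨u, hu⟩ : ∃ u, σ β = u * β := ⟨σ β / β, by field_simp⟩
  obtain ⟨v, hv⟩ : ∃ v, τ β = v * β := ⟨τ β / β, by field_simp⟩
  have hu2 : u ^ 2 = (μ ^ 2) ^ 2 := by
    rw [hu] at h1
    apply mul_right_cancel₀ (pow_ne_zero 2 hβ0)
    rw [hI]; linear_combination h1
  have hv4 : v ^ 4 = 1 := by
    rw [hv] at h2
    apply mul_right_cancel₀ (pow_ne_zero 4 hβ0)
    linear_combination h2
  have hτu : τ u = -u := by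
    rcases sq_eq_sq_iff_eq_or_eq_neg.mp hu2 with h | h
    · rw [h, hτI]
    · rw [h, map_neg, hτI]
  have hu0 : u ≠ 0 := by rintro h; rw [h] at hu2; rw [hI] at hu2; norm_num at hu2
  have hv0 : v ≠ 0 := by rintro h; rw [h] at hv4; norm_num at hv4
  have hσv : σ v = v := by
    have : (v ^ 2 - 1) * (v ^ 2 - (μ ^ 2) ^ 2) = 0 := by rw [hI]; linear_combination hv4
    rcases mul_eq_zero.mp this with h | h
    · rcases sq_eq_one_iff.mp (sub_eq_zero.mp h) with h | h <;> rw [h] <;> simp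
    · rcases sq_eq_sq_iff_eq_or_eq_neg.mp (sub_eq_zero.mp h) with h | h
      · rw [h, hσI]
      · rw [h, map_neg, hσI]
  have hc := hcomm β
  rw [hv, hu, map_mul, map_mul, hσv, hτu, hu, hv] at hc
  have : 2 * (u * v * β) = 0 := by linear_combination hc
  exact mul_ne_zero two_ne_zero (mul_ne_zero (mul_ne_zero hu0 hv0) hβ0) this

lemma nonsq_r2 (j : ℕ) (hj : 2 ≤ j) (a2 : ℕ) (ha2 : a2 ≠ 0) (β : CK j) : β ^ 2 ≠ a2 * r2 j := by
  obtain ⟨σ, hσ⟩ := gal_exists j 5 (by decide)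
  obtain ⟨τ, hτ⟩ := gal_exists j (2 ^ (j + 1) - 1) (Nat.Even.sub_odd (Nat.one_le_two_pow) ⟨2 ^ j, by ring⟩ odd_one)
  refine nonsq_abs (σ : CK j ≃+* CK j) (τ : CK j ≃+* CK j) (zt j ^ (2 ^ (j - 2))) β (gal_comm j σ τ) ?_ ?_ (mu4 j hj) a2 ha2
  · change σ _ = _
    rw [map_pow, hσ, ← pow_mul, mul_comm, pow_mul]
    linear_combination (zt j ^ (2 ^ (j - 2))) * mu4 j hj
  · change τ _ * _ = _
    rw [map_pow, hτ, ← mul_pow, ← pow_succ, Nat.sub_add_cancel Nat.one_le_two_pow, (zt_spec j).pow_eq_one, one_pow]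

lemma nonsq_small (j : ℕ) (hj : j ≤ 1) (a : ℕ) (ha : ¬ IsSquare a) (β : CK j) : β ^ 2 ≠ a := by
  intro hβ
  have haQ : ∀ x : ℚ, x ^ 2 ≠ a := by
    intro x hx
    exact ha (Rat.isSquare_natCast_iff.mp ⟨x, by rw [← hx]; ring⟩)
  have hβm : β ∈ Algebra.adjoin ℚ {zt j} := by rw [zt_adjoin]; trivial
  have hquad : ∃ c : ℚ, zt j ^ 2 = (c : CK j) ∧ ((∀ x : ℚ, zt j ≠ x) → c < 0) := by
    have hz := zt_pow j
    interval_cases j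
    · rw [pow_zero, pow_one] at hz
      exact ⟨1, by rw [hz]; simp, fun h => absurd (by rw [hz]; simp) (h (-1))⟩
    · exact ⟨-1, by simpa using hz, fun _ => by norm_num⟩
  obtain ⟨c, hc, hneg⟩ := hquad
  have : ∃ x y : ℚ, (x : CK j) + y * zt j = β := by
    clear hβ
    induction hβm using Algebra.adjoin_induction with
    | mem x hx => rw [Set.mem_singleton_iff] at hx; exact ⟨0, 1, by rw [hx]; simp⟩
    | algebraMap r => exact ⟨r, 0, by simp⟩
    | add x y _ _ hx hy =>
      obtain ⟨p, q, rfl⟩ := hx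
      obtain ⟨s, t, rfl⟩ := hy
      exact ⟨p + s, q + t, by push_cast; ring⟩
    | mul x y _ _ hx hy =>
      obtain ⟨p, q, rfl⟩ := hx
      obtain ⟨s, t, rfl⟩ := hy
      exact ⟨p * s + q * t * c, p * t + q * s, by push_cast; rw [← hc]; ring⟩
  obtain ⟨x, y, rfl⟩ := this
  by_cases hrat : ∀ x : ℚ, zt j ≠ x
  · have e : (2 * x * y : ℚ) * zt j = ((a - x ^ 2 - y ^ 2 * c : ℚ) : CK j) := by
      push_cast; rw [← hβ, ← hc]; ring
    have hxy : 2 * x * y = 0 := by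
      by_contra h
      have h' : ((2 * x * y : ℚ) : CK j) ≠ 0 := by exact_mod_cast h
      refine hrat ((a - x ^ 2 - y ^ 2 * c) / (2 * x * y)) ?_
      rw [Rat.cast_div, ← e]; field_simp
    rw [hxy] at e
    rw [Rat.cast_zero, zero_mul] at e
    have e' : (a : ℚ) - x ^ 2 - y ^ 2 * c = 0 := by exact_mod_cast e.symm
    have hy : y ≠ 0 := by
      rintro rfl
      exact haQ x (by linarith)
    have hx : x = 0 := by
      rcases mul_eq_zero.mp hxy with h | h
      · linarith
      · exact absurd h hy
    have h1 := hneg hrat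
    have : 0 < y ^ 2 := by positivity
    have ha0 : (0 : ℚ) ≤ a := by positivity
    rw [hx] at e'
    nlinarith
  · push Not at hrat
    obtain ⟨z, hz⟩ := hrat
    rw [hz] at hβ
    exact haQ (x + y * z) (by exact_mod_cast hβ)

lemma nonsq_odd (j a1 q : ℕ) (hq : q.Prime) (hq2 : q ≠ 2) (hqa : q ∣ a1) (hsf : Squarefree a1) (β : CK j) : β ^ 2 ≠ a1 := by
  intro hβ
  have ib : IsIntegral ℤ β := IsIntegral.of_pow (n := 2) (by positivity) (by rw [hβ]; exact isIntegral_algebraMap (x := (a1 : ℤ)) |> fun h => by simpa using h)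
  obtain ⟨b, rfl⟩ : ∃ z : 𝓞 (CK j), (z : CK j) = β := ⟨⟨β, ib⟩, rfl⟩
  have hb : b ^ 2 = a1 := by apply RingOfIntegers.ext; simpa using hβ
  have := Fact.mk hq
  have hqq := Nat.prime_iff_prime_int.mp hq
  have : (Ideal.span {(q : ℤ)}).IsPrime := (Ideal.span_singleton_prime hqq.ne_zero).mpr hqq
  have hmax : (Ideal.span {(q : ℤ)}).IsMaximal := this.isMaximal (by simpa using hq.ne_zero)
  obtain ⟨⟨P, hP, hPo⟩⟩ := (Ideal.span {(q : ℤ)}).nonempty_primesOver (S := 𝓞 (CK j))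
  have hram := IsCyclotomicExtension.Rat.ramificationIdx_eq_of_not_dvd q (CK j) P (m := 2 ^ (j + 1))
    (fun h => hq2 ((Nat.prime_dvd_prime_iff_eq hq Nat.prime_two).mp (hq.dvd_of_dvd_pow h)))
  have hmap : (Ideal.span {(q : ℤ)}).map (algebraMap ℤ (𝓞 (CK j))) = Ideal.span {(q : 𝓞 (CK j))} := by
    rw [Ideal.map_span]; simp
  have hmap0 : (Ideal.span {(q : ℤ)}).map (algebraMap ℤ (𝓞 (CK j))) ≠ ⊥ := by
    rw [hmap, Ne, Ideal.span_singleton_eq_bot]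
    exact_mod_cast hq.ne_zero
  rw [IsDedekindDomain.ramificationIdx_eq_multiplicity (Ideal.span {(q : ℤ)}) P hmap0] at hram
  have hqP : (q : 𝓞 (CK j)) ∈ P := by
    have h := (Ideal.mem_of_liesOver P (Ideal.span {(q : ℤ)}) (q : ℤ)).mp (Ideal.mem_span_singleton_self _)
    simpa using h
  obtain ⟨c, hc⟩ := hqa
  have hcop : IsCoprime (c : ℤ) (q : ℤ) := by
    rw [Nat.isCoprime_iff_coprime, Nat.coprime_comm, hq.coprime_iff_not_dvd]
    rintro ⟨d, rfl⟩
    have := hsf q ⟨d, by rw [hc]; ring⟩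
    exact hq.not_isUnit this
  obtain ⟨u, v, huv⟩ := hcop
  have hbP : b ∈ P := by
    refine hP.mem_of_pow_mem 2 ?_
    rw [hb, hc]; push_cast
    exact P.mul_mem_right _ hqP
  have hqP2 : (q : 𝓞 (CK j)) ∈ P ^ 2 := by
    have e : (q : 𝓞 (CK j)) = u * b ^ 2 + v * (q : 𝓞 (CK j)) ^ 2 := by
      have h : ((u * c + v * q : ℤ) : 𝓞 (CK j)) = 1 := by rw [huv]; simp
      push_cast at h
      rw [hb, hc]; push_cast
      linear_combination (- (q : 𝓞 (CK j))) * h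
    rw [e]
    exact add_mem ((P ^ 2).mul_mem_left _ (Ideal.pow_mem_pow hbP 2)) ((P ^ 2).mul_mem_left _ (Ideal.pow_mem_pow hqP 2))
  have hdvd : P ^ 2 ∣ (Ideal.span {(q : ℤ)}).map (algebraMap ℤ (𝓞 (CK j))) := by
    rw [Ideal.dvd_iff_le, hmap, Ideal.span_singleton_le_iff_mem]; exact hqP2
  have hfin : FiniteMultiplicity P ((Ideal.span {(q : ℤ)}).map (algebraMap ℤ (𝓞 (CK j)))) :=
    FiniteMultiplicity.of_not_isUnit (fun h => hP.ne_top (Ideal.isUnit_iff.mp h)) hmap0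
  have := hfin.le_multiplicity_of_pow_dvd hdvd
  omega
end QD

namespace QD
open MeasureTheory Filter Topology Set
open NumberField Ideal

lemma dens_generic (a j k : ℕ) (ha0 : a ≠ 0) (hk : k ≤ j + 1) (hns : k = 0 ∨ ∀ b : CK j, b ^ 2 ≠ a) :
    HasDens (SS a (j + 1) k) (1 / (2 ^ j * 2 ^ k)) := by
  have hirr : Irreducible (Polynomial.X ^ (2 ^ k) - Polynomial.C (a : CK j)) := by
    refine irr2 k _ ?_ hns
    by_cases h : k ≤ 1
    · exact Or.inl h
    · exact Or.inr (CK_I j (by omega))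
  obtain ⟨L, _, _, f, α, hα, hgen, hfr⟩ := exists_L (CK j) k (a : CK j) (zt j) (zt_adjoin j) hirr
  have := dens_L L a j k ha0 hk (f (zt j)) α (by rw [← map_pow, zt_pow]; simp) (by rw [hα]; simp) hgen
  rw [hfr, CK_finrank] at this
  push_cast at this
  exact this

lemma dens_two (a2 j k : ℕ) (ha2 : a2 ≠ 0) (hj : 2 ≤ j) (hk : k + 1 ≤ j + 1) :
    HasDens (SS (2 * a2 ^ 2) (j + 1) (k + 1)) (1 / (2 ^ j * 2 ^ k)) := by
  have hirr : Irreducible (Polynomial.X ^ (2 ^ k) - Polynomial.C (a2 * r2 j : CK j)) :=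
    irr2 k _ (Or.inr (CK_I j (by omega))) (Or.inr (nonsq_r2 j hj a2 ha2))
  obtain ⟨L, _, _, f, α, hα, hgen, hfr⟩ := exists_L (CK j) k (a2 * r2 j : CK j) (zt j) (zt_adjoin j) hirr
  have := dens_L L (2 * a2 ^ 2) j (k + 1) (by positivity) hk (f (zt j)) α (by rw [← map_pow, zt_pow]; simp) (by
    rw [pow_succ, pow_mul, hα, ← map_pow, mul_pow, r2_sq j hj, map_mul, map_pow, map_natCast, map_ofNat]; push_cast; ring) hgen
  rw [hfr, CK_finrank] at this
  push_cast at this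
  exact this

theorem densA (a a1 a2 j k : ℕ) (ha : 0 < a) (hfact : a = a1 * a2 ^ 2) (hsf : Squarefree a1) (hsq : ¬ IsSquare a)
    (h2 : a1 ≠ 2) (hk : k ≤ j + 1) : HasDens (SS a (j + 1) k) (1 / (2 ^ j * 2 ^ k)) := by
  refine dens_generic a j k ha.ne' hk (Or.inr ?_)
  have ha2 : a2 ≠ 0 := by rintro rfl; simp at hfact; omega
  obtain ⟨q, hq, hq2, hqa⟩ : ∃ q : ℕ, q.Prime ∧ q ≠ 2 ∧ q ∣ a1 := by
    by_contra! hcon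
    have h1 : a1 ≠ 1 := by rintro rfl; exact hsq ⟨a2, by rw [hfact]; ring⟩
    obtain ⟨q, hq, hqa⟩ := Nat.exists_prime_and_dvd h1
    have hq2 : q = 2 := by
      by_contra h
      exact hcon q hq h hqa
    subst hq2
    obtain ⟨c, hc⟩ := hqa
    have hc1 : c ≠ 1 := by rintro rfl; exact h2 (by rw [hc])
    obtain ⟨q, hq', hqc⟩ := Nat.exists_prime_and_dvd hc1
    have hq2 : q = 2 := by
      by_contra h
      exact hcon q hq' h (by rw [hc]; exact hqc.mul_left 2)
    subst hq2
    have := hsf 2 (by rw [hc]; exact mul_dvd_mul_left 2 hqc)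
    exact hq.not_isUnit this
  intro b hb
  refine nonsq_odd j a1 q hq hq2 hqa hsf (b / a2) ?_
  have : (a2 : CK j) ≠ 0 := by exact_mod_cast ha2
  rw [div_pow, hb, hfact]; push_cast; field_simp

theorem densB (a2 j k : ℕ) (ha2 : a2 ≠ 0) (hns : ¬ IsSquare (2 * a2 ^ 2)) (hk : k ≤ j + 1) :
    HasDens (SS (2 * a2 ^ 2) (j + 1) k) (if 2 ≤ j ∧ 1 ≤ k then 1 / (2 ^ j * 2 ^ (k - 1)) else 1 / (2 ^ j * 2 ^ k)) := by
  split_ifs with h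
  · obtain ⟨t, rfl⟩ := Nat.exists_eq_add_of_le' h.2
    rw [Nat.add_sub_cancel]
    exact dens_two a2 j t ha2 h.1 hk
  · refine dens_generic _ j k (by positivity) hk ?_
    rcases Nat.eq_zero_or_pos k with h0 | h0
    · exact Or.inl h0
    · exact Or.inr (nonsq_small j (by omega) _ hns)
end QD

namespace QD
open Filter Topology Set

def pst (S : ℕ → Prop) (n : ℕ) : Set ℕ := {p | p.Prime ∧ p ≤ n ∧ S p}

lemma pst_finite (S : ℕ → Prop) (n : ℕ) : (pst S n).Finite :=
  (Set.finite_Iic n).subset fun _ h => h.2.1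

lemma cnt_eq (S : ℕ → Prop) (x : ℝ) : cnt S x = ((pst S ⌊x⌋₊).ncard : ℝ) := by
  unfold cnt
  rw [← Set.ncard_coe_finset]
  congr 2
  ext p
  simp only [Finset.coe_filter, Finset.mem_Icc, Set.mem_setOf_eq, pst]
  constructor
  · rintro ⟨h1, h2, h3⟩; exact ⟨h2, h1.2, h3⟩
  · rintro ⟨h1, h2, h3⟩; exact ⟨⟨h1.one_lt.le, h2⟩, h1, h3⟩

lemma cnt_mono {S T : ℕ → Prop} (h : ∀ p, p.Prime → S p → T p) (x : ℝ) : cnt S x ≤ cnt T x := by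
  rw [cnt_eq, cnt_eq]
  exact Nat.cast_le.mpr <| Set.ncard_le_ncard (s := pst S _) (t := pst T _) (fun p hp => ⟨hp.1, hp.2.1, h p hp.1 hp.2.2⟩) (pst_finite T _)

lemma cnt_or {S T : ℕ → Prop} (h : ∀ p, S p → ¬ T p) (x : ℝ) : cnt (fun p => S p ∨ T p) x = cnt S x + cnt T x := by
  rw [cnt_eq, cnt_eq, cnt_eq, ← Nat.cast_add, ← Set.ncard_union_eq ?_ (pst_finite _ _) (pst_finite _ _)]
  · congr 2
    ext p
    simp only [pst, Set.mem_union, Set.mem_setOf_eq]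
    tauto
  · rw [Set.disjoint_left]
    exact fun p hp hq => h p hp.2.2 hq.2.2

lemma HasDens.or {S T : ℕ → Prop} {d e : ℝ} (hS : HasDens S d) (hT : HasDens T e) (h : ∀ p, S p → ¬ T p) :
    HasDens (fun p => S p ∨ T p) (d + e) := by
  refine (Tendsto.add hS hT).congr fun x => ?_
  rw [cnt_or h, add_div]

lemma HasDens.congr {S T : ℕ → Prop} {d : ℝ} (hS : HasDens S d) (h : ∀ p, p.Prime → (S p ↔ T p)) : HasDens T d := by
  refine Tendsto.congr (fun x => ?_) hS
  rw [le_antisymm (cnt_mono (fun p hp => (h p hp).mp) x) (cnt_mono (fun p hp => (h p hp).mpr) x)]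

lemma HasDens.diff {S T : ℕ → Prop} {d e : ℝ} (hS : HasDens S d) (hT : HasDens T e) (h : ∀ p, p.Prime → T p → S p) :
    HasDens (fun p => S p ∧ ¬ T p) (d - e) := by
  refine (Tendsto.sub hS hT).congr fun x => ?_
  have e1 := cnt_or (S := T) (T := fun p => S p ∧ ¬ T p) (fun p h1 h2 => h2.2 h1) x
  have e2 : cnt (fun p => T p ∨ (S p ∧ ¬ T p)) x = cnt S x :=
    le_antisymm (cnt_mono (fun p hp h1 => h1.elim (h p hp) (fun h2 => h2.1)) x) (cnt_mono (fun p hp h1 => by tauto) x)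
  rw [← sub_div, ← e2, e1]; ring

lemma dens_true : HasDens (fun _ => True) 1 := dens_of_tht _ _ theta_asymp

lemma cnt_true_tendsto : Tendsto (cnt (fun _ => True)) atTop atTop := by
  have h := cnt_asymp _ 1 theta_asymp
  have h2 : Tendsto (fun x : ℝ => x / Real.log x) atTop atTop := by
    have h3 : Tendsto (fun x : ℝ => Real.log x / x) atTop (𝓝[>] 0) := by
      rw [tendsto_nhdsWithin_iff]
      refine ⟨Real.isLittleO_log_id_atTop.tendsto_div_nhds_zero, ?_⟩
      filter_upwards [eventually_gt_atTop 1] with x hx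
      have := Real.log_pos hx
      exact div_pos this (by linarith)
    refine h3.inv_tendsto_nhdsGT_zero.congr fun x => ?_
    simp
  refine (h.pos_mul_atTop one_pos h2).congr' ?_
  filter_upwards [eventually_gt_atTop 1] with x hx
  have := Real.log_pos hx
  field_simp

lemma dens_fin (m : ℕ) (hm : m ≠ 0) : HasDens (fun p => p ∣ m) 0 := by
  refine squeeze_zero (g := fun x => (m.divisors.card : ℝ) / cnt (fun _ => True) x) (fun x => div_nonneg (cnt_nonneg _ _) (cnt_nonneg _ _)) (fun x => ?_)
    (tendsto_const_nhds.div_atTop cnt_true_tendsto)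
  have : cnt (fun p => p ∣ m) x ≤ m.divisors.card := by
    rw [cnt_eq, ← Set.ncard_coe_finset]
    exact Nat.cast_le.mpr <| Set.ncard_le_ncard (s := pst (fun p => p ∣ m) ⌊x⌋₊) (t := (m.divisors : Set ℕ)) (fun p hp => Finset.mem_coe.mpr (Nat.mem_divisors.mpr ⟨hp.2.2, hm⟩)) (Finset.finite_toSet _)
  have h0 := cnt_nonneg (fun _ => True) x
  gcongr

lemma HasDens.off {S : ℕ → Prop} {d : ℝ} (hS : HasDens S d) (m : ℕ) (hm : m ≠ 0) : HasDens (fun p => S p ∧ ¬ p ∣ m) d := by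
  have h1 : HasDens (fun p => S p ∧ p ∣ m) 0 := by
    refine squeeze_zero (fun x => div_nonneg (cnt_nonneg _ _) (cnt_nonneg _ _)) (fun x => ?_) (dens_fin m hm)
    have h0 := cnt_nonneg (fun _ => True) x
    have := cnt_mono (S := fun p => S p ∧ p ∣ m) (T := fun p => p ∣ m) (fun p _ h => h.2) x
    gcongr
  have h2 := HasDens.diff hS h1 (fun p _ h => h.1)
  rw [sub_zero] at h2
  refine h2.congr fun p _ => ?_
  tauto

lemma HasDens.squeeze {S : ℕ → Prop} {A T : ℕ → ℕ → Prop} {d : ℝ} {α β : ℕ → ℝ} (hA : ∀ N, HasDens (A N) (α N)) (hT : ∀ N, HasDens (T N) (β N))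
    (h1 : ∀ N p, A N p → S p) (h2 : ∀ N p, S p → A N p ∨ T N p) (hα : Tendsto α atTop (𝓝 d)) (hβ : Tendsto β atTop (𝓝 0)) : HasDens S d := by
  rw [HasDens, Metric.tendsto_nhds]
  intro ε hε
  obtain ⟨N, hN1, hN2⟩ := ((Metric.tendsto_nhds.mp hα (ε / 4) (by positivity)).and (Metric.tendsto_nhds.mp hβ (ε / 4) (by positivity))).exists
  filter_upwards [Metric.tendsto_nhds.mp (hA N) (ε / 4) (by positivity), Metric.tendsto_nhds.mp (hT N) (ε / 4) (by positivity)] with x hx1 hx2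
  have h0 := cnt_nonneg (fun _ => True) x
  have l1 : cnt (A N) x / cnt (fun _ => True) x ≤ cnt S x / cnt (fun _ => True) x := by
    have := cnt_mono (fun p _ => h1 N p) x
    gcongr
  have l2 : cnt S x / cnt (fun _ => True) x ≤ cnt (A N) x / cnt (fun _ => True) x + cnt (T N) x / cnt (fun _ => True) x := by
    rw [← add_div]
    have : cnt S x ≤ cnt (A N) x + cnt (T N) x := by
      have e1 := cnt_or (S := A N) (T := fun p => T N p ∧ ¬ A N p) (fun p h1 h2 => h2.2 h1) x
      have e2 := cnt_mono (S := fun p => T N p ∧ ¬ A N p) (T := T N) (fun p _ h => h.1) x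
      have e3 := cnt_mono (S := S) (T := fun p => A N p ∨ (T N p ∧ ¬ A N p)) (fun p _ h => by have := h2 N p h; tauto) x
      linarith
    gcongr
  rw [Real.dist_eq, abs_lt] at *
  constructor <;> linarith [hx1.1, hx1.2, hx2.1, hx2.2, hN1.1, hN1.2, hN2.1, hN2.2]

/-- The union over `i`. -/
def WW (a s N p : ℕ) : Prop := ∃ i < N, SS a (i + 1) (i + 1 - s) p ∧ ¬ SS a (i + 2) (i + 1 - s) p
def WInf (a s p : ℕ) : Prop := ∃ i, SS a (i + 1) (i + 1 - s) p ∧ ¬ SS a (i + 2) (i + 1 - s) p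

lemma SS_mono {a j j' k p : ℕ} (h : j ≤ j') (hS : SS a j' k p) : SS a j k p :=
  ⟨(pow_dvd_pow 2 h).trans hS.1, hS.2⟩

lemma WW_dens (a s : ℕ) (d : ℕ → ℕ → ℝ) (hd : ∀ i k, k ≤ i + 1 → HasDens (SS a (i + 1) k) (d i k)) (N : ℕ) :
    HasDens (WW a s N) (∑ i ∈ Finset.range N, (d i (i + 1 - s) - d (i + 1) (i + 1 - s))) := by
  induction N with
  | zero =>
    have h := dens_fin 1 one_ne_zero
    rw [Finset.sum_range_zero]
    refine h.congr fun p hp => ?_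
    simp [WW, hp.ne_one]
  | succ N ih =>
    rw [Finset.sum_range_succ]
    have h1 := (hd N (N + 1 - s) (by omega)).diff (hd (N + 1) (N + 1 - s) (by omega)) (fun p _ h => SS_mono (by omega) h)
    refine (ih.or h1 ?_).congr fun p _ => ?_
    · rintro p ⟨i, hi, h2, h3⟩ ⟨h4, -⟩
      exact h3 ⟨(pow_dvd_pow 2 (by omega)).trans h4.1, h2.2⟩
    · constructor
      · rintro (⟨i, hi, h⟩ | h)
        · exact ⟨i, by omega, h⟩
        · exact ⟨N, by omega, h⟩
      · rintro ⟨i, hi, h⟩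
        rcases Nat.lt_succ_iff_lt_or_eq.mp hi with h5 | rfl
        · exact Or.inl ⟨i, h5, h⟩
        · exact Or.inr h

lemma WInf_dens (a s : ℕ) (d : ℕ → ℕ → ℝ) (hd : ∀ i k, k ≤ i + 1 → HasDens (SS a (i + 1) k) (d i k)) (δ : ℝ)
    (h : Tendsto (fun N => ∑ i ∈ Finset.range N, (d i (i + 1 - s) - d (i + 1) (i + 1 - s))) atTop (𝓝 δ))
    (h0 : Tendsto (fun N => d N 0) atTop (𝓝 0)) : HasDens (WInf a s) δ := by
  refine HasDens.squeeze (WW_dens a s d hd) (fun N => hd N 0 (by omega)) ?_ ?_ h h0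
  · rintro N p ⟨i, -, h⟩; exact ⟨i, h⟩
  · rintro N p ⟨i, h⟩
    by_cases hi : i < N
    · exact Or.inl ⟨i, hi, h⟩
    · exact Or.inr ⟨(pow_dvd_pow 2 (by omega)).trans h.1.1, (a : ZMod p), by simp⟩
end QD

namespace QD
open Filter Topology Set

lemma WInf_iff (a s p : ℕ) (hs : s ≤ 1) (hp : p.Prime) (hp2 : p ≠ 2) (hpa : ¬ p ∣ a) :
    WInf a s p ↔ ¬ 2 ^ (s + 1) ∣ orderOf (a : ZMod p) := by
  haveI : Fact p.Prime := ⟨hp⟩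
  have ha0 : (a : ZMod p) ≠ 0 := by rwa [Ne, ZMod.natCast_eq_zero_iff]
  have hodd : p % 2 = 1 := hp.eq_two_or_odd.resolve_left hp2
  have hp1 : p - 1 ≠ 0 := by have := hp.two_le; omega
  constructor
  · rintro ⟨i, ⟨h1, c, hc⟩, h2⟩ h3
    have h4 : ¬ 2 ^ (i + 2) ∣ p - 1 := fun h => h2 ⟨h, c, hc⟩
    obtain ⟨t, ht⟩ := h1
    have hc0 : c ≠ 0 := by
      rintro rfl
      by_cases h : i + 1 - s = 0
      · rw [h] at hc; simp at hc; exact ha0 hc.symm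
      · rw [zero_pow (by positivity)] at hc; exact ha0 hc.symm
    have h5 : (a : ZMod p) ^ (2 ^ s * t) = 1 := by
      rw [← hc, ← pow_mul, ← mul_assoc, ← pow_add, show i + 1 - s + s = i + 1 by omega, ← ht]
      exact ZMod.pow_card_sub_one_eq_one hc0
    have h6 := h3.trans (orderOf_dvd_of_pow_eq_one h5)
    rw [pow_succ] at h6
    have h7 := Nat.dvd_of_mul_dvd_mul_left (by positivity) h6
    apply h4
    rw [ht, pow_succ]
    exact mul_dvd_mul_left _ h7
  · intro h
    obtain ⟨j, t, ht, hjt⟩ := Nat.exists_eq_two_pow_mul_odd hp1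
    obtain ⟨i, rfl⟩ : ∃ i, j = i + 1 := by
      cases j with
      | zero => rw [pow_zero, one_mul] at hjt; rw [← hjt] at ht; obtain ⟨w, hw⟩ := ht; omega
      | succ i => exact ⟨i, rfl⟩
    have hno : ¬ 2 ^ (i + 2) ∣ p - 1 := by
      rw [hjt, show i + 2 = (i + 1) + 1 by omega, pow_succ]
      intro h
      have := Nat.dvd_of_mul_dvd_mul_left (by positivity) h
      obtain ⟨w, hw⟩ := ht; omega
    refine ⟨i, ⟨⟨t, hjt⟩, ?_⟩, fun h => hno h.1⟩
    have ho : orderOf (a : ZMod p) ∣ 2 ^ (i + 1) * t := by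
      rw [← hjt]; exact orderOf_dvd_of_pow_eq_one (ZMod.pow_card_sub_one_eq_one ha0)
    have ho0 : orderOf (a : ZMod p) ≠ 0 := by
      intro h0; rw [h0] at h; exact h (dvd_zero _)
    obtain ⟨v, r, hr, hvr⟩ := Nat.exists_eq_two_pow_mul_odd ho0
    have hv : v ≤ s := by
      by_contra hv
      apply h; rw [hvr]
      exact (pow_dvd_pow 2 (by omega)).trans (dvd_mul_right _ _)
    have hrt : r ∣ t := by
      have : r ∣ 2 ^ (i + 1) * t := (Dvd.intro_left _ hvr.symm).trans ho
      exact (Nat.Coprime.pow_right _ (Nat.coprime_two_right.mpr hr)).dvd_of_dvd_mul_left this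
    have h5 : (a : ZMod p) ^ (2 ^ s * t) = 1 := by
      rw [← orderOf_dvd_iff_pow_eq_one, hvr]
      exact mul_dvd_mul (pow_dvd_pow 2 hv) hrt
    obtain ⟨g, hg⟩ := IsCyclic.exists_generator (α := (ZMod p)ˣ)
    have hgo : orderOf g = p - 1 := by
      rw [orderOf_eq_card_of_forall_mem_zpowers hg, Nat.card_eq_fintype_card, ZMod.card_units]
    obtain ⟨e, he⟩ := (mem_powers_iff_mem_zpowers.mpr (hg (Units.mk0 _ ha0)))
    simp only at he
    have h6 : g ^ (e * (2 ^ s * t)) = 1 := by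
      rw [pow_mul, he]; ext; simpa using h5
    have h7 := orderOf_dvd_of_pow_eq_one h6
    rw [hgo, hjt, show i + 1 = (i + 1 - s) + s by omega, pow_add, mul_assoc] at h7
    have htp : 0 < t := ht.pos
    obtain ⟨f, hf⟩ := Nat.dvd_of_mul_dvd_mul_right (by positivity) h7
    refine ⟨((g ^ f : (ZMod p)ˣ) : ZMod p), ?_⟩
    have : g ^ (f * 2 ^ (i + 1 - s)) = Units.mk0 _ ha0 := by rw [← he, hf, mul_comm]
    rw [← Units.val_pow_eq_pow_val, ← pow_mul, this]; rfl

lemma limA (s : ℕ) (hs : s ≤ 1) : Tendsto (fun N => ∑ i ∈ Finset.range N,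
    ((1 : ℝ) / (2 ^ i * 2 ^ (i + 1 - s)) - 1 / (2 ^ (i + 1) * 2 ^ (i + 1 - s)))) atTop (𝓝 (2 ^ s / 3)) := by
  have key : ∀ N, ∑ i ∈ Finset.range N,
    ((1 : ℝ) / (2 ^ i * 2 ^ (i + 1 - s)) - 1 / (2 ^ (i + 1) * 2 ^ (i + 1 - s))) = 2 ^ s / 3 * (1 - (1 / 4) ^ N) := by
    intro N
    induction N with
    | zero => simp
    | succ n ih =>
      rw [Finset.sum_range_succ, ih]
      have h4 : ((1 : ℝ) / 4) ^ n = 1 / (2 ^ n * 2 ^ n) := by rw [← mul_pow, one_div_pow]; norm_num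
      rw [pow_succ (1 / 4 : ℝ), h4]
      interval_cases s
      · rw [show n + 1 - 0 = n + 1 by omega]; field_simp; ring
      · rw [show n + 1 - 1 = n by omega]; field_simp; ring
  simp_rw [key]
  have h := (tendsto_pow_atTop_nhds_zero_of_lt_one (r := (1 / 4 : ℝ)) (by norm_num) (by norm_num)).const_sub 1
  simpa using h.const_mul ((2 : ℝ) ^ s / 3)

noncomputable def dB (i k : ℕ) : ℝ := if 2 ≤ i ∧ 1 ≤ k then 1 / (2 ^ i * 2 ^ (k - 1)) else 1 / (2 ^ i * 2 ^ k)

lemma limB (s : ℕ) (hs : s ≤ 1) : Tendsto (fun N => ∑ i ∈ Finset.range N,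
    (dB i (i + 1 - s) - dB (i + 1) (i + 1 - s))) atTop (𝓝 (2 ^ s * 7 / 24)) := by
  have key : ∀ N, ∑ i ∈ Finset.range (N + 2),
    (dB i (i + 1 - s) - dB (i + 1) (i + 1 - s)) = 2 ^ s * 7 / 24 - 2 ^ s / 24 * (1 / 4) ^ N := by
    intro N
    induction N with
    | zero =>
      interval_cases s <;> simp [Finset.sum_range_succ, dB] <;> norm_num
    | succ n ih =>
      rw [show n + 1 + 2 = (n + 2) + 1 by omega, Finset.sum_range_succ, ih]
      have h4 : ((1 : ℝ) / 4) ^ n = 1 / (2 ^ n * 2 ^ n) := by rw [← mul_pow, one_div_pow]; norm_num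
      rw [pow_succ (1 / 4 : ℝ), h4, dB, dB, if_pos (by omega), if_pos (by omega)]
      interval_cases s
      · rw [show n + 2 + 1 - 0 - 1 = n + 2 by omega]; field_simp; ring
      · rw [show n + 2 + 1 - 1 - 1 = n + 1 by omega]; field_simp; ring
  rw [← tendsto_add_atTop_iff_nat 2]
  simp_rw [key]
  have h := (tendsto_pow_atTop_nhds_zero_of_lt_one (r := (1 / 4 : ℝ)) (by norm_num) (by norm_num)).const_mul ((2 : ℝ) ^ s / 24)
  simpa using h.const_sub ((2 : ℝ) ^ s * 7 / 24)

lemma lim0 : Tendsto (fun N : ℕ => (1 : ℝ) / (2 ^ N * 2 ^ 0)) atTop (𝓝 0) := by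
  have h := tendsto_pow_atTop_nhds_zero_of_lt_one (r := (1 / 2 : ℝ)) (by norm_num) (by norm_num)
  refine h.congr fun n => ?_
  simp

lemma final (a : ℕ) (ha : a ≠ 0) (d : ℕ → ℕ → ℝ) (hd : ∀ i k, k ≤ i + 1 → HasDens (SS a (i + 1) k) (d i k)) (δ : ℝ)
    (h0 : Tendsto (fun N => d N 0) atTop (𝓝 0))
    (h : ∀ s ≤ 1, Tendsto (fun N => ∑ i ∈ Finset.range N, (d i (i + 1 - s) - d (i + 1) (i + 1 - s))) atTop (𝓝 (2 ^ s * δ))) :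
    HasDens (fun p => p ≠ 2 ∧ ¬ p ∣ a ∧ orderOf (a : ZMod p) % 4 = 0) (1 - 2 * δ) ∧
    HasDens (fun p => p ≠ 2 ∧ ¬ p ∣ a ∧ orderOf (a : ZMod p) % 4 = 2) δ := by
  have m0 : 2 * a ≠ 0 := by omega
  have A0 := (WInf_dens a 0 d hd _ (h 0 (by omega)) h0).off (2 * a) m0
  have A1 := (WInf_dens a 1 d hd _ (h 1 (by omega)) h0).off (2 * a) m0
  have AT := dens_true.off (2 * a) m0
  have hoff : ∀ p : ℕ, p.Prime → (¬ p ∣ 2 * a ↔ p ≠ 2 ∧ ¬ p ∣ a) := by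
    intro p hp
    rw [hp.dvd_mul, not_or, Nat.prime_dvd_prime_iff_eq hp Nat.prime_two]
  have B0 : HasDens (fun p => (p ≠ 2 ∧ ¬ p ∣ a) ∧ ¬ 2 ∣ orderOf (a : ZMod p)) (2 ^ 0 * δ) := by
    refine A0.congr fun p hp => ?_
    rw [hoff p hp, and_comm]
    refine and_congr_right fun hh => ?_
    rw [WInf_iff a 0 p (by omega) hp hh.1 hh.2]; norm_num
  have B1 : HasDens (fun p => (p ≠ 2 ∧ ¬ p ∣ a) ∧ ¬ 4 ∣ orderOf (a : ZMod p)) (2 ^ 1 * δ) := by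
    refine A1.congr fun p hp => ?_
    rw [hoff p hp, and_comm]
    refine and_congr_right fun hh => ?_
    rw [WInf_iff a 1 p (by omega) hp hh.1 hh.2]; norm_num
  constructor
  · have C := AT.diff B1 (fun p hp hh => ⟨trivial, (hoff p hp).mpr hh.1⟩)
    rw [pow_one] at C
    refine C.congr fun p hp => ?_
    rw [hoff p hp, Nat.dvd_iff_mod_eq_zero (m := 4)]
    tauto
  · have C := B1.diff B0 (fun p hp hh => ⟨hh.1, fun h4 => hh.2 ((by norm_num : 2 ∣ 4).trans h4)⟩)
    rw [pow_one, pow_zero, show 2 * δ - 1 * δ = δ by ring] at C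
    refine C.congr fun p hp => ?_
    have : orderOf (a : ZMod p) % 4 = 2 ↔ ¬ 4 ∣ orderOf (a : ZMod p) ∧ 2 ∣ orderOf (a : ZMod p) := by omega
    rw [this]
    tauto

lemma cnt_real (S : ℕ → Prop) (x : ℝ) : cnt S x = (Set.ncard {p : ℕ | p.Prime ∧ (p : ℝ) ≤ x ∧ S p} : ℝ) := by
  rw [cnt_eq]
  congr 2
  ext p
  simp only [pst, Set.mem_setOf_eq]
  refine and_congr_right fun hp => ?_
  rw [Nat.le_floor_iff' hp.ne_zero]

lemma finalA (a a1 a2 : ℕ) (ha : 0 < a) (hfact : a = a1 * a2 ^ 2) (hsf : Squarefree a1) (hsq : ¬ IsSquare a) (h2 : a1 ≠ 2) :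
    HasDens (fun p => p ≠ 2 ∧ ¬ p ∣ a ∧ orderOf (a : ZMod p) % 4 = 0) (1 / 3) ∧
    HasDens (fun p => p ≠ 2 ∧ ¬ p ∣ a ∧ orderOf (a : ZMod p) % 4 = 2) (1 / 3) := by
  have := final a ha.ne' (fun i k => 1 / (2 ^ i * 2 ^ k)) (fun i k hk => densA a a1 a2 i k ha hfact hsf hsq h2 hk) (1 / 3) lim0
    (fun s hs => by rw [mul_one_div]; exact limA s hs)
  norm_num at this ⊢
  exact this

lemma finalB (a a2 : ℕ) (ha : 0 < a) (hfact : a = 2 * a2 ^ 2) (hsq : ¬ IsSquare a) :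
    HasDens (fun p => p ≠ 2 ∧ ¬ p ∣ a ∧ orderOf (a : ZMod p) % 4 = 0) (5 / 12) ∧
    HasDens (fun p => p ≠ 2 ∧ ¬ p ∣ a ∧ orderOf (a : ZMod p) % 4 = 2) (7 / 24) := by
  subst hfact
  have ha2 : a2 ≠ 0 := by rintro rfl; simp at ha
  have := final (2 * a2 ^ 2) ha.ne' dB (fun i k hk => densB a2 i k ha2 hsq hk) (7 / 24) (by simpa [dB] using lim0)
    (fun s hs => by rw [← mul_div_assoc]; exact limB s hs)
  rw [show (1 : ℝ) - 2 * (7 / 24) = 5 / 12 by norm_num] at this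
  exact this
end QD

lemma QD.Qcount_eq (a : ℕ) (x : ℝ) (l : ℕ) :
    (Qcount a x l : ℝ) = QD.cnt (fun p => p ≠ 2 ∧ ¬ p ∣ a ∧ orderOf (a : ZMod p) % 4 = l) x := by
  rw [QD.cnt_real, Qcount]
  congr 2
  ext p
  simp only [Set.mem_ofPred_eq]
  tauto

lemma QD.primePi_eq (x : ℝ) : (primePi x : ℝ) = QD.cnt (fun _ => True) x := by
  rw [QD.cnt_real, primePi]
  congr 2
  ext p
  simp only [Set.mem_ofPred_eq]
  tauto

open Filter in
/-- Unconditionally, the natural densities `δ_l = lim #Q_a(x;4,l)/π(x)` exist for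
`l = 0, 2`, with `δ_0 = δ_2 = 1/3` if `a1 ≠ 2`, and `δ_0 = 5/12`, `δ_2 = 7/24`
if `a1 = 2`. -/
theorem Qcount_density_zero_two (a a1 a2 : ℕ) (ha : 0 < a)
    (hpow : ∀ h, 2 ≤ h → ¬∃ b : ℕ, b ^ h = a)
    (hfact : a = a1 * a2 ^ 2) (hsf : Squarefree a1) :
    (a1 ≠ 2 →
      Tendsto (fun x : ℝ => (Qcount a x 0 : ℝ) / (primePi x : ℝ)) atTop (nhds (1 / 3)) ∧
      Tendsto (fun x : ℝ => (Qcount a x 2 : ℝ) / (primePi x : ℝ)) atTop (nhds (1 / 3))) ∧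
    (a1 = 2 →
      Tendsto (fun x : ℝ => (Qcount a x 0 : ℝ) / (primePi x : ℝ)) atTop (nhds (5 / 12)) ∧
      Tendsto (fun x : ℝ => (Qcount a x 2 : ℝ) / (primePi x : ℝ)) atTop (nhds (7 / 24))) := by
  have hsq : ¬ IsSquare a := by
    rintro ⟨b, hb⟩
    exact hpow 2 le_rfl ⟨b, by rw [hb, sq]⟩
  simp only [QD.Qcount_eq, QD.primePi_eq]
  constructor
  · intro h2
    exact QD.finalA a a1 a2 ha hfact hsf hsq h2
  · intro h2
    subst h2
    exact QD.finalB a a2 ha hfact hsq
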